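/- The Riemann hypothesis is true if and only if there exists t₀ ≥ 0 such that the equality ‖𝔖_t‖²_{L²(ℝ)} = -2 g(t) holds for all t ≥ t₀. -/

import Mathlib

open MeasureTheory Real Complex Filter Set

noncomputable section

/-- The von Mangoldt function. -/
def vM (n : ℕ) : ℝ := ArithmeticFunction.vonMangoldt n

/-- The logarithmic derivative `Γ'/Γ` of the complex Gamma function. -/
def digamma (s : ℂ) : ℂ := deriv Complex.Gamma s / Complex.Gamma s

/-- The logarithmic derivative `Γ'/Γ` of the real Gamma function. -/
def digammaR (x : ℝ) : ℝ := deriv Real.Gamma x / Real.Gamma x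

/-- The Hurwitz–Lerch zeta function `Φ(z,s,a) = ∑_{n≥0} z^n (n+a)^{-s}`, real version. -/
def PhiR (z s a : ℝ) : ℝ := ∑' n : ℕ, z ^ n / ((n : ℝ) + a) ^ s

/-- The Hurwitz–Lerch zeta function `Φ(z,s,a) = ∑_{n≥0} z^n (n+a)^{-s}`, complex version. -/
def PhiC (z s a : ℂ) : ℂ := ∑' n : ℕ, z ^ n / ((n : ℂ) + a) ^ s

/-- The screw function `g(t)`, extended evenly to all of `ℝ`. -/
def g (t : ℝ) : ℝ :=
  -4 * (Real.exp (|t| / 2) + Real.exp (-|t| / 2) - 2)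
    - |t| / 2 * (digammaR (1 / 4) - Real.log π)
    - (1 / 4) * (PhiR 1 2 (1 / 4) - Real.exp (-|t| / 2) * PhiR (Real.exp (-2 * |t|)) 2 (1 / 4))
    + ∑ n ∈ Finset.Icc 1 ⌊Real.exp |t|⌋₊, vM n / Real.sqrt n * (|t| - Real.log n)

/-- `Z(s) = π^{-s/2} Γ(s/2) ζ(s)`. -/
def Zfun (s : ℂ) : ℂ := (π : ℂ) ^ (-s / 2) * Complex.Gamma (s / 2) * riemannZeta s

/-- The function `𝔓_t(z)` (for `t ≥ 0`). -/
def Pfrak (t : ℝ) (z : ℂ) : ℂ :=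
  4 * ((Real.exp (t / 2) : ℂ) - 1) / (1 - 2 * I * z)
    + 4 * ((Real.exp (-t / 2) : ℂ) - 1) / (1 + 2 * I * z)
    - ∑ n ∈ Finset.Icc 1 ⌊Real.exp t⌋₊,
        ((vM n / Real.sqrt n : ℝ) : ℂ) *
          ((Complex.exp (I * z * ((t : ℝ) - Real.log n)) - 1) / (I * z))
    + (Complex.exp (I * t * z) - 1) / (I * z) *
        (deriv Zfun (1 / 2 - I * z) / Zfun (1 / 2 - I * z) - (1 / 2) * (Real.log π : ℂ)
          + (1 / 2) * _root_.digamma (1 / 4 + I * z / 2))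
    - 1 / (2 * I * z) * (_root_.digamma (1 / 4) - _root_.digamma (1 / 4 + I * z / 2))
    - 1 / (2 * I * z) * (Real.exp (-t / 2) : ℂ) *
        (PhiC (Real.exp (-2 * t)) 1 (1 / 4) - PhiC (Real.exp (-2 * t)) 1 ((1 / 2 + I * z) / 2))

/-- The Riemann xi function `ξ(s) = (1/2)s(s-1)π^{-s/2}Γ(s/2)ζ(s)`. -/
def xi (s : ℂ) : ℂ := s * (s - 1) / 2 * (π : ℂ) ^ (-s / 2) * Complex.Gamma (s / 2) * riemannZeta s

/-- `E(z) = ξ(1/2-iz) + ξ'(1/2-iz)`. -/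
def Efun (z : ℂ) : ℂ := xi (1 / 2 - I * z) + deriv xi (1 / 2 - I * z)

/-- `Θ(z) = conj(E(conj z)) / E(z)`. -/
def Theta (z : ℂ) : ℂ := (starRingEnd ℂ) (Efun ((starRingEnd ℂ) z)) / Efun z

/-- The screw line `𝔖_t(z)`, extended to negative `t` by `𝔖_{-t} = 𝔖_t`. -/
def Sfrak (t : ℝ) (z : ℂ) : ℂ := I * (1 + Theta z) / (2 * (Real.sqrt π : ℂ)) * Pfrak |t| z

/-- The entire function `z ↦ ξ(1/2 - iz)`. -/
def xiShift (z : ℂ) : ℂ := xi (1 / 2 - I * z)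

/-- The set of zeros of `z ↦ ξ(1/2 - iz)` (not counting multiplicity). -/
def XiZeros : Set ℂ := {z | xiShift z = 0}

/-- The multiplicity of a zero of `z ↦ ξ(1/2 - iz)`. -/
def mult (γ : ℂ) : ℕ := sInf {n : ℕ | iteratedDeriv n xiShift γ ≠ 0}

/-- The kernel `G_g(t,u) = g(t-u) - g(t) - g(u) + g(0)`. -/
def Gg (t u : ℝ) : ℝ := g (t - u) - g t - g u + g 0

/-- `𝒫̂_φ(z) = ∫_ℝ 𝔖_t(z) φ(t) dt`. -/
def Phat (φ : ℝ → ℂ) (z : ℂ) : ℂ := ∫ t : ℝ, Sfrak t z * φ t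

/-- The Fourier-type transform `φ̂(z) = ∫_ℝ φ(t) e^{izt} dt`. -/
def FT (φ : ℝ → ℂ) (z : ℂ) : ℂ := ∫ t : ℝ, φ t * Complex.exp (I * z * t)

/-! ### Logarithmic derivatives of entire functions of order less than two -/

namespace EntireFunction

open Metric Topology

variable {F : ℂ → ℂ}

lemma analyticOrderAt_ne_top_of_differentiable (hF : Differentiable ℂ F) {w : ℂ} (hw : F w ≠ 0)
    (z : ℂ) : analyticOrderAt F z ≠ ⊤ := by
  intro h
  rw [AnalyticOnNhd.analyticOrderAt_eq_top_iff_eq_zero z (fun z => hF.analyticAt z)] at h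
  exact hw (by rw [h]; rfl)

lemma finite_zeros_closedBall (hF : Differentiable ℂ F) {w : ℂ} (hw : F w ≠ 0) (R : ℝ) :
    {z : ℂ | F z = 0 ∧ ‖z‖ ≤ R}.Finite := by
  have h1 : F ⁻¹' {0}ᶜ ∈ codiscrete ℂ :=
    AnalyticOnNhd.preimage_zero_mem_codiscrete (fun z _ => hF.analyticAt z) hw
  have h2 := (isCompact_closedBall (0 : ℂ) R).finite_sdiff_of_mem_codiscreteWithin
    (codiscreteWithin_mono (subset_univ _) h1)
  refine h2.subset ?_
  rintro z ⟨h, hz⟩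
  simp [h, hz]

/-- Dividing an entire function by the full power of a linear factor. -/
lemma exists_eq_sub_pow_mul (hF : Differentiable ℂ F) {w : ℂ} (hw : F w ≠ 0) (ρ : ℂ) :
    ∃ G : ℂ → ℂ, Differentiable ℂ G ∧ G ρ ≠ 0 ∧
      ∀ z, F z = (z - ρ) ^ analyticOrderNatAt F ρ * G z := by
  obtain ⟨q, hq, hq0, hev⟩ := (hF.analyticAt ρ).analyticOrderAt_ne_top.1
    (analyticOrderAt_ne_top_of_differentiable hF hw ρ)
  set n := analyticOrderNatAt F ρ
  let G : ℂ → ℂ := Function.update (fun z => F z / (z - ρ) ^ n) ρ (q ρ)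
  have hne : ∀ z, z ≠ ρ → G z = F z / (z - ρ) ^ n := fun z hz => Function.update_of_ne hz _ _
  have hGρ : G ρ = q ρ := Function.update_self _ _ _
  have hGq : G =ᶠ[𝓝 ρ] q := by
    filter_upwards [hev] with z hz
    rcases eq_or_ne z ρ with rfl | h
    · exact hGρ
    · rw [hne z h, hz, smul_eq_mul]
      have : (z - ρ) ^ n ≠ 0 := pow_ne_zero _ (sub_ne_zero.2 h)
      field_simp
  refine ⟨G, fun z => ?_, by rwa [hGρ], fun z => ?_⟩
  · rcases eq_or_ne z ρ with rfl | h
    · exact (hq.differentiableAt).congr_of_eventuallyEq hGq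
    · have h1 : G =ᶠ[𝓝 z] fun z => F z / (z - ρ) ^ n := by
        filter_upwards [isOpen_ne.mem_nhds h] with y hy using hne y hy
      refine DifferentiableAt.congr_of_eventuallyEq ?_ h1
      exact (hF z).div (by fun_prop) (pow_ne_zero _ (sub_ne_zero.2 h))
  · rcases eq_or_ne z ρ with rfl | h
    · simpa [hGρ] using hev.self_of_nhds
    · rw [hne z h]
      have : (z - ρ) ^ n ≠ 0 := pow_ne_zero _ (sub_ne_zero.2 h)
      field_simp

/-- Dividing an entire function by the linear factors of finitely many of its zeros. -/
lemma exists_eq_prod_mul (hF : Differentiable ℂ F) {w : ℂ} (hw : F w ≠ 0) (S : Finset ℂ) :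
    ∃ G : ℂ → ℂ, Differentiable ℂ G ∧ (∀ ρ ∈ S, G ρ ≠ 0) ∧
      ∀ z, F z = (∏ ρ ∈ S, (z - ρ) ^ analyticOrderNatAt F ρ) * G z := by
  classical
  induction S using Finset.induction_on with
  | empty => exact ⟨F, hF, by simp, by simp⟩
  | insert a S ha ih =>
    obtain ⟨G, hG, hGS, hFG⟩ := ih
    have hGw : G w ≠ 0 := fun h => hw (by rw [hFG, h, mul_zero])
    obtain ⟨K, hK, hKa, hGK⟩ := exists_eq_sub_pow_mul hG hGw a
    have hord : analyticOrderNatAt F a = analyticOrderNatAt G a := by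
      have h1 : F = (fun z => ∏ ρ ∈ S, (z - ρ) ^ analyticOrderNatAt F ρ) * G := by
        ext z; exact hFG z
      have h2 : AnalyticAt ℂ (fun z => ∏ ρ ∈ S, (z - ρ) ^ analyticOrderNatAt F ρ) a := by
        have : Differentiable ℂ (fun z => ∏ ρ ∈ S, (z - ρ) ^ analyticOrderNatAt F ρ) := by fun_prop
        exact this.analyticAt a
      have h3 : analyticOrderAt (fun z => ∏ ρ ∈ S, (z - ρ) ^ analyticOrderNatAt F ρ) a = 0 := by
        rw [analyticOrderAt_eq_zero]
        right
        refine Finset.prod_ne_zero_iff.2 fun ρ hρ => pow_ne_zero _ (sub_ne_zero.2 ?_)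
        rintro rfl; exact ha hρ
      unfold analyticOrderNatAt
      conv_lhs => rw [h1]
      rw [analyticOrderAt_mul h2 (hG.analyticAt a), h3, zero_add]
    refine ⟨K, hK, ?_, fun z => ?_⟩
    · intro ρ hρ
      rcases Finset.mem_insert.1 hρ with rfl | h
      · exact hKa
      · intro h0; exact hGS ρ h (by rw [hGK, h0, mul_zero])
    · rw [Finset.prod_insert ha, hFG, hGK, hord]; ring

/-- The zeros in a closed disc, as a finset. -/
def zerosIn (hF : Differentiable ℂ F) {w : ℂ} (hw : F w ≠ 0) (R : ℝ) : Finset ℂ :=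
  (finite_zeros_closedBall hF hw R).toFinset

lemma mem_zerosIn (hF : Differentiable ℂ F) {w : ℂ} (hw : F w ≠ 0) {R : ℝ} {z : ℂ} :
    z ∈ zerosIn hF hw R ↔ F z = 0 ∧ ‖z‖ ≤ R := by
  simp [zerosIn]

lemma exists_quotient_bound (hF : Differentiable ℂ F) (h0 : F 0 ≠ 0) {R M : ℝ} (hR : 0 < R)
    (hM : ∀ z, ‖z‖ = 3 * R → ‖F z‖ ≤ M) :
    ∃ G : ℂ → ℂ, Differentiable ℂ G ∧ (∀ z, ‖z‖ ≤ R → G z ≠ 0) ∧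
      (∀ z, F z = (∏ ρ ∈ zerosIn hF h0 R, (z - ρ) ^ analyticOrderNatAt F ρ) * G z) ∧
      ∀ z, ‖z‖ ≤ 3 * R →
        ‖G z‖ * 2 ^ (∑ ρ ∈ zerosIn hF h0 R, analyticOrderNatAt F ρ) * ‖F 0‖ ≤ M * ‖G 0‖ := by
  obtain ⟨G, hG, hGS, hFG⟩ := exists_eq_prod_mul hF h0 (zerosIn hF h0 R)
  set S := zerosIn hF h0 R
  set n := ∑ ρ ∈ S, analyticOrderNatAt F ρ
  have hS : ∀ ρ ∈ S, ‖ρ‖ ≤ R := fun ρ hρ => ((mem_zerosIn hF h0).1 hρ).2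
  have hF0 : ‖F 0‖ ≤ R ^ n * ‖G 0‖ := by
    rw [hFG 0, norm_mul, norm_prod, ← Finset.prod_pow_eq_pow_sum]
    gcongr with ρ hρ
    rw [norm_pow]
    gcongr
    simpa using hS ρ hρ
  have hsph : ∀ z, ‖z‖ = 3 * R → ‖G z‖ ≤ M / (2 * R) ^ n := by
    intro z hz
    rw [le_div_iff₀ (by positivity)]
    refine le_trans ?_ (hM z hz)
    rw [hFG z, norm_mul, norm_prod, ← Finset.prod_pow_eq_pow_sum, mul_comm]
    gcongr with ρ hρ
    rw [norm_pow]
    gcongr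
    have := norm_sub_norm_le z ρ
    have := hS ρ hρ
    linarith
  have hball : ∀ z, ‖z‖ ≤ 3 * R → ‖G z‖ ≤ M / (2 * R) ^ n := by
    intro z hz
    refine Complex.norm_le_of_forall_mem_frontier_norm_le (U := ball (0 : ℂ) (3 * R))
      isBounded_ball hG.diffContOnCl ?_ ?_
    · intro z hz
      rw [frontier_ball _ (by positivity)] at hz
      exact hsph z (by simpa using hz)
    · rw [closure_ball _ (by positivity)]; simpa using hz
  refine ⟨G, hG, fun z hz h => ?_, hFG, fun z hz => ?_⟩
  · have : z ∈ S := (mem_zerosIn hF h0).2 ⟨by rw [hFG, h, mul_zero], hz⟩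
    exact hGS z this h
  · have hnn : 0 ≤ M / (2 * R) ^ n := (norm_nonneg _).trans (hball z hz)
    calc ‖G z‖ * 2 ^ n * ‖F 0‖ ≤ M / (2 * R) ^ n * 2 ^ n * (R ^ n * ‖G 0‖) :=
          mul_le_mul (mul_le_mul_of_nonneg_right (hball z hz) (by positivity)) hF0
            (norm_nonneg _) (mul_nonneg hnn (by positivity))
      _ = M * ‖G 0‖ := by
          rw [mul_pow]; field_simp

/-- Number of zeros in a disc in terms of a bound on a larger circle. -/
lemma two_pow_card_zeros_le (hF : Differentiable ℂ F) (h0 : F 0 ≠ 0) {R M : ℝ} (hR : 0 < R)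
    (hM : ∀ z, ‖z‖ = 3 * R → ‖F z‖ ≤ M) :
    2 ^ (∑ ρ ∈ zerosIn hF h0 R, analyticOrderNatAt F ρ) * ‖F 0‖ ≤ M := by
  obtain ⟨G, hG, hGne, hFG, hb⟩ := exists_quotient_bound hF h0 hR hM
  have h1 := hb 0 (by simp; positivity)
  have h2 : 0 < ‖G 0‖ := norm_pos_iff.2 (hGne 0 (by simp [hR.le]))
  rw [mul_assoc, mul_comm M] at h1
  exact le_of_mul_le_mul_left h1 h2

/-- A zero-free function with bounded modulus has slowly varying logarithmic derivative. -/
lemma norm_logDeriv_sub_le {G : ℂ → ℂ} (hG : Differentiable ℂ G) {R B : ℝ} (hR : 0 < R)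
    (hB : 0 < B) (hne : ∀ z, ‖z‖ ≤ R → G z ≠ 0)
    (hb : ∀ z, ‖z‖ ≤ R → ‖G z‖ ≤ Real.exp B * ‖G 0‖) {z : ℂ} (hz : ‖z‖ ≤ R / 4) :
    ‖deriv G z / G z - deriv G 0 / G 0‖ ≤ 64 * B / R ^ 2 * ‖z‖ := by
  have hd : DifferentiableOn ℂ (fun z => deriv G z / G z) (ball 0 R) := by
    intro z hz
    have hz' : ‖z‖ ≤ R := (mem_ball_zero_iff.1 hz).le
    exact ((hG.analyticAt z).deriv.differentiableAt.div (hG z) (hne z hz')).differentiableWithinAt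
  obtain ⟨h₁, hh₁⟩ := hd.isExactOn_ball
  let h : ℂ → ℂ := fun z => h₁ z - h₁ 0
  have hh : ∀ z ∈ ball (0 : ℂ) R, HasDerivAt h (deriv G z / G z) z := fun z hz =>
    (hh₁ z hz).sub_const _
  have hh0 : h 0 = 0 := sub_self _
  have hexp : ∀ z ∈ ball (0 : ℂ) R, G z * Complex.exp (-h z) = G 0 := by
    have hder : ∀ z ∈ ball (0 : ℂ) R, HasDerivAt (fun z => G z * Complex.exp (-h z)) 0 z := by
      intro z hz
      have := (hG z).hasDerivAt.mul ((hh z hz).neg.cexp)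
      refine this.congr_deriv ?_
      have := hne z (mem_ball_zero_iff.1 hz).le
      field_simp
      ring
    intro z hz
    have := (convex_ball (0 : ℂ) R).is_const_of_fderivWithin_eq_zero (𝕜 := ℂ)
      (f := fun z => G z * Complex.exp (-h z))
      (fun z hz => (hder z hz).differentiableAt.differentiableWithinAt)
      (fun z hz => by
        rw [fderivWithin_of_isOpen isOpen_ball hz]
        ext
        simp [(hder z hz).deriv]) hz (mem_ball_self hR)
    simpa [hh0] using this
  have hre : Set.MapsTo h (ball 0 R) {z | z.re ≤ B} := by
    intro z hz
    have hz' : ‖z‖ ≤ R := (mem_ball_zero_iff.1 hz).le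
    have e1 := hexp z hz
    have hG0 : 0 < ‖G 0‖ := norm_pos_iff.2 (hne 0 (by simp [hR.le]))
    have e2 : ‖G z‖ = ‖G 0‖ * Real.exp (h z).re := by
      rw [← e1, norm_mul, Complex.norm_exp, mul_assoc, ← Real.exp_add]
      simp
    have e3 := hb z hz'
    rw [e2, mul_comm] at e3
    have := le_of_mul_le_mul_right e3 hG0
    simpa using this
  have hdh : DifferentiableOn ℂ h (ball 0 R) := fun z hz =>
    (hh z hz).differentiableAt.differentiableWithinAt
  have hbd : ∀ z, ‖z‖ ≤ R / 2 → ‖h z‖ ≤ 2 * B := by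
    intro z hz
    have hzb : z ∈ ball (0 : ℂ) R := by rw [mem_ball_zero_iff]; linarith
    have := borelCaratheodory_zero hB hdh hre hR hzb hh0
    refine this.trans ?_
    rw [div_le_iff₀ (by linarith)]
    nlinarith [norm_nonneg z]
  have hsec : ∀ z ∈ closedBall (0 : ℂ) (R / 4), ‖deriv (deriv h) z‖ ≤ 64 * B / R ^ 2 := by
    intro z hz
    have hz' : ‖z‖ ≤ R / 4 := by simpa using hz
    have hsub : closedBall z (R / 4) ⊆ ball 0 R := by
      intro y hy
      have := norm_le_norm_add_norm_sub' y z
      rw [mem_closedBall, dist_eq_norm] at hy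
      rw [mem_ball_zero_iff]; linarith
    have := norm_iteratedDeriv_le_of_forall_mem_sphere_norm_le (f := h) (c := z) (C := 2 * B) 2
      (by positivity : 0 < R / 4)
      ((hdh.mono hsub).diffContOnCl_ball (subset_refl _)) (by
        intro y hy
        apply hbd
        have := norm_le_norm_add_norm_sub' y z
        rw [mem_sphere, dist_eq_norm] at hy
        linarith)
    rw [iteratedDeriv_succ, iteratedDeriv_one] at this
    refine this.trans (le_of_eq ?_)
    norm_num [Nat.factorial]
    field_simp
    norm_num
  have hder : ∀ z ∈ ball (0 : ℂ) R, deriv h z = deriv G z / G z := fun z hz => (hh z hz).deriv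
  have hmv := (convex_closedBall (0 : ℂ) (R / 4)).norm_image_sub_le_of_norm_deriv_le
    (f := deriv h) (C := 64 * B / R ^ 2) (x := 0) (y := z)
    (fun y hy => by
      have : y ∈ ball (0 : ℂ) R := by
        have : ‖y‖ ≤ R / 4 := by simpa using hy
        rw [mem_ball_zero_iff]; linarith
      exact ((hdh.analyticAt (isOpen_ball.mem_nhds this)).deriv).differentiableAt)
    hsec (by simp; positivity) (by simpa using hz)
  rw [hder z (by rw [mem_ball_zero_iff]; linarith), hder 0 (mem_ball_self hR), sub_zero] at hmv
  exact hmv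

end EntireFunction

namespace EntireFunction

open Metric Topology

variable {F : ℂ → ℂ}

lemma growth_at_three_mul {C : ℝ} (hC : 0 ≤ C)
    (hg : ∀ z, ‖F z‖ ≤ Real.exp (C * (1 + ‖z‖) ^ (3 / 2 : ℝ))) {R : ℝ} (hR : 1 ≤ R) {z : ℂ}
    (hz : ‖z‖ ≤ 3 * R) : ‖F z‖ ≤ Real.exp (8 * C * R ^ (3 / 2 : ℝ)) := by
  refine (hg z).trans (Real.exp_le_exp.2 ?_)
  have h1 : (1 + ‖z‖) ^ (3 / 2 : ℝ) ≤ (4 * R) ^ (3 / 2 : ℝ) :=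
    Real.rpow_le_rpow (by positivity) (by linarith) (by norm_num)
  have h2 : (4 * R) ^ (3 / 2 : ℝ) = 8 * R ^ (3 / 2 : ℝ) := by
    rw [Real.mul_rpow (by norm_num) (by linarith)]
    congr 1
    rw [show (4 : ℝ) = 2 ^ (2 : ℝ) by norm_num, ← Real.rpow_mul (by norm_num)]
    norm_num
  rw [h2] at h1
  nlinarith

/-- Zero counting for functions of order at most `3/2`. -/
lemma exists_card_zeros_le (hF : Differentiable ℂ F) (h0 : F 0 ≠ 0) {C : ℝ} (hC : 0 ≤ C)
    (hg : ∀ z, ‖F z‖ ≤ Real.exp (C * (1 + ‖z‖) ^ (3 / 2 : ℝ))) :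
    ∃ K : ℝ, 0 < K ∧ ∀ R : ℝ, 1 ≤ R →
      ((∑ ρ ∈ zerosIn hF h0 R, analyticOrderNatAt F ρ : ℕ) : ℝ) ≤ K * R ^ (3 / 2 : ℝ) := by
  have hl2 : 0 < Real.log 2 := Real.log_pos (by norm_num)
  refine ⟨(8 * C + |Real.log ‖F 0‖| + 1) / Real.log 2, by positivity, fun R hR => ?_⟩
  have h1 := two_pow_card_zeros_le hF h0 (by linarith : 0 < R)
    (fun z hz => growth_at_three_mul hC hg hR hz.le)
  set n := ∑ ρ ∈ zerosIn hF h0 R, analyticOrderNatAt F ρ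
  have hF0 : 0 < ‖F 0‖ := norm_pos_iff.2 h0
  have h2 := Real.log_le_log (by positivity) h1
  rw [Real.log_exp, Real.log_mul (by positivity) hF0.ne', Real.log_pow] at h2
  rw [div_mul_eq_mul_div, le_div_iff₀ hl2]
  have h3 : (1 : ℝ) ≤ R ^ (3 / 2 : ℝ) := Real.one_le_rpow hR (by norm_num)
  have h4 := neg_abs_le (Real.log ‖F 0‖)
  nlinarith [abs_nonneg (Real.log ‖F 0‖)]

lemma summable_order_div_sq (hF : Differentiable ℂ F) (h0 : F 0 ≠ 0) {C : ℝ} (hC : 0 ≤ C)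
    (hg : ∀ z, ‖F z‖ ≤ Real.exp (C * (1 + ‖z‖) ^ (3 / 2 : ℝ))) :
    Summable fun ρ : {z // F z = 0} => (analyticOrderNatAt F ρ : ℝ) / ‖(ρ : ℂ)‖ ^ 2 := by
  classical
  obtain ⟨K, hK, hcard⟩ := exists_card_zeros_le hF h0 hC hg
  have hr0 : ∃ r : ℝ, 0 < r ∧ ∀ z, F z = 0 → r ≤ ‖z‖ := by
    have := hF.continuous.continuousAt.eventually_ne h0
    obtain ⟨r, hr, h⟩ := Metric.eventually_nhds_iff.1 this
    refine ⟨r, hr, fun z hz => ?_⟩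
    by_contra hlt
    exact h (by simpa using hlt) hz
  obtain ⟨r, hr, hrz⟩ := hr0
  set c : ℝ := max 4 (1 / r ^ 2)
  have hc : 0 < c := lt_max_of_lt_left (by norm_num)
  have hk : ∀ z, F z = 0 → ∃ k : ℕ, ‖z‖ ≤ 2 ^ k ∧ 1 / ‖z‖ ^ 2 ≤ c * (1 / 4) ^ k := by
    intro z hz
    have hz0 : r ≤ ‖z‖ := hrz z hz
    have hzpos : 0 < ‖z‖ := hr.trans_le hz0
    rcases le_or_gt ‖z‖ 1 with h1 | h1
    · refine ⟨0, by simpa using h1, ?_⟩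
      rw [pow_zero, mul_one]
      refine le_trans ?_ (le_max_right _ _)
      gcongr
    · obtain ⟨n, hn, hn'⟩ := exists_nat_pow_near h1.le (by norm_num : (1 : ℝ) < 2)
      refine ⟨n + 1, hn'.le, ?_⟩
      have : (4 : ℝ) ^ (n + 1) ≤ 4 * ‖z‖ ^ 2 := by
        have e : (4 : ℝ) ^ n = (2 ^ n) ^ 2 := by rw [← pow_mul, mul_comm, pow_mul]; norm_num
        rw [pow_succ, e]
        nlinarith [pow_pos (by norm_num : (0:ℝ) < 2) n]
      calc 1 / ‖z‖ ^ 2 ≤ 4 * (1 / 4) ^ (n + 1) := by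
            rw [one_div_pow, mul_one_div, div_le_div_iff₀ (by positivity) (by positivity)]
            linarith
        _ ≤ c * (1 / 4) ^ (n + 1) := by
            gcongr; exact le_max_left _ _
  choose! k hk1 hk2 using hk
  set q : ℝ := 2 ^ (3 / 2 : ℝ) / 4
  have hq : q < 1 := by
    have : (2 : ℝ) ^ (3 / 2 : ℝ) < 2 ^ (2 : ℝ) := Real.rpow_lt_rpow_of_exponent_lt (by norm_num) (by norm_num)
    rw [div_lt_one (by norm_num)]
    norm_num at this
    exact this
  have hq0 : 0 ≤ q := by positivity
  have hsum : Summable fun j : ℕ => c * K * q ^ j := (summable_geometric_of_lt_one hq0 hq).mul_left _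
  refine summable_of_sum_le (c := ∑' j, c * K * q ^ j) (fun ρ => by positivity) fun T => ?_
  calc ∑ ρ ∈ T, (analyticOrderNatAt F ρ : ℝ) / ‖(ρ : ℂ)‖ ^ 2
      ≤ ∑ ρ ∈ T, (analyticOrderNatAt F ρ.1 : ℝ) * (c * (1 / 4) ^ k ρ.1) := by
        refine Finset.sum_le_sum fun ρ _ => ?_
        rw [div_eq_mul_one_div]
        exact mul_le_mul_of_nonneg_left (hk2 ρ.1 ρ.2) (by positivity)
    _ = ∑ j ∈ T.image (fun ρ => k ρ.1), ∑ ρ ∈ T with k ρ.1 = j,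
          (analyticOrderNatAt F ρ.1 : ℝ) * (c * (1 / 4) ^ k ρ.1) := by
        rw [Finset.sum_fiberwise_of_maps_to]
        exact fun ρ hρ => Finset.mem_image_of_mem _ hρ
    _ ≤ ∑ j ∈ T.image (fun ρ => k ρ.1), c * K * q ^ j := by
        refine Finset.sum_le_sum fun j _ => ?_
        have e1 : ∑ ρ ∈ T with k ρ.1 = j, (analyticOrderNatAt F ρ.1 : ℝ) * (c * (1 / 4) ^ k ρ.1)
            = (∑ ρ ∈ T with k ρ.1 = j, (analyticOrderNatAt F ρ.1 : ℝ)) * (c * (1 / 4) ^ j) := by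
          rw [Finset.sum_mul]
          refine Finset.sum_congr rfl fun ρ hρ => ?_
          rw [(Finset.mem_filter.1 hρ).2]
        have e2 : ∑ ρ ∈ T with k ρ.1 = j, (analyticOrderNatAt F ρ.1 : ℝ) ≤ K * (2 ^ j) ^ (3 / 2 : ℝ) := by
          refine le_trans ?_ (hcard (2 ^ j) (one_le_pow₀ (by norm_num)))
          push_cast
          refine (Finset.sum_map (T.filter fun ρ => k ρ.1 = j) (Function.Embedding.subtype _)
            (fun ρ : ℂ => (analyticOrderNatAt F ρ : ℝ))).symm.le.trans ?_
          refine Finset.sum_le_sum_of_subset_of_nonneg ?_ fun _ _ _ => by positivity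
          intro z hz
          obtain ⟨ρ, hρ, rfl⟩ := Finset.mem_map.1 hz
          refine (mem_zerosIn hF h0).2 ⟨ρ.2, ?_⟩
          rw [← (Finset.mem_filter.1 hρ).2]
          exact hk1 ρ.1 ρ.2
        rw [e1]
        calc _ ≤ K * (2 ^ j) ^ (3 / 2 : ℝ) * (c * (1 / 4) ^ j) := by gcongr
          _ = c * K * q ^ j := by
            have : ((2 : ℝ) ^ j) ^ (3 / 2 : ℝ) = (2 ^ (3 / 2 : ℝ)) ^ j := by
              rw [← Real.rpow_natCast, ← Real.rpow_natCast, ← Real.rpow_mul (by norm_num),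
                ← Real.rpow_mul (by norm_num), mul_comm]
            rw [this, show q = 2 ^ (3 / 2 : ℝ) * (1 / 4) by ring, mul_pow]
            ring
    _ ≤ _ := hsum.sum_le_tsum _ fun _ _ => by positivity

/-- The partial fraction expansion of the logarithmic derivative of an entire function of order
at most `3/2`. -/
theorem hasSum_logDeriv (hF : Differentiable ℂ F) (h0 : F 0 ≠ 0) {C : ℝ} (hC : 0 ≤ C)
    (hg : ∀ z, ‖F z‖ ≤ Real.exp (C * (1 + ‖z‖) ^ (3 / 2 : ℝ))) {z : ℂ} (hz : F z ≠ 0) :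
    HasSum (fun ρ : {z // F z = 0} => (analyticOrderNatAt F ρ : ℂ) * (1 / (z - ρ) + 1 / ρ))
      (deriv F z / F z - deriv F 0 / F 0) := by
  classical
  have hρ0 : ∀ ρ : {z // F z = 0}, (ρ : ℂ) ≠ 0 := by
    rintro ⟨ρ, hρ⟩ rfl; exact h0 hρ
  have hzρ : ∀ ρ : {z // F z = 0}, z - ρ ≠ 0 := by
    rintro ⟨ρ, hρ⟩ h; exact hz (by rw [sub_eq_zero.1 h]; exact hρ)
  have hsq := summable_order_div_sq hF h0 hC hg
  have hfin : ∀ R : ℝ, {ρ : {z // F z = 0} | ‖(ρ : ℂ)‖ ≤ R}.Finite := by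
    intro R
    refine ((finite_zeros_closedBall hF h0 R).preimage Subtype.val_injective.injOn).subset ?_
    intro ρ hρ
    exact ⟨ρ.2, hρ⟩
  have hs : Summable fun ρ : {z // F z = 0} =>
      (analyticOrderNatAt F ρ : ℂ) * (1 / (z - ρ) + 1 / ρ) := by
    refine Summable.of_norm_bounded_eventually (hsq.mul_left (2 * ‖z‖)) ?_
    filter_upwards [(hfin (2 * ‖z‖)).compl_mem_cofinite] with ρ hρ
    have hρ' : 2 * ‖z‖ < ‖(ρ : ℂ)‖ := by simpa using hρ
    have hpos : 0 < ‖(ρ : ℂ)‖ := norm_pos_iff.2 (hρ0 ρ)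
    have h1 : ‖(ρ : ℂ)‖ / 2 ≤ ‖z - ρ‖ := by
      have := norm_sub_norm_le (ρ : ℂ) z
      rw [norm_sub_rev] at this
      linarith
    have e : (1 / (z - ρ) + 1 / ρ : ℂ) = z / ((z - ρ) * ρ) := by
      have := hρ0 ρ
      have := hzρ ρ
      field_simp
      ring
    rw [e, norm_mul, norm_div, norm_mul, Complex.norm_natCast]
    calc (analyticOrderNatAt F ρ : ℝ) * (‖z‖ / (‖z - ρ‖ * ‖(ρ : ℂ)‖))
        ≤ (analyticOrderNatAt F ρ : ℝ) * (‖z‖ / (‖(ρ : ℂ)‖ / 2 * ‖(ρ : ℂ)‖)) := by gcongr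
      _ = _ := by field_simp
  let S : ℕ → Finset {z // F z = 0} := fun n => (zerosIn hF h0 (n : ℝ)).subtype fun z => F z = 0
  have hS : Tendsto S atTop atTop := by
    refine tendsto_atTop_finset_of_monotone ?_ ?_
    · intro a b hab ρ hρ
      rw [Finset.mem_subtype, mem_zerosIn] at hρ ⊢
      exact ⟨hρ.1, hρ.2.trans (by exact_mod_cast hab)⟩
    · intro ρ
      obtain ⟨n, hn⟩ := exists_nat_ge ‖(ρ : ℂ)‖
      exact ⟨n, by rw [Finset.mem_subtype, mem_zerosIn]; exact ⟨ρ.2, hn⟩⟩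
  have hlim := hs.hasSum.comp hS
  have hF0 : 0 < ‖F 0‖ := norm_pos_iff.2 h0
  have hlim2 : Tendsto (fun n => ∑ ρ ∈ S n, (analyticOrderNatAt F ρ : ℂ) * (1 / (z - ρ) + 1 / ρ))
      atTop (𝓝 (deriv F z / F z - deriv F 0 / F 0)) := by
    set B : ℝ := 8 * C + |Real.log ‖F 0‖| + 1
    rw [tendsto_iff_norm_sub_tendsto_zero]
    have hb0 : Tendsto (fun n : ℕ => 64 * B * ‖z‖ * (n : ℝ) ^ (-(1 / 2) : ℝ)) atTop (𝓝 0) := by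
      have := ((tendsto_rpow_neg_atTop (by norm_num : (0 : ℝ) < 1 / 2)).comp
        tendsto_natCast_atTop_atTop).const_mul (64 * B * ‖z‖)
      simpa using this
    refine squeeze_zero' (Eventually.of_forall fun _ => norm_nonneg _) ?_ hb0
    obtain ⟨N, hN⟩ := exists_nat_ge (4 * ‖z‖ + 1)
    filter_upwards [eventually_ge_atTop N] with n hn
    have hnR : 4 * ‖z‖ + 1 ≤ (n : ℝ) := hN.trans (by exact_mod_cast hn)
    have hn1 : (1 : ℝ) ≤ n := by linarith [norm_nonneg z]
    obtain ⟨G, hG, hGne, hFG, hGb⟩ := exists_quotient_bound hF h0 (by linarith : (0 : ℝ) < n)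
      (fun z hz => growth_at_three_mul hC hg hn1 hz.le)
    set T := zerosIn hF h0 (n : ℝ)
    have hld : ∀ w, ‖w‖ ≤ n → F w ≠ 0 → deriv F w / F w
        = ∑ ρ ∈ T, (analyticOrderNatAt F ρ : ℂ) * (1 / (w - ρ)) + deriv G w / G w := by
      intro w hwn hw
      have hwρ : ∀ ρ ∈ T, w - ρ ≠ 0 := by
        intro ρ hρ h
        rw [sub_eq_zero.1 h] at hw
        exact hw ((mem_zerosIn hF h0).1 hρ).1
      have e1 : F = fun z => (∏ ρ ∈ T, (z - ρ) ^ analyticOrderNatAt F ρ) * G z := funext hFG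
      rw [← logDeriv_apply, ← logDeriv_apply]
      conv_lhs => rw [e1]
      rw [logDeriv_mul (f := fun z => ∏ ρ ∈ T, (z - ρ) ^ analyticOrderNatAt F ρ), logDeriv_prod]
      · congr 1
        refine Finset.sum_congr rfl fun ρ hρ => ?_
        rw [logDeriv_fun_pow (by fun_prop)]
        congr 1
        simp [logDeriv_apply]
      · intro ρ hρ; exact pow_ne_zero _ (hwρ ρ hρ)
      · intro ρ hρ; fun_prop
      · exact Finset.prod_ne_zero_iff.2 fun ρ hρ => pow_ne_zero _ (hwρ ρ hρ)
      · exact hGne w hwn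
      · fun_prop
      · exact hG w
    have hsumS : ∑ ρ ∈ S n, (analyticOrderNatAt F ρ : ℂ) * (1 / (z - ρ) + 1 / ρ)
        = ∑ ρ ∈ T, (analyticOrderNatAt F ρ : ℂ) * (1 / (z - ρ) + 1 / ρ) := by
      rw [Finset.sum_subtype_of_mem (s := T) (p := fun z => F z = 0)
        (fun ρ => (analyticOrderNatAt F ρ : ℂ) * (1 / (z - ρ) + 1 / ρ))]
      exact fun ρ hρ => ((mem_zerosIn hF h0).1 hρ).1
    have hzn : ‖z‖ ≤ n := by linarith [norm_nonneg z]
    have key : (∑ ρ ∈ S n, (analyticOrderNatAt F ρ : ℂ) * (1 / (z - ρ) + 1 / ρ))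
        - (deriv F z / F z - deriv F 0 / F 0) = -(deriv G z / G z - deriv G 0 / G 0) := by
      rw [hsumS, hld z hzn hz, hld 0 (by simp) h0]
      simp only [mul_add, Finset.sum_add_distrib, zero_sub, one_div, inv_neg, mul_neg,
        Finset.sum_neg_distrib]
      ring
    have hn32 : (1 : ℝ) ≤ (n : ℝ) ^ (3 / 2 : ℝ) := Real.one_le_rpow hn1 (by norm_num)
    have hbd := norm_logDeriv_sub_le hG (R := n) (B := B * (n : ℝ) ^ (3 / 2 : ℝ)) (by linarith)
      (by positivity) hGne (by
        intro w hw
        have h1 := hGb w (by linarith)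
        have h2 : ‖G w‖ * ‖F 0‖ ≤ Real.exp (8 * C * (n : ℝ) ^ (3 / 2 : ℝ)) * ‖G 0‖ := by
          refine le_trans ?_ h1
          gcongr
          exact le_mul_of_one_le_right (norm_nonneg _) (one_le_pow₀ (by norm_num))
        have h3 : Real.exp (8 * C * (n : ℝ) ^ (3 / 2 : ℝ))
            ≤ Real.exp (B * (n : ℝ) ^ (3 / 2 : ℝ)) * ‖F 0‖ := by
          rw [← Real.exp_log hF0, ← Real.exp_add, Real.exp_le_exp]
          have := neg_abs_le (Real.log ‖F 0‖)
          nlinarith [abs_nonneg (Real.log ‖F 0‖)]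
        refine le_of_mul_le_mul_right ?_ hF0
        calc ‖G w‖ * ‖F 0‖ ≤ _ := h2
          _ ≤ Real.exp (B * (n : ℝ) ^ (3 / 2 : ℝ)) * ‖F 0‖ * ‖G 0‖ := by gcongr
          _ = _ := by ring) (z := z) (by linarith)
    rw [key, norm_neg]
    refine hbd.trans (le_of_eq ?_)
    have e : (n : ℝ) ^ (-(1 / 2) : ℝ) = (n : ℝ) ^ (3 / 2 : ℝ) / (n : ℝ) ^ 2 := by
      rw [← Real.rpow_natCast, ← Real.rpow_sub (by linarith)]
      norm_num
    rw [e]; ring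
  rw [← tendsto_nhds_unique hlim hlim2]
  exact hs.hasSum

end EntireFunction

/-! ### Bounds for the completed zeta function -/

namespace ZetaBounds

open HurwitzZeta Topology

lemma norm_evenKernel_zero_sub_one_le {x : ℝ} (hx : 1 ≤ x) :
    ‖((evenKernel 0 x : ℝ) : ℂ) - 1‖ ≤ 4 * Real.exp (-π * x) := by
  have h1 : ((evenKernel 0 x : ℝ) : ℂ) = jacobiTheta (I * x) := by
    have := evenKernel_def 0 x
    simpa [jacobiTheta_eq_jacobiTheta₂] using this
  have h2 := norm_jacobiTheta_sub_one_le (τ := I * x) (by simp; linarith)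
  rw [h1]
  refine h2.trans ?_
  have him : (I * (x : ℂ)).im = x := by simp
  rw [him]
  gcongr
  have h3 : Real.exp (-π * x) ≤ 1 / 2 := by
    have : Real.exp (-π * x) ≤ Real.exp (-1) := by
      apply Real.exp_le_exp.2
      nlinarith [Real.pi_gt_three]
    refine this.trans ?_
    rw [Real.exp_neg, one_div]
    refine inv_anti₀ (by norm_num) ?_
    have := Real.add_one_le_exp (1 : ℝ)
    linarith
  rw [div_le_iff₀ (by linarith)]
  linarith

/-- The Mellin density of the entire completed zeta function. -/
abbrev dens : ℝ → ℂ := (hurwitzEvenFEPair 0).f_modif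

lemma norm_dens_le_of_one_lt {x : ℝ} (hx : 1 < x) : ‖dens x‖ ≤ 4 * Real.exp (-π * x) := by
  have : dens x = (evenKernel 0 x : ℂ) - 1 := by
    have h2 : x ∉ Ioo (0 : ℝ) 1 := fun h => by linarith [h.2]
    simp [dens, WeakFEPair.f_modif, h2, mem_Ioi.2 hx, hurwitzEvenFEPair]
  rw [this]
  exact norm_evenKernel_zero_sub_one_le hx.le

lemma norm_dens_le_of_lt_one {x : ℝ} (h0 : 0 < x) (hx : x < 1) :
    ‖dens x‖ ≤ 4 / π * x ^ (1 / 2 : ℝ) := by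
  have hd : dens x = ((x ^ (-(1 / 2) : ℝ) : ℝ) : ℂ) * ((evenKernel 0 (1 / x) : ℂ) - 1) := by
    have h1 : x ∉ Ioi (1 : ℝ) := fun h => by linarith [mem_Ioi.1 h]
    have h2 : x ∈ Ioo (0 : ℝ) 1 := ⟨h0, hx⟩
    have h3 : dens x = (evenKernel 0 x : ℂ) - ((x ^ (-(1 / 2) : ℝ) : ℝ) : ℂ) := by
      simp [dens, WeakFEPair.f_modif, h1, h2, hurwitzEvenFEPair]
    have h4 : evenKernel 0 x = x ^ (-(1 / 2) : ℝ) * evenKernel 0 (1 / x) := by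
      rw [evenKernel_functional_equation, evenKernel_eq_cosKernel_of_zero, Real.rpow_neg h0.le,
        one_div]
    rw [h3, h4]
    push_cast
    ring
  have h1x : 1 ≤ 1 / x := by rw [le_div_iff₀ h0]; linarith
  have hb := norm_evenKernel_zero_sub_one_le h1x
  have hexp : Real.exp (-π * (1 / x)) ≤ x / π := by
    have h := Real.add_one_le_exp (π / x)
    have e : -π * (1 / x) = -(π / x) := by ring
    have hp : 0 < π / x := by positivity
    rw [e, Real.exp_neg, ← one_div, show x / π = 1 / (π / x) by field_simp]
    exact one_div_le_one_div_of_le hp (by linarith)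
  rw [hd, norm_mul, Complex.norm_real, Real.norm_of_nonneg (by positivity)]
  calc x ^ (-(1 / 2) : ℝ) * ‖(evenKernel 0 (1 / x) : ℂ) - 1‖
      ≤ x ^ (-(1 / 2) : ℝ) * (4 * (x / π)) := by
        gcongr; exact hb.trans (by gcongr)
    _ = 4 / π * (x ^ (-(1 / 2) : ℝ) * x ^ (1 : ℝ)) := by rw [Real.rpow_one]; ring
    _ = _ := by rw [← Real.rpow_add h0]; norm_num

lemma completedRiemannZeta₀_eq_mellin (s : ℂ) :
    completedRiemannZeta₀ s = mellin dens (s / 2) / 2 := rfl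

lemma integrableOn_dens (σ : ℝ) :
    IntegrableOn (fun x : ℝ => x ^ (σ - 1) * ‖dens x‖) (Ioi 0) := by
  have h := ((hurwitzEvenFEPair 0).isStrongFEPair_toStrongFEPair.hasMellin (σ : ℂ)).1
  have h2 := h.norm
  refine (integrableOn_congr_fun ?_ measurableSet_Ioi).1 h2
  intro x hx
  simp only [norm_smul]
  rw [Complex.norm_cpow_eq_rpow_re_of_pos hx]
  simp [WeakFEPair.toStrongFEPair]

lemma norm_mellin_dens_le (s : ℂ) :
    ‖mellin dens s‖ ≤ (∫ x in Ioc 0 1, x ^ (s.re - 1) * ‖dens x‖)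
      + ∫ x in Ioi 1, x ^ (s.re - 1) * ‖dens x‖ := by
  rw [← setIntegral_union (by
      rw [Set.disjoint_left]; intro x hx hx'; exact absurd hx.2 (not_le.2 hx')) measurableSet_Ioi
    ((integrableOn_dens s.re).mono_set Ioc_subset_Ioi_self)
    ((integrableOn_dens s.re).mono_set (Ioi_subset_Ioi zero_le_one)),
    Ioc_union_Ioi_eq_Ioi zero_le_one, mellin]
  refine (norm_integral_le_integral_norm _).trans (le_of_eq ?_)
  refine setIntegral_congr_fun measurableSet_Ioi fun x hx => ?_
  simp only [norm_smul]
  rw [Complex.norm_cpow_eq_rpow_re_of_pos hx]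
  simp

lemma setIntegral_Ioc_dens_le {σ : ℝ} (hσ : 0 ≤ σ) :
    ∫ x in Ioc 0 1, x ^ (σ - 1) * ‖dens x‖ ≤ 8 / π := by
  have hi : IntegrableOn (fun x : ℝ => 4 / π * x ^ (-(1 / 2) : ℝ)) (Ioc 0 1) := by
    refine Integrable.const_mul ?_ _
    rw [← IntegrableOn, ← intervalIntegrable_iff_integrableOn_Ioc_of_le zero_le_one]
    exact intervalIntegral.intervalIntegrable_rpow' (by norm_num)
  have hval : ∫ x in Ioc (0 : ℝ) 1, 4 / π * x ^ (-(1 / 2) : ℝ) = 8 / π := by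
    rw [integral_const_mul, ← intervalIntegral.integral_of_le zero_le_one,
      integral_rpow (Or.inl (by norm_num))]
    norm_num
    ring
  rw [← hval]
  refine integral_mono_ae ((integrableOn_dens σ).mono_set Ioc_subset_Ioi_self) hi ?_
  have h1 : ∀ᵐ x : ℝ ∂volume, x ≠ 1 := by simp [ae_iff, measure_singleton]
  filter_upwards [ae_restrict_mem measurableSet_Ioc, ae_restrict_of_ae h1] with x hx hx1
  have hlt : x < 1 := lt_of_le_of_ne hx.2 hx1
  calc x ^ (σ - 1) * ‖dens x‖ ≤ x ^ (σ - 1) * (4 / π * x ^ (1 / 2 : ℝ)) := by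
        gcongr
        · exact Real.rpow_nonneg hx.1.le _
        · exact norm_dens_le_of_lt_one hx.1 hlt
    _ = 4 / π * x ^ (σ - 1 / 2) := by
        rw [mul_left_comm, ← Real.rpow_add hx.1]; congr 2; ring
    _ ≤ _ := by
        refine mul_le_mul_of_nonneg_left ?_ (by positivity)
        exact Real.rpow_le_rpow_of_exponent_ge hx.1 hx.2 (by linarith)

lemma setIntegral_Ioi_dens_le {σ : ℝ} (n : ℕ) (hσ : σ - 1 ≤ n) :
    ∫ x in Ioi 1, x ^ (σ - 1) * ‖dens x‖ ≤ 4 * ∫ x in Ioi (1 : ℝ), x ^ n * Real.exp (-π * x) := by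
  rw [← integral_const_mul]
  have hi : IntegrableOn (fun x : ℝ => 4 * (x ^ n * Real.exp (-π * x))) (Ioi 1) := by
    refine Integrable.const_mul ?_ _
    have := integrableOn_rpow_mul_exp_neg_mul_rpow (p := 1) (s := n) (b := π)
      (by have : (0 : ℝ) ≤ n := by positivity
          linarith) one_pos Real.pi_pos
    refine (this.mono_set (Ioi_subset_Ioi zero_le_one)).congr_fun (fun x _ => ?_) measurableSet_Ioi
    simp
  refine setIntegral_mono_on ((integrableOn_dens σ).mono_set (Ioi_subset_Ioi zero_le_one)) hi
    measurableSet_Ioi fun x hx => ?_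
  have hx1 : (1 : ℝ) < x := hx
  calc x ^ (σ - 1) * ‖dens x‖ ≤ x ^ (n : ℝ) * (4 * Real.exp (-π * x)) := by
        gcongr
        · exact hx1.le
        · exact norm_dens_le_of_one_lt hx1
    _ = _ := by rw [Real.rpow_natCast]; ring

lemma integral_pow_mul_exp_le (n : ℕ) :
    ∫ x in Ioi (1 : ℝ), x ^ n * Real.exp (-π * x) ≤ n.factorial := by
  have hG := Real.integral_rpow_mul_exp_neg_mul_Ioi (a := n + 1) (r := 1) (by positivity) one_pos
  rw [Real.Gamma_nat_eq_factorial] at hG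
  simp only [add_sub_cancel_right, Real.rpow_natCast, one_mul] at hG
  have hi : IntegrableOn (fun x : ℝ => x ^ n * Real.exp (-x)) (Ioi 0) := by
    have := integrableOn_rpow_mul_exp_neg_mul_rpow (p := 1) (s := n) (b := 1)
      (by have : (0 : ℝ) ≤ n := by positivity
          linarith) one_pos one_pos
    refine this.congr_fun (fun x _ => ?_) measurableSet_Ioi
    simp
  have hi2 : IntegrableOn (fun x : ℝ => x ^ n * Real.exp (-π * x)) (Ioi 1) := by
    have := integrableOn_rpow_mul_exp_neg_mul_rpow (p := 1) (s := n) (b := π)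
      (by have : (0 : ℝ) ≤ n := by positivity
          linarith) one_pos Real.pi_pos
    refine (this.mono_set (Ioi_subset_Ioi zero_le_one)).congr_fun (fun x _ => ?_) measurableSet_Ioi
    simp
  calc _ ≤ ∫ x in Ioi (1 : ℝ), x ^ n * Real.exp (-x) := by
        refine setIntegral_mono_on hi2 (hi.mono_set (Ioi_subset_Ioi zero_le_one)) measurableSet_Ioi
          fun x hx => ?_
        have hx1 : (1 : ℝ) < x := hx
        gcongr
        nlinarith [Real.pi_gt_three]
    _ ≤ ∫ x in Ioi (0 : ℝ), x ^ n * Real.exp (-x) := by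
        refine setIntegral_mono_set hi ?_ (Ioi_subset_Ioi zero_le_one).eventuallyLE
        filter_upwards [ae_restrict_mem measurableSet_Ioi] with x hx
        have : (0 : ℝ) < x := hx
        positivity
    _ = _ := by simpa using hG

lemma norm_completedRiemannZeta₀_le {s : ℂ} (n : ℕ) (h0 : 0 ≤ s.re) (hn : s.re / 2 - 1 ≤ n) :
    ‖completedRiemannZeta₀ s‖ ≤ 4 / π + 2 * ∫ x in Ioi (1 : ℝ), x ^ n * Real.exp (-π * x) := by
  have hre : (s / 2).re = s.re / 2 := by simp
  have h := norm_mellin_dens_le (s / 2)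
  rw [hre] at h
  have h1 := setIntegral_Ioc_dens_le (σ := s.re / 2) (by linarith)
  have h2 := setIntegral_Ioi_dens_le (σ := s.re / 2) n hn
  rw [completedRiemannZeta₀_eq_mellin, norm_div, Complex.norm_two, div_le_iff₀ two_pos]
  calc _ ≤ _ := h
    _ ≤ 8 / π + 4 * ∫ x in Ioi (1 : ℝ), x ^ n * Real.exp (-π * x) := add_le_add h1 h2
    _ = _ := by ring

lemma norm_completedRiemannZeta₀_lt_four {s : ℂ} (h0 : 0 ≤ s.re) (h1 : s.re ≤ 2) :
    ‖completedRiemannZeta₀ s‖ < 4 := by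
  have h := norm_completedRiemannZeta₀_le 0 h0 (by simp; linarith)
  have h2 : ∫ x in Ioi (1 : ℝ), x ^ 0 * Real.exp (-π * x) ≤ (0 : ℕ).factorial :=
    integral_pow_mul_exp_le 0
  have h3 : 4 / π < 4 / 3 := by
    gcongr; exact Real.pi_gt_three
  norm_num at h2 h ⊢
  linarith

end ZetaBounds

section

/-! ### The entire function `p ↦ ξ(1/2 + p)` -/

open Topology

/-- The Riemann xi function recentred at the critical line, as an honest entire function. -/
def xiEntire (p : ℂ) : ℂ :=
  ((1 / 2 + p) * (1 / 2 + p - 1) * completedRiemannZeta₀ (1 / 2 + p) + 1) / 2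

lemma differentiable_xiEntire : Differentiable ℂ xiEntire := by
  unfold xiEntire
  have := differentiable_completedZeta₀
  fun_prop

lemma xiEntire_neg (p : ℂ) : xiEntire (-p) = xiEntire p := by
  have h := completedRiemannZeta₀_one_sub (1 / 2 + p)
  have e : 1 - (1 / 2 + p) = 1 / 2 + -p := by ring
  rw [e] at h
  rw [xiEntire, xiEntire, h]
  ring

lemma deriv_xiEntire_neg (p : ℂ) : deriv xiEntire (-p) = -deriv xiEntire p := by
  have h : (fun p => xiEntire (-p)) = xiEntire := funext xiEntire_neg
  have h2 := deriv_comp_neg xiEntire p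
  rw [h] at h2
  rw [h2, neg_neg]

lemma deriv_xiEntire_zero : deriv xiEntire 0 = 0 := by
  have := deriv_xiEntire_neg 0
  rw [neg_zero] at this
  exact self_eq_neg.1 this

lemma xiEntire_eq_completedRiemannZeta {s : ℂ} (h0 : s ≠ 0) (h1 : s ≠ 1) :
    xiEntire (s - 1 / 2) = s * (s - 1) / 2 * completedRiemannZeta s := by
  have h1' : 1 - s ≠ 0 := sub_ne_zero.2 h1.symm
  rw [completedRiemannZeta_eq, xiEntire, add_sub_cancel]
  field_simp
  ring

lemma completedRiemannZeta_eq_Zfun {s : ℂ} (hs : 0 < s.re) : completedRiemannZeta s = Zfun s := by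
  have h0 : s ≠ 0 := by rintro rfl; simp at hs
  have hG := Gammaℝ_ne_zero_of_re_pos hs
  have := riemannZeta_def_of_ne_zero h0
  rw [Zfun, this, ← Gammaℝ_def]
  field_simp

lemma xiEntire_eq_Zfun {s : ℂ} (hs : 0 < s.re) (h1 : s ≠ 1) :
    xiEntire (s - 1 / 2) = s * (s - 1) / 2 * Zfun s := by
  rw [← completedRiemannZeta_eq_Zfun hs]
  exact xiEntire_eq_completedRiemannZeta (by rintro rfl; simp at hs) h1

lemma xiEntire_eq_xi {s : ℂ} (hs : 0 < s.re) (h1 : s ≠ 1) : xiEntire (s - 1 / 2) = xi s := by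
  rw [xiEntire_eq_Zfun hs h1, xi, Zfun]
  ring

lemma xiEntire_half : xiEntire (1 / 2) = 1 / 2 := by
  rw [xiEntire]; norm_num

lemma xi_conj (s : ℂ) : xi ((starRingEnd ℂ) s) = (starRingEnd ℂ) (xi s) := by
  unfold xi
  simp only [map_mul, map_div₀, map_sub, map_one, map_ofNat, riemannZeta_conj, ← Complex.Gamma_conj]
  congr 3
  have := cpow_conj (π : ℂ) (-(starRingEnd ℂ) s / 2) (by
    rw [Complex.arg_ofReal_of_nonneg Real.pi_pos.le]; exact Real.pi_pos.ne)
  simp only [map_div₀, map_neg, Complex.conj_conj, map_ofNat, Complex.conj_ofReal] at this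
  rw [this, Complex.conj_conj]

lemma xiEntire_conj (p : ℂ) : xiEntire ((starRingEnd ℂ) p) = (starRingEnd ℂ) (xiEntire p) := by
  have key : ∀ p : ℂ, 0 ≤ p.re →
      xiEntire ((starRingEnd ℂ) p) = (starRingEnd ℂ) (xiEntire p) := by
    intro p hp
    rcases eq_or_ne p (1 / 2) with rfl | h
    · have : (starRingEnd ℂ) (1 / 2 : ℂ) = 1 / 2 := by simp [map_ofNat]
      rw [this, xiEntire_half, this]
    · have e1 : xiEntire p = xi (1 / 2 + p) := by
        rw [← xiEntire_eq_xi (by simp; linarith)]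
        · congr 1; ring
        · intro h'; exact h (by linear_combination h')
      have hc : (starRingEnd ℂ) p ≠ 1 / 2 := by
        intro h'; apply h; rw [← Complex.conj_conj p, h']; simp [map_ofNat]
      have e2 : xiEntire ((starRingEnd ℂ) p) = xi (1 / 2 + (starRingEnd ℂ) p) := by
        rw [← xiEntire_eq_xi (by simp; linarith)]
        · congr 1; ring
        · intro h'; exact hc (by linear_combination h')
      rw [e1, e2, ← xi_conj]; simp [map_ofNat]
  rcases le_total 0 p.re with h | h
  · exact key p h
  · have := key (-p) (by simpa using h)
    rwa [map_neg, xiEntire_neg, xiEntire_neg] at this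

lemma xiEntire_ne_zero_of_real (x : ℝ) : xiEntire x ≠ 0 := by
  have key : ∀ x : ℝ, 0 ≤ x → xiEntire x ≠ 0 := by
    intro x hx
    rcases lt_or_ge x (1 / 2) with h | h
    · intro h0
      have hb := ZetaBounds.norm_completedRiemannZeta₀_lt_four (s := 1 / 2 + (x : ℂ))
        (by simp; linarith) (by simp; linarith)
      have e : ((1 / 2 + x : ℂ) * (1 / 2 + x - 1)) * completedRiemannZeta₀ (1 / 2 + x) = -1 := by
        rw [xiEntire] at h0
        linear_combination 2 * h0
      have e2 := congrArg norm e
      have e3 : ((1 / 2 + x : ℂ) * (1 / 2 + x - 1)) = ((x ^ 2 - 1 / 4 : ℝ) : ℂ) := by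
        push_cast; ring
      rw [norm_mul, e3, Complex.norm_real, norm_neg, norm_one, Real.norm_eq_abs,
        abs_of_nonpos (by nlinarith)] at e2
      nlinarith [norm_nonneg (completedRiemannZeta₀ (1 / 2 + x)), sq_nonneg x]
    · rcases eq_or_ne x (1 / 2) with rfl | hne
      · push_cast; rw [xiEntire_half]; norm_num
      · have hs1 : (1 / 2 + x : ℂ) ≠ 1 := by
          intro h'; apply hne
          have : (x : ℂ) = ((1 / 2 : ℝ) : ℂ) := by push_cast; linear_combination h'
          exact_mod_cast this
        have hre : (1 / 2 + (x : ℂ)).re = 1 / 2 + x := by simp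
        have hpos : 0 < (1 / 2 + (x : ℂ)).re := by rw [hre]; linarith
        have := xiEntire_eq_Zfun hpos hs1
        rw [add_sub_cancel_left] at this
        rw [this]
        have hz := riemannZeta_ne_zero_of_one_le_re (s := 1 / 2 + (x : ℂ)) (by rw [hre]; linarith)
        have hG := Gammaℝ_ne_zero_of_re_pos hpos
        have h0 : (1 / 2 + x : ℂ) ≠ 0 := by intro h'; rw [h'] at hpos; simp at hpos
        rw [Zfun, ← Gammaℝ_def]
        exact mul_ne_zero (div_ne_zero (mul_ne_zero h0 (sub_ne_zero.2 hs1)) two_ne_zero)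
          (mul_ne_zero hG hz)
  rcases le_total 0 x with h | h
  · exact key x h
  · have := key (-x) (by linarith)
    rwa [ofReal_neg, xiEntire_neg] at this

lemma xiEntire_zero_ne_zero : xiEntire 0 ≠ 0 := by
  simpa using xiEntire_ne_zero_of_real 0

lemma re_eq_zero_of_riemannHypothesis (h : RiemannHypothesis) {p : ℂ} (hp : xiEntire p = 0) :
    p.re = 0 := by
  have key : ∀ p : ℂ, 0 ≤ p.re → xiEntire p = 0 → p.re = 0 := by
    intro p hp h0
    have hs1 : (1 / 2 + p : ℂ) ≠ 1 := by
      intro h'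
      have : p = 1 / 2 := by linear_combination h'
      rw [this, xiEntire_half] at h0
      norm_num at h0
    have hpos : 0 < (1 / 2 + p).re := by simp; linarith
    have := xiEntire_eq_Zfun hpos hs1
    rw [add_sub_cancel_left, h0] at this
    have hs0 : (1 / 2 + p : ℂ) ≠ 0 := by intro h'; rw [h'] at hpos; simp at hpos
    have hG := Gammaℝ_ne_zero_of_re_pos hpos
    have hz : riemannZeta (1 / 2 + p) = 0 := by
      rw [Zfun, ← Gammaℝ_def] at this
      have h2 : (1 / 2 + p) * (1 / 2 + p - 1) / 2 ≠ 0 :=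
        div_ne_zero (mul_ne_zero hs0 (sub_ne_zero.2 hs1)) two_ne_zero
      rcases mul_eq_zero.1 this.symm with h3 | h3
      · exact absurd h3 h2
      · exact (mul_eq_zero.1 h3).resolve_left hG
    have h3 := h _ hz (by
      rintro ⟨n, hn⟩
      rw [hn] at hpos
      simp at hpos
      have : (0 : ℝ) ≤ n := by positivity
      linarith) hs1
    simpa using h3
  rcases le_total 0 p.re with h | h
  · exact key p h hp
  · have := key (-p) (by simpa using h) (by rwa [xiEntire_neg])
    simpa using this

lemma riemannHypothesis_of_xiEntire_ne_zero (h : ∀ p : ℂ, 0 < p.re → xiEntire p ≠ 0) :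
    RiemannHypothesis := by
  intro s hs hnt hs1
  have hs0 : s ≠ 0 := by rintro rfl; rw [riemannZeta_zero] at hs; norm_num at hs
  have hG : Gammaℝ s ≠ 0 := by
    intro hG
    obtain ⟨n, hn⟩ := Gammaℝ_eq_zero_iff.1 hG
    rcases n with _ | n
    · simp at hn; exact hs0 hn
    · exact hnt ⟨n, by rw [hn]; push_cast; ring⟩
  have hΛ : completedRiemannZeta s = 0 := by
    have := riemannZeta_def_of_ne_zero hs0
    rw [hs] at this
    exact (div_eq_zero_iff.1 this.symm).resolve_right hG
  have hX : xiEntire (s - 1 / 2) = 0 := by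
    rw [xiEntire_eq_completedRiemannZeta hs0 hs1, hΛ, mul_zero]
  have hX' : xiEntire (-(s - 1 / 2)) = 0 := by rwa [xiEntire_neg]
  by_contra hne
  rcases lt_or_gt_of_ne hne with hlt | hgt
  · exact h _ (by simp; linarith) hX'
  · exact h _ (by simp; linarith) hX

lemma exists_xiEntire_growth : ∃ C : ℝ, 0 ≤ C ∧
    ∀ p, ‖xiEntire p‖ ≤ Real.exp (C * (1 + ‖p‖) ^ (3 / 2 : ℝ)) := by
  refine ⟨8, by norm_num, ?_⟩
  have key : ∀ p : ℂ, 0 ≤ p.re → ‖xiEntire p‖ ≤ Real.exp (8 * (1 + ‖p‖) ^ (3 / 2 : ℝ)) := by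
    intro p hp
    set y : ℝ := 1 + ‖p‖
    have hy1 : 1 ≤ y := by simp [y]
    set n := ⌈‖p‖⌉₊
    have hpn : ‖p‖ ≤ n := Nat.le_ceil _
    have hny : (n : ℝ) ≤ y := by
      have := (Nat.ceil_lt_add_one (norm_nonneg p)).le
      simp only [y]; linarith
    have hre : p.re ≤ ‖p‖ := Complex.re_le_norm p
    have h1 := ZetaBounds.norm_completedRiemannZeta₀_le (s := 1 / 2 + p) n
      (by simp; linarith) (by simp; linarith)
    have h2 := ZetaBounds.integral_pow_mul_exp_le n
    have h3 : 4 / π < 4 / 3 := by gcongr; exact Real.pi_gt_three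
    have hfac : (n.factorial : ℝ) ≤ y ^ y := by
      calc (n.factorial : ℝ) ≤ (n : ℝ) ^ n := by exact_mod_cast Nat.factorial_le_pow n
        _ ≤ y ^ n := by gcongr
        _ = y ^ (n : ℝ) := (Real.rpow_natCast _ _).symm
        _ ≤ y ^ y := Real.rpow_le_rpow_of_exponent_le hy1 hny
    have hyy1 : 1 ≤ y ^ y := Real.one_le_rpow hy1 (by linarith)
    have hZ : ‖completedRiemannZeta₀ (1 / 2 + p)‖ ≤ 4 * y ^ y := by linarith
    have hq : ‖(1 / 2 + p) * (1 / 2 + p - 1)‖ ≤ y ^ 2 := by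
      rw [norm_mul, sq]
      gcongr
      · refine (norm_add_le _ _).trans ?_
        simp only [y]; norm_num
      · rw [show (1 / 2 + p - 1 : ℂ) = p - 1 / 2 by ring]
        refine (norm_sub_le _ _).trans ?_
        simp only [y]; norm_num; linarith
    have hX : ‖xiEntire p‖ ≤ 3 * y ^ 2 * y ^ y := by
      rw [xiEntire, norm_div, Complex.norm_two, div_le_iff₀ two_pos]
      calc _ ≤ ‖(1 / 2 + p) * (1 / 2 + p - 1)‖ * ‖completedRiemannZeta₀ (1 / 2 + p)‖ + 1 := by
            refine (norm_add_le _ _).trans ?_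
            rw [norm_mul, norm_one]
        _ ≤ y ^ 2 * (4 * y ^ y) + 1 := by gcongr
        _ ≤ _ := by
            have : 1 ≤ y ^ 2 * y ^ y := one_le_mul_of_one_le_of_one_le (one_le_pow₀ hy1) hyy1
            nlinarith
    refine hX.trans ?_
    have hy0 : 0 < y := by linarith
    have hlog : Real.log y ≤ 2 * y ^ (1 / 2 : ℝ) := by
      have := Real.log_le_rpow_div hy0.le (by norm_num : (0 : ℝ) < 1 / 2)
      linarith
    have hhalf : y ^ (1 / 2 : ℝ) ≤ y ^ (3 / 2 : ℝ) :=
      Real.rpow_le_rpow_of_exponent_le hy1 (by norm_num)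
    have h32 : y ^ (3 / 2 : ℝ) = y * y ^ (1 / 2 : ℝ) := by
      rw [show (3 / 2 : ℝ) = 1 + 1 / 2 by norm_num, Real.rpow_add hy0, Real.rpow_one]
    have h32' : 1 ≤ y ^ (3 / 2 : ℝ) := Real.one_le_rpow hy1 (by norm_num)
    have e3 : (3 : ℝ) ≤ Real.exp 2 := by
      have := Real.add_one_le_exp (2 : ℝ)
      linarith
    calc 3 * y ^ 2 * y ^ y ≤ Real.exp 2 * Real.exp (2 * Real.log y) * Real.exp (Real.log y * y) := by
          have e4 : Real.exp (2 * Real.log y) = y ^ 2 := by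
            rw [two_mul, Real.exp_add, Real.exp_log hy0]; ring
          rw [e4, ← Real.rpow_def_of_pos hy0]
          gcongr
      _ ≤ _ := by
          rw [← Real.exp_add, ← Real.exp_add]
          apply Real.exp_le_exp.2
          nlinarith
  intro p
  rcases le_total 0 p.re with h | h
  · exact key p h
  · have := key (-p) (by simpa using h)
    rwa [xiEntire_neg, norm_neg] at this

/-- The zeros of `xiEntire`. -/
abbrev XiZero : Type := {p : ℂ // xiEntire p = 0}

/-- The multiplicity of a zero of `xiEntire`. -/
def xiMult (ρ : XiZero) : ℕ := analyticOrderNatAt xiEntire ρ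

lemma xiMult_pos (ρ : XiZero) : 0 < xiMult ρ := by
  have h1 := EntireFunction.analyticOrderAt_ne_top_of_differentiable differentiable_xiEntire
    xiEntire_zero_ne_zero ρ
  have h2 : analyticOrderAt xiEntire ρ ≠ 0 :=
    (differentiable_xiEntire.analyticAt ρ).analyticOrderAt_ne_zero.2 ρ.2
  rw [xiMult, Nat.pos_iff_ne_zero]
  intro h
  rw [← Nat.cast_analyticOrderNatAt h1] at h2
  simp [h] at h2

lemma XiZero.ne_zero (ρ : XiZero) : (ρ : ℂ) ≠ 0 := by
  intro h
  apply xiEntire_zero_ne_zero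
  have := ρ.2
  rwa [h] at this

lemma summable_xiMult : Summable fun ρ : XiZero => (xiMult ρ : ℝ) / ‖(ρ : ℂ)‖ ^ 2 := by
  obtain ⟨C, hC, hg⟩ := exists_xiEntire_growth
  exact EntireFunction.summable_order_div_sq differentiable_xiEntire xiEntire_zero_ne_zero hC hg

lemma hasSum_logDeriv_xiEntire {p : ℂ} (hp : xiEntire p ≠ 0) :
    HasSum (fun ρ : XiZero => (xiMult ρ : ℂ) * (1 / (p - ρ) + 1 / ρ))
      (deriv xiEntire p / xiEntire p) := by
  obtain ⟨C, hC, hg⟩ := exists_xiEntire_growth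
  have := EntireFunction.hasSum_logDeriv differentiable_xiEntire xiEntire_zero_ne_zero hC hg hp
  simpa [deriv_xiEntire_zero, xiMult] using this

lemma finite_xiZero_norm_le (R : ℝ) : {ρ : XiZero | ‖(ρ : ℂ)‖ ≤ R}.Finite := by
  refine ((EntireFunction.finite_zeros_closedBall differentiable_xiEntire
    xiEntire_zero_ne_zero R).preimage Subtype.val_injective.injOn).subset ?_
  intro ρ hρ
  exact ⟨ρ.2, hρ⟩

instance : Countable XiZero := by
  have : (univ : Set XiZero) = ⋃ n : ℕ, {ρ : XiZero | ‖(ρ : ℂ)‖ ≤ n} := by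
    ext ρ
    simpa using exists_nat_ge ‖(ρ : ℂ)‖
  rw [← Set.countable_univ_iff, this]
  exact Set.countable_iUnion fun n => (finite_xiZero_norm_le n).countable

end

section

/-! ### The series of the digamma function -/

open Topology

namespace DigammaSeries

lemma differentiableAt_realGamma {x : ℝ} (hx : 0 < x) : DifferentiableAt ℝ Real.Gamma x :=
  Real.differentiableAt_Gamma fun m h => by
    rw [h] at hx
    have : (0 : ℝ) ≤ m := by positivity
    linarith

lemma complexGamma_ofReal_hasDerivAt {x : ℝ} (hx : 0 < x) :
    HasDerivAt Complex.Gamma ((deriv Real.Gamma x : ℝ) : ℂ) x := by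
  have h1 : DifferentiableAt ℂ Complex.Gamma (x : ℂ) := by
    refine Complex.differentiableAt_Gamma _ fun m h => ?_
    have := congrArg Complex.re h
    simp at this
    have h2 : (0 : ℝ) ≤ m := by positivity
    linarith
  have h2 : DifferentiableAt ℝ Real.Gamma x := differentiableAt_realGamma hx
  have h3 := h1.hasDerivAt.comp_ofReal
  have h4 := h2.hasDerivAt.ofReal_comp
  have h5 : (fun y : ℝ => Complex.Gamma y) = fun y : ℝ => ((Real.Gamma y : ℝ) : ℂ) :=
    funext fun y => Complex.Gamma_ofReal y
  rw [h5] at h3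
  rw [← h3.unique h4]
  exact h1.hasDerivAt

lemma digamma_ofReal {x : ℝ} (hx : 0 < x) : _root_.digamma (x : ℂ) = (digammaR x : ℂ) := by
  rw [_root_.digamma, digammaR, (complexGamma_ofReal_hasDerivAt hx).deriv, Complex.Gamma_ofReal]
  push_cast; rfl

lemma digammaR_add_one {x : ℝ} (hx : 0 < x) : digammaR (x + 1) = digammaR x + 1 / x := by
  have h1 : HasDerivAt Real.Gamma (deriv Real.Gamma (x + 1)) (x + 1) :=
    (differentiableAt_realGamma (by linarith)).hasDerivAt
  have h2 : HasDerivAt Real.Gamma (deriv Real.Gamma x) x :=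
    (differentiableAt_realGamma hx).hasDerivAt
  have h3 := (hasDerivAt_id x).mul h2
  have h4 := h1.comp_add_const x 1
  have h5 : (fun y => Real.Gamma (y + 1)) =ᶠ[𝓝 x] (id * Real.Gamma) := by
    filter_upwards [eventually_ne_nhds hx.ne'] with y hy
    simp [Real.Gamma_add_one hy]
  have h6 := h4.unique (h3.congr_of_eventuallyEq h5)
  have hG := (Real.Gamma_pos_of_pos hx).ne'
  rw [digammaR, digammaR, h6, Real.Gamma_add_one hx.ne']
  simp only [id]
  field_simp
  ring

lemma digammaR_add_nat {x : ℝ} (hx : 0 < x) (n : ℕ) :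
    digammaR (x + n) = digammaR x + ∑ j ∈ Finset.range n, 1 / ((j : ℝ) + x) := by
  induction n with
  | zero => simp
  | succ n ih =>
    have := digammaR_add_one (x := x + n) (by positivity)
    rw [Finset.sum_range_succ, ← add_assoc, ← ih]
    push_cast
    rw [← add_assoc, this, add_comm x]

lemma monotoneOn_digammaR : MonotoneOn digammaR (Ioi 0) := by
  have h := Real.convexOn_log_Gamma.monotoneOn_deriv fun x hx =>
    (differentiableAt_realGamma hx).log (Real.Gamma_pos_of_pos hx).ne'
  have e : ∀ x ∈ Ioi (0 : ℝ), deriv (Real.log ∘ Real.Gamma) x = digammaR x := by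
    intro x hx
    exact (((differentiableAt_realGamma hx).hasDerivAt).log
      (Real.Gamma_pos_of_pos hx).ne').deriv
  intro x hx y hy hxy
  have := h hx hy hxy
  rwa [e x hx, e y hy] at this

lemma tendsto_digammaR_add_sub {x : ℝ} (hx : 0 < x) :
    Tendsto (fun n : ℕ => digammaR (x + n) - digammaR n) atTop (𝓝 0) := by
  obtain ⟨k, hk⟩ := exists_nat_ge x
  have h0 : Tendsto (fun n : ℕ => ∑ j ∈ Finset.range k, 1 / ((j : ℝ) + n)) atTop (𝓝 0) := by
    rw [← Finset.sum_const_zero (s := Finset.range k)]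
    refine tendsto_finsetSum _ fun j _ => ?_
    have : Tendsto (fun n : ℕ => (j : ℝ) + n) atTop atTop :=
      tendsto_atTop_add_const_left _ _ tendsto_natCast_atTop_atTop
    simp only [one_div]
    exact tendsto_inv_atTop_zero.comp this
  refine squeeze_zero' ?_ ?_ h0
  · filter_upwards [eventually_gt_atTop 0] with n hn
    have hn' : (0 : ℝ) < n := by exact_mod_cast hn
    exact sub_nonneg.2 (monotoneOn_digammaR (mem_Ioi.2 hn') (mem_Ioi.2 (by linarith)) (by linarith))
  · filter_upwards [eventually_gt_atTop 0] with n hn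
    have hn' : (0 : ℝ) < n := by exact_mod_cast hn
    have h1 := monotoneOn_digammaR (mem_Ioi.2 (by linarith : 0 < x + n))
      (mem_Ioi.2 (by linarith : 0 < (n : ℝ) + k)) (by linarith)
    rw [digammaR_add_nat hn'] at h1
    linarith

lemma norm_nat_add_ge {s : ℂ} (n : ℕ) : (n : ℝ) + s.re ≤ ‖(n : ℂ) + s‖ := by
  have := Complex.re_le_norm ((n : ℂ) + s)
  simpa using this

lemma summable_bound {c : ℝ} (hc : 0 < c) (B : ℝ) :
    Summable fun n : ℕ => B / ((n : ℝ) + c) ^ 2 := by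
  have := (Real.summable_one_div_nat_add_rpow c 2).2 (by norm_num)
  refine (this.mul_left B).congr fun n => ?_
  rw [abs_of_pos (by positivity)]
  norm_num
  rfl

lemma norm_term_le {a c : ℝ} (hc : 0 < c) (hca : c ≤ a) {s : ℂ} (hs : c ≤ s.re) (n : ℕ) :
    ‖1 / ((n : ℂ) + a) - 1 / ((n : ℂ) + s)‖ ≤ ‖s - a‖ / ((n : ℝ) + c) ^ 2 := by
  have h1 : (n : ℝ) + c ≤ ‖(n : ℂ) + s‖ := (by linarith : (n : ℝ) + c ≤ n + s.re).trans (norm_nat_add_ge n)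
  have h2 : (n : ℝ) + c ≤ ‖(n : ℂ) + a‖ := by
    have := norm_nat_add_ge (s := (a : ℂ)) n
    simp only [ofReal_re] at this
    linarith
  have hp : 0 < (n : ℝ) + c := by positivity
  have n1 : (n : ℂ) + s ≠ 0 := norm_pos_iff.1 (hp.trans_le h1)
  have n2 : (n : ℂ) + a ≠ 0 := norm_pos_iff.1 (hp.trans_le h2)
  have e : 1 / ((n : ℂ) + a) - 1 / ((n : ℂ) + s) = (s - a) / (((n : ℂ) + a) * ((n : ℂ) + s)) := by
    field_simp
    ring
  rw [e, norm_div, norm_mul, sq]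
  gcongr

lemma hasSum_digamma_sub_ofReal {a x : ℝ} (ha : 0 < a) (hx : 0 < x) :
    HasSum (fun n : ℕ => 1 / ((n : ℂ) + a) - 1 / ((n : ℂ) + x))
      (_root_.digamma x - _root_.digamma a) := by
  have hs : Summable fun n : ℕ => 1 / ((n : ℂ) + a) - 1 / ((n : ℂ) + x) :=
    Summable.of_norm_bounded (summable_bound (c := min a x) (lt_min ha hx) _) fun n =>
      norm_term_le (lt_min ha hx) (min_le_left _ _) (by simp) n
  have hlim := hs.hasSum.tendsto_sum_nat
  have h2 : Tendsto (fun n : ℕ => ((digammaR x - digammaR a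
      - ((digammaR (x + n) - digammaR n) - (digammaR (a + n) - digammaR n)) : ℝ) : ℂ)) atTop
      (𝓝 ((digammaR x - digammaR a : ℝ) : ℂ)) := by
    refine (Complex.continuous_ofReal.tendsto _).comp ?_
    have := ((tendsto_digammaR_add_sub hx).sub (tendsto_digammaR_add_sub ha)).const_sub
      (digammaR x - digammaR a)
    simpa using this
  have h3 : (fun n : ℕ => ((digammaR x - digammaR a
      - ((digammaR (x + n) - digammaR n) - (digammaR (a + n) - digammaR n)) : ℝ) : ℂ))
      = fun n => ∑ j ∈ Finset.range n, (1 / ((j : ℂ) + a) - 1 / ((j : ℂ) + x)) := by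
    ext n
    rw [digammaR_add_nat hx, digammaR_add_nat ha, Finset.sum_sub_distrib]
    push_cast
    ring
  rw [h3] at h2
  rw [digamma_ofReal ha, digamma_ofReal hx, ← ofReal_sub, ← tendsto_nhds_unique hlim h2]
  exact hs.hasSum

theorem hasSum_digamma_sub {a : ℝ} (ha : 0 < a) {s : ℂ} (hs : 0 < s.re) :
    HasSum (fun n : ℕ => 1 / ((n : ℂ) + a) - 1 / ((n : ℂ) + s))
      (_root_.digamma s - _root_.digamma a) := by
  set c : ℝ := min a s.re / 2
  have hm : 0 < min a s.re := lt_min ha hs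
  have hc : 0 < c := by positivity
  have hca : c < a := by have := min_le_left a s.re; simp only [c]; linarith
  have hcs : c < s.re := by have := min_le_right a s.re; simp only [c]; linarith
  set B : ℝ := ‖s‖ + a + 1
  set U : Set ℂ := {z | c < z.re} ∩ Metric.ball 0 B
  have hUo : IsOpen U := (isOpen_lt continuous_const Complex.continuous_re).inter Metric.isOpen_ball
  have hUc : IsPreconnected U :=
    ((convex_halfSpace_re_gt c).inter (convex_ball (0 : ℂ) B)).isPreconnected
  have hne : ∀ z ∈ U, ∀ n : ℕ, (n : ℂ) + z ≠ 0 := by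
    intro z hz n h
    have := congrArg Complex.re h
    have h1 : c < z.re := hz.1
    have h2 : (0 : ℝ) ≤ n := by positivity
    simp at this
    linarith
  have hd1 : DifferentiableOn ℂ (fun z => ∑' n : ℕ, (1 / ((n : ℂ) + a) - 1 / ((n : ℂ) + z))) U := by
    refine Complex.differentiableOn_tsum_of_summable_norm (summable_bound hc (B + a)) ?_ hUo ?_
    · intro n z hz
      exact ((differentiableAt_const _).sub ((differentiableAt_const _).div (by fun_prop)
        (hne z hz n))).differentiableWithinAt
    · intro n z hz
      refine (norm_term_le hc hca.le (le_of_lt hz.1) n).trans ?_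
      gcongr
      refine (norm_sub_le _ _).trans ?_
      have : ‖z‖ < B := by simpa using hz.2
      simp only [Complex.norm_real, Real.norm_eq_abs, abs_of_pos ha]
      linarith
  have hd2 : DifferentiableOn ℂ (fun z => _root_.digamma z - _root_.digamma a) U := by
    intro z hz
    have hz0 : 0 < z.re := hc.trans hz.1
    have hne' : ∀ m : ℕ, z ≠ -m := fun m h => hne z hz m (by rw [h]; ring)
    have hopen : IsOpen {z : ℂ | 0 < z.re} := isOpen_lt continuous_const Complex.continuous_re
    have hG : DifferentiableOn ℂ Complex.Gamma {z : ℂ | 0 < z.re} := by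
      intro y hy
      refine (Complex.differentiableAt_Gamma _ fun m h => ?_).differentiableWithinAt
      have hy' : 0 < y.re := hy
      rw [h] at hy'
      simp at hy'
      have h2 : (0 : ℝ) ≤ m := by positivity
      linarith
    have hA := hG.analyticAt (hopen.mem_nhds hz0)
    exact ((hA.deriv.differentiableAt.div hA.differentiableAt
      (Complex.Gamma_ne_zero hne')).sub_const _).differentiableWithinAt
  have haU : (a : ℂ) ∈ U := by
    refine ⟨by simpa using hca, ?_⟩
    simp only [Metric.mem_ball, dist_zero_right, Complex.norm_real, Real.norm_eq_abs, abs_of_pos ha]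
    have := norm_nonneg s
    simp only [B]; linarith
  have hsU : s ∈ U := by
    refine ⟨hcs, ?_⟩
    simp only [Metric.mem_ball, dist_zero_right, B]; linarith
  have hfreq : ∃ᶠ z in 𝓝[≠] (a : ℂ), (∑' n : ℕ, (1 / ((n : ℂ) + a) - 1 / ((n : ℂ) + z)))
      = _root_.digamma z - _root_.digamma a := by
    have ht : Tendsto (fun x : ℝ => (x : ℂ)) (𝓝[≠] a) (𝓝[≠] (a : ℂ)) := by
      refine tendsto_nhdsWithin_iff.2 ⟨?_, ?_⟩
      · exact (Complex.continuous_ofReal.tendsto a).mono_left nhdsWithin_le_nhds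
      · filter_upwards [self_mem_nhdsWithin] with x hx
        simpa using hx
    refine ht.frequently (Eventually.frequently ?_)
    filter_upwards [nhdsWithin_le_nhds (Ioi_mem_nhds ha)] with x hx
    exact (hasSum_digamma_sub_ofReal ha hx).tsum_eq
  have heq := (hd1.analyticOnNhd hUo).eqOn_of_preconnected_of_frequently_eq
    (hd2.analyticOnNhd hUo) hUc haU hfreq hsU
  have hsum : Summable fun n : ℕ => 1 / ((n : ℂ) + a) - 1 / ((n : ℂ) + s) :=
    Summable.of_norm_bounded (summable_bound hc _) fun n => norm_term_le hc hca.le hcs.le n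
  simp only at heq
  rw [← heq]
  exact hsum.hasSum

end DigammaSeries

end

section

/-! ### Logarithmic derivatives of `ξ` and of the completed zeta function -/

open Topology

lemma Zfun_differentiableAt {s : ℂ} (hs : 0 < s.re) (h1 : s ≠ 1) : DifferentiableAt ℂ Zfun s := by
  have h0 : s ≠ 0 := by rintro rfl; simp at hs
  refine (differentiableAt_completedZeta h0 h1).congr_of_eventuallyEq ?_
  filter_upwards [(isOpen_lt continuous_const Complex.continuous_re).mem_nhds hs] with z hz
  exact (completedRiemannZeta_eq_Zfun hz).symm

lemma logDeriv_xiEntire_eq_Zfun {s : ℂ} (hs : 0 < s.re) (h1 : s ≠ 1)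
    (hx : xiEntire (s - 1 / 2) ≠ 0) :
    deriv xiEntire (s - 1 / 2) / xiEntire (s - 1 / 2)
      = 1 / s + 1 / (s - 1) + deriv Zfun s / Zfun s := by
  have h0 : s ≠ 0 := by rintro rfl; simp at hs
  have h1' : s - 1 ≠ 0 := sub_ne_zero.2 h1
  have hZ : Zfun s ≠ 0 := by
    intro h; apply hx; rw [xiEntire_eq_Zfun hs h1, h, mul_zero]
  have e : (fun z => xiEntire (z - 1 / 2)) =ᶠ[𝓝 s] fun z => z * (z - 1) / 2 * Zfun z := by
    filter_upwards [(isOpen_lt continuous_const Complex.continuous_re).mem_nhds hs,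
      eventually_ne_nhds h1] with z hz hz1
    exact xiEntire_eq_Zfun hz hz1
  have d1 : HasDerivAt (fun z => xiEntire (z - 1 / 2)) (deriv xiEntire (s - 1 / 2)) s :=
    (differentiable_xiEntire _).hasDerivAt.comp_sub_const s (1 / 2)
  have d2 : HasDerivAt (fun z : ℂ => z * (z - 1) / 2 * Zfun z)
      ((1 * (s - 1) + s * 1) / 2 * Zfun s + s * (s - 1) / 2 * deriv Zfun s) s :=
    (((hasDerivAt_id s).mul ((hasDerivAt_id s).sub_const 1)).div_const 2).mul
      (Zfun_differentiableAt hs h1).hasDerivAt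
  rw [d1.unique (d2.congr_of_eventuallyEq e), xiEntire_eq_Zfun hs h1]
  field_simp

lemma logDeriv_Zfun {s : ℂ} (hs : 0 < s.re) (h1 : s ≠ 1) (hz : riemannZeta s ≠ 0) :
    deriv Zfun s / Zfun s = -(1 / 2) * (Real.log π : ℂ) + 1 / 2 * _root_.digamma (s / 2)
      + deriv riemannZeta s / riemannZeta s := by
  have hpi : (π : ℂ) ≠ 0 := by exact_mod_cast Real.pi_ne_zero
  have hs2 : ∀ m : ℕ, s / 2 ≠ -m := by
    intro m h
    have h3 := congrArg Complex.re h
    have : (0 : ℝ) ≤ m := by positivity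
    simp at h3
    linarith
  have hG := Complex.Gamma_ne_zero hs2
  have d1 : HasDerivAt (fun s : ℂ => (π : ℂ) ^ (-s / 2))
      ((π : ℂ) ^ (-s / 2) * Complex.log π * (-1 / 2)) s :=
    HasDerivAt.const_cpow ((hasDerivAt_neg s).div_const 2) (Or.inl hpi)
  have d2 : HasDerivAt (fun s : ℂ => Complex.Gamma (s / 2))
      (deriv Complex.Gamma (s / 2) * (1 / 2)) s :=
    (Complex.differentiableAt_Gamma _ hs2).hasDerivAt.comp s ((hasDerivAt_id s).div_const 2)
  have d3 := (differentiableAt_riemannZeta h1).hasDerivAt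
  have d4 : HasDerivAt Zfun _ s := (d1.mul d2).mul d3
  have hc : (π : ℂ) ^ (-s / 2) ≠ 0 := by
    rw [Complex.cpow_ne_zero_iff]; exact Or.inl hpi
  rw [d4.deriv, Zfun, _root_.digamma, Complex.ofReal_log Real.pi_pos.le]
  simp only [Pi.mul_apply]
  field_simp

/-! ### Laplace transforms on the half-line -/

/-- `φ` has an absolutely convergent Laplace transform at `p`, with value `v`. -/
def HasLaplace (φ : ℝ → ℂ) (p v : ℂ) : Prop :=
  IntegrableOn (fun t : ℝ => φ t * Complex.exp (-p * t)) (Ioi 0) ∧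
    ∫ t in Ioi (0 : ℝ), φ t * Complex.exp (-p * t) = v

namespace HasLaplace

variable {φ ψ : ℝ → ℂ} {p v w : ℂ}

lemma add (h1 : HasLaplace φ p v) (h2 : HasLaplace ψ p w) :
    HasLaplace (fun t => φ t + ψ t) p (v + w) := by
  have e : (fun t : ℝ => (φ t + ψ t) * Complex.exp (-p * t))
      = fun t => φ t * Complex.exp (-p * t) + ψ t * Complex.exp (-p * t) := by
    ext t; ring
  refine ⟨by rw [e]; exact h1.1.add h2.1, ?_⟩
  rw [e, integral_add h1.1 h2.1, h1.2, h2.2]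

lemma const_mul (c : ℂ) (h1 : HasLaplace φ p v) : HasLaplace (fun t => c * φ t) p (c * v) := by
  have e : (fun t : ℝ => (c * φ t) * Complex.exp (-p * t))
      = fun t => c * (φ t * Complex.exp (-p * t)) := by
    ext t; ring
  refine ⟨by rw [e]; exact h1.1.const_mul c, ?_⟩
  rw [e, integral_const_mul, h1.2]

lemma congr (h1 : HasLaplace φ p v) (h : ∀ t, 0 < t → ψ t = φ t) (hv : w = v) :
    HasLaplace ψ p w := by
  have e : EqOn (fun t : ℝ => φ t * Complex.exp (-p * t))
      (fun t : ℝ => ψ t * Complex.exp (-p * t)) (Ioi 0) := fun t ht => by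
    simp only [h t ht]
  exact ⟨h1.1.congr_fun e measurableSet_Ioi, by
    rw [← setIntegral_congr_fun measurableSet_Ioi e, h1.2, hv]⟩

lemma sub (h1 : HasLaplace φ p v) (h2 : HasLaplace ψ p w) :
    HasLaplace (fun t => φ t - ψ t) p (v - w) :=
  (h1.add (h2.const_mul (-1))).congr (fun t _ => by ring) (by ring)

lemma exp {a : ℂ} (h : a.re < p.re) :
    HasLaplace (fun t : ℝ => Complex.exp (a * t)) p (1 / (p - a)) := by
  have hre : (a - p).re < 0 := by simpa using h
  have e : (fun t : ℝ => Complex.exp (a * t) * Complex.exp (-p * t))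
      = fun t : ℝ => Complex.exp ((a - p) * t) := by
    ext t; rw [← Complex.exp_add]; congr 1; ring
  refine ⟨by rw [e]; exact integrableOn_exp_mul_complex_Ioi hre 0, ?_⟩
  rw [e, integral_exp_mul_complex_Ioi hre 0]
  simp only [ofReal_zero, mul_zero, Complex.exp_zero]
  rw [← neg_sub p a, neg_div_neg_eq]

lemma one (h : 0 < p.re) : HasLaplace (fun _ => 1) p (1 / p) :=
  (exp (a := 0) (by simpa using h)).congr (fun t _ => by simp) (by simp)

/-- A ramp starting at `L ≥ 0`. -/
lemma ramp (h : 0 < p.re) {L : ℝ} (hL : 0 ≤ L) :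
    HasLaplace (fun t : ℝ => ((max (t - L) 0 : ℝ) : ℂ)) p (Complex.exp (-p * L) / p ^ 2) := by
  have hp : p ≠ 0 := by rintro rfl; simp at h
  set F : ℝ → ℂ := fun t => -(((t : ℂ) - L) / p + 1 / p ^ 2) * Complex.exp (-p * t)
  have hderiv : ∀ t ∈ Ioi L, HasDerivAt F (((t : ℂ) - L) * Complex.exp (-p * t)) t := by
    intro t _
    have h1 : HasDerivAt (fun t : ℂ => -((t - L) / p + 1 / p ^ 2) * Complex.exp (-p * t))
        (-(1 / p) * Complex.exp (-p * t) + -(((t : ℂ) - L) / p + 1 / p ^ 2) *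
          (Complex.exp (-p * t) * (-p * 1))) (t : ℂ) :=
      ((((((hasDerivAt_id (t : ℂ)).sub_const (L : ℂ)).div_const p).add_const (1 / p ^ 2))).neg).mul
        (((hasDerivAt_id (t : ℂ)).const_mul (-p)).cexp)
    refine h1.comp_ofReal.congr_deriv ?_
    field_simp
    ring
  have hlim : Tendsto F atTop (𝓝 0) := by
    have h1 : Tendsto (fun t : ℝ => Real.exp (-p.re * t)) atTop (𝓝 0) :=
      Real.tendsto_exp_atBot.comp (tendsto_id.const_mul_atTop_of_neg (by linarith))
    have h2 : Tendsto (fun t : ℝ => t * Real.exp (-p.re * t)) atTop (𝓝 0) := by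
      have := Real.tendsto_pow_mul_exp_neg_atTop_nhds_zero 1
      have h3 := (this.comp (tendsto_id.const_mul_atTop h)).const_mul (1 / p.re)
      rw [mul_zero] at h3
      refine h3.congr fun t => ?_
      simp only [Function.comp, id, pow_one]
      rw [neg_mul]; field_simp
    have h4 := (h2.const_mul (1 / ‖p‖)).add (h1.const_mul (‖-(L : ℂ) / p + 1 / p ^ 2‖))
    rw [mul_zero, mul_zero, add_zero] at h4
    refine squeeze_zero_norm' ?_ h4
    filter_upwards [eventually_ge_atTop 0] with t ht
    simp only [F]
    rw [norm_mul, Complex.norm_exp, norm_neg]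
    have e : (-p * (t : ℂ)).re = -p.re * t := by simp
    rw [e]
    have : ‖((t : ℂ) - L) / p + 1 / p ^ 2‖ ≤ 1 / ‖p‖ * t + ‖-(L : ℂ) / p + 1 / p ^ 2‖ := by
      have e2 : ((t : ℂ) - L) / p + 1 / p ^ 2 = t / p + (-(L : ℂ) / p + 1 / p ^ 2) := by
        rw [sub_div, neg_div]; ring
      rw [e2]
      refine (norm_add_le _ _).trans ?_
      rw [norm_div, Complex.norm_real, Real.norm_eq_abs, abs_of_nonneg ht]
      apply le_of_eq; ring
    refine (mul_le_mul_of_nonneg_right this (Real.exp_pos _).le).trans (le_of_eq ?_)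
    ring
  have hintegrable : IntegrableOn (fun t : ℝ => ((t : ℂ) - L) * Complex.exp (-p * t)) (Ioi L) := by
    have h1 : IntegrableOn (fun t : ℝ => Complex.exp (-(p / 2) * t)) (Ioi L) :=
      integrableOn_exp_mul_complex_Ioi (by simpa using h) L
    refine ((h1.norm.const_mul (2 / p.re))).mono' ?_ ?_
    · exact (by fun_prop : Continuous fun t : ℝ => ((t : ℂ) - L) * Complex.exp (-p * t)
        ).aestronglyMeasurable
    · filter_upwards [ae_restrict_mem measurableSet_Ioi] with t ht
      have htL : 0 < t - L := sub_pos.2 ht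
      rw [norm_mul, Complex.norm_exp, Complex.norm_exp, ← ofReal_sub, Complex.norm_real,
        Real.norm_eq_abs, abs_of_pos htL]
      have e1 : (-p * (t : ℂ)).re = -p.re / 2 * t + -p.re / 2 * t := by simp; ring
      have e2 : (-(p / 2) * (t : ℂ)).re = -p.re / 2 * t := by simp; ring
      rw [e1, e2, Real.exp_add, ← mul_assoc]
      refine mul_le_mul_of_nonneg_right ?_ (Real.exp_pos _).le
      have h5 : t * p.re / 2 ≤ Real.exp (t * p.re / 2) := by
        have := Real.add_one_le_exp (t * p.re / 2); linarith
      have h6 : -p.re / 2 * t = -(t * p.re / 2) := by ring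
      rw [h6, Real.exp_neg, ← div_eq_mul_inv, div_le_div_iff₀ (Real.exp_pos _) h]
      nlinarith
  have hFL : F L = -(Complex.exp (-p * L) / p ^ 2) := by
    simp only [F, sub_self, zero_div]; ring
  have hval := integral_Ioi_of_hasDerivAt_of_tendsto
    (a := L) (f := F) (by
      refine Continuous.continuousWithinAt ?_
      simp only [F]; fun_prop) hderiv hintegrable hlim
  have hsub : Ioi L ⊆ Ioi (0 : ℝ) := Ioi_subset_Ioi hL
  have e : EqOn (fun t : ℝ => ((max (t - L) 0 : ℝ) : ℂ) * Complex.exp (-p * t))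
      ((Ioi L).indicator (fun t : ℝ => ((t : ℂ) - L) * Complex.exp (-p * t))) (Ioi 0) := by
    intro t _
    by_cases ht : t ∈ Ioi L
    · rw [indicator_of_mem ht]
      have : 0 < t - L := sub_pos.2 ht
      simp only [max_eq_left this.le]; push_cast; rfl
    · rw [indicator_of_notMem ht]
      have : t - L ≤ 0 := sub_nonpos.2 (not_lt.1 ht)
      simp [max_eq_right this]
  constructor
  · refine IntegrableOn.congr_fun ?_ e.symm measurableSet_Ioi
    exact ((integrable_indicator_iff measurableSet_Ioi).2 hintegrable).integrableOn
  · rw [setIntegral_congr_fun measurableSet_Ioi e, setIntegral_indicator measurableSet_Ioi,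
      inter_eq_right.2 hsub, hval, hFL]
    ring

lemma tsum {ι : Type*} [Countable ι] {F : ι → ℝ → ℂ} {v : ι → ℂ} (hF : ∀ n, HasLaplace (F n) p (v n))
    (hsum : Summable fun n => ∫ t in Ioi (0 : ℝ), ‖F n t * Complex.exp (-p * t)‖) :
    HasLaplace (fun t => ∑' n, F n t) p (∑' n, v n) := by
  have e : (fun t : ℝ => (∑' n, F n t) * Complex.exp (-p * t))
      = fun t => ∑' n, F n t * Complex.exp (-p * t) := by
    ext t; rw [tsum_mul_right]
  have hv : (fun n => ∫ t in Ioi (0 : ℝ), F n t * Complex.exp (-p * t)) = v :=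
    funext fun n => (hF n).2
  have key := hasSum_integral_of_summable_integral_norm (fun n => (hF n).1) hsum
  rw [hv] at key
  refine ⟨?_, by rw [e, key.tsum_eq]⟩
  rw [e]
  have hae : ∀ n, AEStronglyMeasurable (fun t : ℝ => F n t * Complex.exp (-p * t))
      (volume.restrict (Ioi 0)) := fun n => (hF n).1.aestronglyMeasurable
  have hfin : ∑' n, ∫⁻ t in Ioi (0 : ℝ), ‖F n t * Complex.exp (-p * t)‖ₑ < ⊤ := by
    have : ∀ n, ∫⁻ t in Ioi (0 : ℝ), ‖F n t * Complex.exp (-p * t)‖ₑ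
        = ENNReal.ofReal (∫ t in Ioi (0 : ℝ), ‖F n t * Complex.exp (-p * t)‖) := fun n => by
      rw [ofReal_integral_norm_eq_lintegral_enorm (hF n).1]
    simp_rw [this]
    exact hsum.tsum_ofReal_lt_top
  rw [← lintegral_tsum fun n => (hae n).enorm] at hfin
  have hsummable : ∀ᵐ t ∂(volume.restrict (Ioi (0 : ℝ))),
      Summable fun n => F n t * Complex.exp (-p * t) := by
    have := ae_lt_top' (AEMeasurable.tsum fun n => (hae n).enorm) hfin.ne
    filter_upwards [this] with t ht
    exact (ENNReal.summable_toReal ht.ne).of_norm_bounded (fun n => by simp [enorm])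
  refine ⟨?_, ?_⟩
  · refine aestronglyMeasurable_of_tendsto_ae atTop
      (f := fun (N : Finset ι) t => ∑ n ∈ N, F n t * Complex.exp (-p * t)) (fun N => ?_) ?_
    · exact Finset.aestronglyMeasurable_fun_sum _ fun n _ => hae n
    · filter_upwards [hsummable] with t ht
      exact ht.hasSum
  · refine lt_of_le_of_lt (lintegral_mono fun t => ?_) hfin
    exact enorm_tsum_le_tsum_enorm
end HasLaplace

end

section

/-! ### Decomposition and Laplace transform of the screw function -/

open Topology

namespace Screw

/-- The archimedean terms of the screw function. -/
def gammaTerm (n : ℕ) (t : ℝ) : ℝ := (1 - Real.exp (-(2 * n + 1 / 2) * t)) / ((n : ℝ) + 1 / 4) ^ 2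

/-- The prime power terms of the screw function. -/
def primeTerm (n : ℕ) (t : ℝ) : ℝ := vM n / Real.sqrt n * max (t - Real.log n) 0

/-- The elementary part of the screw function. -/
def elemTerm (t : ℝ) : ℝ :=
  -4 * (Real.exp (t / 2) + Real.exp (-t / 2) - 2) - t / 2 * (digammaR (1 / 4) - Real.log π)

lemma norm_gammaTerm_le (n : ℕ) {t : ℝ} (ht : 0 ≤ t) :
    ‖gammaTerm n t‖ ≤ 1 / ((n : ℝ) + 1 / 4) ^ 2 := by
  rw [gammaTerm, norm_div, Real.norm_of_nonneg (by positivity : 0 ≤ ((n : ℝ) + 1 / 4) ^ 2)]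
  gcongr
  have h1 : Real.exp (-(2 * n + 1 / 2) * t) ≤ 1 := by
    rw [Real.exp_le_one_iff, neg_mul]
    have : 0 ≤ (2 * n + 1 / 2) * t := by positivity
    linarith
  rw [Real.norm_of_nonneg (by linarith)]
  have := Real.exp_pos (-(2 * n + 1 / 2) * t)
  linarith

lemma summable_quarter : Summable fun n : ℕ => 1 / ((n : ℝ) + 1 / 4) ^ 2 :=
  DigammaSeries.summable_bound (by norm_num) 1

lemma summable_gammaTerm {t : ℝ} (ht : 0 ≤ t) : Summable fun n => gammaTerm n t :=
  Summable.of_norm_bounded summable_quarter fun n => norm_gammaTerm_le n ht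

lemma primeTerm_eq_zero {n : ℕ} {t : ℝ} (h : ⌊Real.exp t⌋₊ < n) : primeTerm n t = 0 := by
  have h1 : Real.exp t < n := (Nat.floor_lt (Real.exp_pos t).le).1 h
  have h2 : t ≤ Real.log n :=
    (Real.le_log_iff_exp_le (lt_of_le_of_lt (Real.exp_pos t).le h1)).2 h1.le
  rw [primeTerm, max_eq_right (by linarith), mul_zero]

lemma primeTerm_zero (t : ℝ) : primeTerm 0 t = 0 := by
  simp [primeTerm, vM]

lemma primeTerm_nonneg (n : ℕ) (t : ℝ) : 0 ≤ primeTerm n t := by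
  have : 0 ≤ vM n := ArithmeticFunction.vonMangoldt_nonneg
  rw [primeTerm]; positivity

lemma tsum_primeTerm {N : ℕ} {t : ℝ} (h : ⌊Real.exp t⌋₊ ≤ N) :
    ∑' n, primeTerm n t = ∑ n ∈ Finset.Icc 1 N, primeTerm n t := by
  refine tsum_eq_sum fun n hn => ?_
  rcases Nat.eq_zero_or_pos n with rfl | h0
  · exact primeTerm_zero t
  · refine primeTerm_eq_zero ?_
    by_contra hc
    exact hn (Finset.mem_Icc.2 ⟨h0, by omega⟩)

lemma g_eq {t : ℝ} (ht : 0 ≤ t) :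
    g t = elemTerm t - 1 / 4 * (∑' n, gammaTerm n t) + ∑' n, primeTerm n t := by
  rw [g, abs_of_nonneg ht, tsum_primeTerm le_rfl, elemTerm, PhiR, PhiR, ← tsum_mul_left]
  have hr : ∀ n : ℕ, ((n : ℝ) + 1 / 4) ^ (2 : ℝ) = ((n : ℝ) + 1 / 4) ^ 2 := fun n => by
    exact_mod_cast Real.rpow_natCast _ 2
  have e2 : ∀ n : ℕ, Real.exp (-t / 2) * (Real.exp (-2 * t) ^ n / ((n : ℝ) + 1 / 4) ^ (2 : ℝ))
      = Real.exp (-(2 * n + 1 / 2) * t) / ((n : ℝ) + 1 / 4) ^ 2 := fun n => by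
    rw [hr, ← Real.exp_nat_mul, ← mul_div_assoc, ← Real.exp_add]
    congr 2; ring
  have e1 : ∀ n : ℕ, (1 : ℝ) ^ n / ((n : ℝ) + 1 / 4) ^ (2 : ℝ) = 1 / ((n : ℝ) + 1 / 4) ^ 2 :=
    fun n => by rw [hr, one_pow]
  simp_rw [e1, e2]
  have hs : Summable fun n : ℕ => Real.exp (-(2 * n + 1 / 2) * t) / ((n : ℝ) + 1 / 4) ^ 2 := by
    refine (summable_quarter.sub (summable_gammaTerm ht)).congr fun n => ?_
    rw [gammaTerm]; ring
  rw [← summable_quarter.tsum_sub hs]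
  have e3 : ∀ n : ℕ, 1 / ((n : ℝ) + 1 / 4) ^ 2
      - Real.exp (-(2 * n + 1 / 2) * t) / ((n : ℝ) + 1 / 4) ^ 2 = gammaTerm n t := fun n => by
    rw [gammaTerm]; ring
  simp_rw [e3]
  congr 1
  refine Finset.sum_congr rfl fun n hn => ?_
  obtain ⟨h1, h2⟩ := Finset.mem_Icc.1 hn
  have h3 : (n : ℝ) ≤ Real.exp t := (Nat.le_floor_iff (Real.exp_pos t).le).1 h2
  have h4 : Real.log n ≤ t := (Real.log_le_iff_le_exp (by exact_mod_cast h1)).2 h3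
  rw [primeTerm, max_eq_left (by linarith)]

lemma g_zero : g 0 = 0 := by
  rw [g_eq le_rfl, tsum_primeTerm (N := 1) (by simp)]
  simp [elemTerm, gammaTerm, primeTerm]
  norm_num

lemma g_abs (t : ℝ) : g |t| = g t := by simp [g]

lemma continuousOn_g : ContinuousOn g (Ici 0) := by
  have h1 : ContinuousOn (fun t => ∑' n, gammaTerm n t) (Ici 0) := by
    refine continuousOn_tsum (fun n => ?_) summable_quarter fun n t ht => norm_gammaTerm_le n ht
    unfold gammaTerm; fun_prop
  have h2 : Continuous fun t => ∑' n, primeTerm n t := by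
    rw [continuous_iff_continuousAt]
    intro t
    have : (fun u => ∑' n, primeTerm n u) =ᶠ[𝓝 t]
        fun u => ∑ n ∈ Finset.Icc 1 ⌊Real.exp (t + 1)⌋₊, primeTerm n u := by
      filter_upwards [Iio_mem_nhds (by linarith : t < t + 1)] with u hu
      exact tsum_primeTerm (Nat.floor_mono (Real.exp_le_exp.2 (le_of_lt hu)))
    refine ContinuousAt.congr ?_ this.symm
    refine Continuous.continuousAt ?_
    unfold primeTerm; fun_prop
  have h3 : Continuous elemTerm := by unfold elemTerm; fun_prop
  exact ((h3.continuousOn.sub (continuousOn_const.mul h1)).add h2.continuousOn).congr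
    fun t ht => g_eq ht

lemma continuous_g : Continuous g := by
  have : g = fun t => g |t| := funext fun t => (g_abs t).symm
  rw [this]
  exact continuousOn_g.comp_continuous continuous_abs fun t => abs_nonneg t

lemma hasLaplace_gammaTerm {p : ℂ} (hp : 0 < p.re) (n : ℕ) :
    HasLaplace (fun t => (gammaTerm n t : ℂ)) p
      (2 / p ^ 2 * (1 / ((n : ℂ) + (1 / 4 : ℝ)) - 1 / ((n : ℂ) + (1 / 4 + p / 2)))) := by
  have hn : (0 : ℝ) ≤ n := by positivity
  have hp0 : p ≠ 0 := by rintro rfl; simp at hp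
  have ha : ((n : ℂ) + 1 / 4) ≠ 0 := by
    intro h; have := congrArg Complex.re h; norm_num at this; linarith
  have hb : ((n : ℂ) + 1 / 4) * 2 + p ≠ 0 := by
    intro h; have := congrArg Complex.re h; norm_num at this; linarith
  refine (((HasLaplace.one hp).sub (HasLaplace.exp (a := -(2 * n + 1 / 2)) ?_)).const_mul
    (1 / ((n : ℂ) + 1 / 4) ^ 2)).congr (fun t _ => ?_) ?_
  · norm_num; linarith
  · rw [gammaTerm]; push_cast; ring
  · have e1 : (n : ℂ) + (1 / 4 + p / 2) = (((n : ℂ) + 1 / 4) * 2 + p) / 2 := by ring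
    have e2 : p - -(2 * (n : ℂ) + 1 / 2) = ((n : ℂ) + 1 / 4) * 2 + p := by ring
    push_cast
    rw [e1, e2]
    generalize (n : ℂ) + 1 / 4 = a at *
    have hb' : 2 * a + p ≠ 0 := by rwa [mul_comm]
    rw [mul_comm a 2]
    field_simp
    ring

lemma hasLaplace_tsum_gammaTerm {p : ℂ} (hp : 0 < p.re) :
    HasLaplace (fun t => ((∑' n, gammaTerm n t : ℝ) : ℂ)) p
      (2 / p ^ 2 * (_root_.digamma (1 / 4 + p / 2) - _root_.digamma (1 / 4))) := by
  have h1 := DigammaSeries.hasSum_digamma_sub (a := 1 / 4) (s := 1 / 4 + p / 2) (by norm_num)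
    (by norm_num; linarith)
  have h2 := (h1.mul_left (2 / p ^ 2)).tsum_eq
  refine (HasLaplace.tsum (fun n => hasLaplace_gammaTerm hp n) ?_).congr (fun t _ => ?_) ?_
  · have hone := (HasLaplace.one hp).1.norm
    refine Summable.of_nonneg_of_le (fun n => by positivity) (fun n => ?_)
      (summable_quarter.mul_right (∫ t in Ioi (0 : ℝ), ‖1 * Complex.exp (-p * t)‖))
    rw [← integral_const_mul]
    refine setIntegral_mono_on (hasLaplace_gammaTerm hp n).1.norm (hone.const_mul _)
      measurableSet_Ioi fun t ht => ?_
    rw [norm_mul, one_mul, Complex.norm_real]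
    gcongr
    exact norm_gammaTerm_le n (le_of_lt ht)
  · exact Complex.ofReal_tsum _
  · rw [h2]; push_cast; rfl

lemma term_vonMangoldt {n : ℕ} (hn : n ≠ 0) (p : ℂ) :
    ((vM n / Real.sqrt n : ℝ) : ℂ) * (Complex.exp (-p * Real.log n)) =
      LSeries.term (fun n => (ArithmeticFunction.vonMangoldt n : ℂ)) (1 / 2 + p) n := by
  have hn' : (0 : ℝ) < n := by positivity
  have hnc : (n : ℂ) ≠ 0 := by exact_mod_cast hn
  rw [LSeries.term_of_ne_zero hn, Complex.cpow_add _ _ hnc, vM]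
  have h1 : (n : ℂ) ^ (1 / 2 : ℂ) = (Real.sqrt n : ℂ) := by
    rw [Real.sqrt_eq_rpow, Complex.ofReal_cpow hn'.le]; push_cast; rfl
  have h2 : (n : ℂ) ^ p = Complex.exp (p * Real.log n) := by
    rw [Complex.cpow_def_of_ne_zero hnc, ← Complex.natCast_log, mul_comm]
  have h3 : (Real.sqrt n : ℂ) ≠ 0 := by
    exact_mod_cast (Real.sqrt_pos.2 hn').ne'
  rw [h1, h2, neg_mul, Complex.exp_neg]
  push_cast
  field_simp

lemma hasLaplace_primeTerm {p : ℂ} (hp : 0 < p.re) (n : ℕ) :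
    HasLaplace (fun t => (primeTerm n t : ℂ)) p
      (1 / p ^ 2 * LSeries.term (fun n => (ArithmeticFunction.vonMangoldt n : ℂ)) (1 / 2 + p) n) := by
  rcases Nat.eq_zero_or_pos n with rfl | h0
  · refine ((HasLaplace.one hp).const_mul 0).congr (fun t _ => ?_) (by simp)
    simp [primeTerm_zero]
  · have hL : 0 ≤ Real.log n := Real.log_nonneg (by exact_mod_cast h0)
    refine ((HasLaplace.ramp hp hL).const_mul ((vM n / Real.sqrt n : ℝ) : ℂ)).congr
      (fun t _ => ?_) ?_
    · rw [primeTerm, ofReal_mul]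
    · rw [← term_vonMangoldt h0.ne']; ring

lemma hasLaplace_tsum_primeTerm {p : ℂ} (hp : 1 / 2 < p.re) :
    HasLaplace (fun t => ((∑' n, primeTerm n t : ℝ) : ℂ)) p
      (1 / p ^ 2 * (-deriv riemannZeta (1 / 2 + p) / riemannZeta (1 / 2 + p))) := by
  have hp0 : 0 < p.re := by linarith
  have hs : 1 < (1 / 2 + p).re := by norm_num; linarith
  have h1 := ArithmeticFunction.LSeries_vonMangoldt_eq_deriv_riemannZeta_div hs
  refine (HasLaplace.tsum (fun n => hasLaplace_primeTerm hp0 n) ?_).congr (fun t _ => ?_) ?_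
  · -- the integral of the norm is the Laplace transform at the real part
    have hreal : 1 < (1 / 2 + (p.re : ℂ)).re := by norm_num; linarith
    have hsum := ((ArithmeticFunction.LSeriesSummable_vonMangoldt hreal).norm).mul_left
      (‖1 / (p.re : ℂ) ^ 2‖)
    refine hsum.congr fun n => ?_
    have h2 := (hasLaplace_primeTerm (p := (p.re : ℂ)) (by simpa using hp0) n).2
    rw [← norm_mul, ← h2]
    have e : ∀ t : ℝ, (primeTerm n t : ℂ) * Complex.exp (-(p.re : ℂ) * t)
        = ((‖(primeTerm n t : ℂ) * Complex.exp (-p * t)‖ : ℝ) : ℂ) := fun t => by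
      rw [norm_mul, Complex.norm_real, Real.norm_of_nonneg (primeTerm_nonneg n t),
        Complex.norm_exp]
      have : (-p * (t : ℂ)).re = -p.re * t := by simp
      rw [this]; push_cast; rfl
    simp_rw [e]
    rw [integral_complex_ofReal, Complex.norm_real, Real.norm_of_nonneg (by positivity)]
  · exact Complex.ofReal_tsum _
  · rw [← h1, LSeries, tsum_mul_left]

lemma hasLaplace_elemTerm {p : ℂ} (hp : 1 / 2 < p.re) :
    HasLaplace (fun t => (elemTerm t : ℂ)) p
      (-4 * (1 / (p - 1 / 2) + 1 / (p + 1 / 2) - 2 / p)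
        - 1 / (2 * p ^ 2) * (_root_.digamma (1 / 4) - Real.log π)) := by
  have hp0 : 0 < p.re := by linarith
  have h1 := HasLaplace.exp (p := p) (a := 1 / 2) (by norm_num; linarith)
  have h2 := HasLaplace.exp (p := p) (a := -(1 / 2)) (by norm_num; linarith)
  have h3 := (HasLaplace.one hp0).const_mul 2
  have h4 := HasLaplace.ramp hp0 (le_refl 0)
  have hd := DigammaSeries.digamma_ofReal (x := 1 / 4) (by norm_num)
  push_cast at hd
  refine ((((h1.add h2).sub h3).const_mul (-4)).sub
    (h4.const_mul ((1 / 2) * (_root_.digamma (1 / 4) - Real.log π)))).congr (fun t ht => ?_) ?_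
  · rw [elemTerm, sub_zero, max_eq_left ht.le, hd]
    push_cast
    rw [show (t : ℂ) / 2 = 1 / 2 * t by ring, show -(t : ℂ) / 2 = -(1 / 2) * t by ring]
    ring
  · simp only [ofReal_zero, mul_zero, Complex.exp_zero, sub_neg_eq_add]
    ring

theorem hasLaplace_g {p : ℂ} (hp : 1 / 2 < p.re) :
    HasLaplace (fun t => (g t : ℂ)) p (-(1 / p ^ 2) * (deriv xiEntire p / xiEntire p)) ∧
      xiEntire p ≠ 0 := by
  have hp0 : 0 < p.re := by linarith
  have hpne : p ≠ 0 := by rintro rfl; simp at hp0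
  have hs : 1 < (1 / 2 + p).re := by norm_num; linarith
  have hs0 : 0 < (1 / 2 + p).re := by linarith
  have hs1 : (1 / 2 + p) ≠ 1 := by intro h; rw [h] at hs; simp at hs
  have hz := riemannZeta_ne_zero_of_one_le_re hs.le
  have e1 : p + 1 / 2 ≠ 0 := by
    intro h; have := congrArg Complex.re h; norm_num at this; linarith
  have e2 : p - 1 / 2 ≠ 0 := by
    intro h; have := congrArg Complex.re h; norm_num at this; linarith
  have hx : xiEntire p ≠ 0 := by
    have h1 := xiEntire_eq_Zfun hs0 hs1
    rw [add_sub_cancel_left] at h1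
    rw [h1, Zfun, ← Gammaℝ_def]
    have hG := Gammaℝ_ne_zero_of_re_pos hs0
    refine mul_ne_zero (div_ne_zero (mul_ne_zero ?_ ?_) two_ne_zero) (mul_ne_zero hG hz)
    · rwa [add_comm]
    · intro h; apply e2; linear_combination h
  refine ⟨?_, hx⟩
  have hl := logDeriv_xiEntire_eq_Zfun hs0 hs1 (by rwa [add_sub_cancel_left])
  rw [add_sub_cancel_left, logDeriv_Zfun hs0 hs1 hz] at hl
  refine (((hasLaplace_elemTerm hp).sub ((hasLaplace_tsum_gammaTerm hp0).const_mul (1 / 4))).add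
    (hasLaplace_tsum_primeTerm hp)).congr (fun t ht => ?_) ?_
  · rw [g_eq ht.le]; push_cast; ring
  · have e3 : (1 / 2 + p) / 2 = 1 / 4 + p / 2 := by ring
    have e4 : 1 / (1 / 2 + p) + 1 / (1 / 2 + p - 1) = 1 / (p + 1 / 2) + 1 / (p - 1 / 2) := by
      congr 2 <;> ring
    have e5 : -4 * (1 / (p - 1 / 2) + 1 / (p + 1 / 2) - 2 / p)
        = -(1 / p ^ 2) * (1 / (p + 1 / 2) + 1 / (p - 1 / 2)) := by
      have e1' : p * 2 + 1 ≠ 0 := fun h => e1 (by linear_combination h / 2)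
      have e2' : p * 2 - 1 ≠ 0 := fun h => e2 (by linear_combination h / 2)
      field_simp
      ring
    rw [hl, e3, e4, e5]
    ring

end Screw

end

section

/-! ### Landau's lemma -/

open Topology ProbabilityTheory

namespace Landau

variable {Ω : Type*} [MeasurableSpace Ω] {μ : Measure Ω} {X : Ω → ℝ}

lemma mem_integrableExpSet_of_le (hXm : AEMeasurable X μ) (hX : ∀ᵐ ω ∂μ, X ω ≤ 0) {x y : ℝ}
    (hx : x ∈ integrableExpSet X μ) (hxy : x ≤ y) : y ∈ integrableExpSet X μ := by
  refine Integrable.mono' hx (by fun_prop) ?_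
  filter_upwards [hX] with ω hω
  rw [Real.norm_of_nonneg (Real.exp_pos _).le]
  exact Real.exp_le_exp.2 (mul_le_mul_of_nonpos_right hxy hω)

/-- If the Laplace transform of a positive measure on a half-line converges for `Re p > σ` and
continues analytically to a neighbourhood of `σ`, then it converges to the left of `σ`. -/
theorem exists_mem_integrableExpSet_lt (hXm : AEMeasurable X μ) (hX : ∀ᵐ ω ∂μ, X ω ≤ 0) {σ : ℝ}
    (hσ : Ioi σ ⊆ integrableExpSet X μ) {H : ℂ → ℂ} (hH : AnalyticAt ℂ H σ)
    (hHK : ∀ᶠ p in 𝓝 (σ : ℂ), σ < p.re → H p = complexMGF X μ p) :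
    ∃ x < σ, x ∈ integrableExpSet X μ := by
  obtain ⟨r, hr, hball⟩ := Metric.eventually_nhds_iff_ball.1
    (hH.eventually_analyticAt.and hHK)
  set c : ℝ := σ + r / 4 with hc
  set y : ℝ := 3 * r / 8 with hy
  have hcσ : dist (c : ℂ) σ = r / 4 := by
    rw [Complex.dist_eq, ← ofReal_sub, Complex.norm_real, Real.norm_eq_abs, hc,
      add_sub_cancel_left, abs_of_pos (by positivity)]
  have hsub : Metric.ball (c : ℂ) (r / 2) ⊆ Metric.ball (σ : ℂ) r := by
    refine Metric.ball_subset_ball' ?_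
    rw [hcσ]; linarith
  have hdiff : DifferentiableOn ℂ H (Metric.ball (c : ℂ) (r / 2)) := fun z hz =>
    (hball z (hsub hz)).1.differentiableAt.differentiableWithinAt
  have hcint : ((c : ℂ)).re ∈ interior (integrableExpSet X μ) := by
    refine interior_mono hσ ?_
    rw [interior_Ioi, mem_Ioi, ofReal_re]; linarith
  have hz : ((c : ℂ) - y) ∈ Metric.ball (c : ℂ) (r / 2) := by
    rw [Metric.mem_ball, Complex.dist_eq, sub_sub_cancel_left, norm_neg, Complex.norm_real,
      Real.norm_eq_abs, abs_of_pos (by positivity)]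
    linarith
  have hT := Complex.hasSum_taylorSeries_on_ball hdiff hz
  have hcongr : H =ᶠ[𝓝 (c : ℂ)] complexMGF X μ := by
    filter_upwards [Metric.ball_mem_nhds (c : ℂ) (by positivity : 0 < r / 2),
      (isOpen_lt continuous_const Complex.continuous_re).mem_nhds
        (show σ < ((c : ℂ)).re by rw [ofReal_re]; linarith)] with z hz1 hz2
    exact (hball z (hsub hz1)).2 hz2
  set F : ℕ → Ω → ℝ := fun n ω => (y * -X ω) ^ n / n.factorial * Real.exp (c * X ω) with hF
  have hterm : ∀ n : ℕ, ((n.factorial : ℂ))⁻¹ • ((c : ℂ) - y - c) ^ n • iteratedDeriv n H c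
      = ((∫ ω, F n ω ∂μ : ℝ) : ℂ) := by
    intro n
    rw [hcongr.iteratedDeriv_eq, iteratedDeriv_complexMGF hcint, ← integral_complex_ofReal,
      smul_eq_mul, smul_eq_mul, ← integral_const_mul, ← integral_const_mul]
    congr 1
    ext ω
    simp only [hF]
    push_cast
    rw [show (c : ℂ) - y - c = -y by ring, show ((y : ℂ) * -(X ω : ℂ)) ^ n
      = (-(y : ℂ)) ^ n * (X ω : ℂ) ^ n by rw [← mul_pow]; ring_nf]
    ring
  have hsum : Summable fun n => ∫ ω, F n ω ∂μ := by
    have := hT.summable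
    simp_rw [hterm] at this
    exact Complex.summable_ofReal.1 this
  have hFint : ∀ n, Integrable (F n) μ := by
    intro n
    have := (integrable_pow_mul_exp_of_mem_interior_integrableExpSet hcint n).const_mul
      ((-y) ^ n / n.factorial)
    refine this.congr (ae_of_all _ fun ω => ?_)
    simp only [hF, ofReal_re]
    rw [show y * -X ω = -y * X ω by ring, mul_pow]
    ring
  have hFnn : ∀ n, 0 ≤ᵐ[μ] F n := by
    intro n
    filter_upwards [hX] with ω hω
    simp only [hF, Pi.zero_apply]
    have : 0 ≤ y * -X ω := mul_nonneg (by positivity) (by linarith)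
    positivity
  have hFm : ∀ n, AEMeasurable (fun ω => ENNReal.ofReal (F n ω)) μ := fun n =>
    (hFint n).aemeasurable.ennreal_ofReal
  refine ⟨c - y, by rw [hc, hy]; linarith, ?_⟩
  refine ⟨by fun_prop, ?_⟩
  have hle : ∫⁻ ω, ‖Real.exp ((c - y) * X ω)‖ₑ ∂μ ≤ ∫⁻ ω, ∑' n, ENNReal.ofReal (F n ω) ∂μ := by
    refine lintegral_mono_ae ?_
    filter_upwards [hX] with ω hω
    have h0 : 0 ≤ y * -X ω := mul_nonneg (by positivity) (by linarith)
    have h1 := (Real.exp_eq_exp_ℝ ▸ NormedSpace.expSeries_div_hasSum_exp (y * -X ω) :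
        HasSum (fun n : ℕ => (y * -X ω) ^ n / n.factorial) (Real.exp (y * -X ω))).mul_right (Real.exp (c * X ω))
    rw [← ENNReal.ofReal_tsum_of_nonneg (fun n => by positivity) h1.summable,
      h1.tsum_eq, ← Real.exp_add, Real.enorm_eq_ofReal (Real.exp_pos _).le]
    apply le_of_eq; congr 2; ring
  refine lt_of_le_of_lt hle ?_
  rw [lintegral_tsum hFm]
  have : ∀ n, ∫⁻ ω, ENNReal.ofReal (F n ω) ∂μ = ENNReal.ofReal (∫ ω, F n ω ∂μ) := fun n =>
    (ofReal_integral_eq_lintegral_ofReal (hFint n) (hFnn n)).symm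
  simp_rw [this]
  exact hsum.tsum_ofReal_lt_top

end Landau

end

section

open Topology ProbabilityTheory

namespace Landau

/-- An entire function all of whose logarithmic derivatives are finite has no zeros. -/
lemma ne_zero_of_deriv_eq_mul {f A : ℂ → ℂ} (hf : Differentiable ℂ f) {w : ℂ} (hw : f w ≠ 0) {p : ℂ}
    (hA : AnalyticAt ℂ A p) (h : ∀ᶠ z in 𝓝 p, deriv f z = f z * A z) : f p ≠ 0 := by
  intro hp
  have hfa : AnalyticAt ℂ f p := hf.analyticAt p
  have h1 := hfa.analyticOrderAt_deriv_add_one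
  simp only [hp, sub_zero] at h1
  have h2 : analyticOrderAt (deriv f) p = analyticOrderAt f p + analyticOrderAt A p := by
    rw [← analyticOrderAt_mul hfa hA]
    exact analyticOrderAt_congr h
  have h3 := EntireFunction.analyticOrderAt_ne_top_of_differentiable hf hw p
  rw [h2] at h1
  have h4 : analyticOrderAt f p + 1 ≤ analyticOrderAt f p := by
    calc analyticOrderAt f p + 1 ≤ analyticOrderAt f p + analyticOrderAt A p + 1 := by
          gcongr; exact le_self_add
      _ = analyticOrderAt f p := h1
  exact absurd ((ENat.add_one_le_iff h3).1 h4) (lt_irrefl _)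

/-- If the screw function is eventually nonpositive, then `ξ(1/2 + p)` has no zeros in `Re p > 0`. -/
theorem xiEntire_ne_zero_of_g_nonpos {t₀ : ℝ} (hg : ∀ t, t₀ ≤ t → g t ≤ 0) {p : ℂ}
    (hp : 0 < p.re) : xiEntire p ≠ 0 := by
  obtain ⟨C, hC⟩ := (isCompact_Icc (a := (0 : ℝ)) (b := t₀)).exists_bound_of_continuousOn
    Screw.continuous_g.continuousOn
  set M : ℝ := |C| * Real.exp t₀ with hM
  set q : ℝ → ℝ := fun t => -g t + M * Real.exp (-t) with hq
  have hqc : Continuous q := by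
    have := Screw.continuous_g
    fun_prop
  have hqnn : ∀ t, 0 < t → 0 ≤ q t := by
    intro t ht
    have hMt : 0 ≤ M * Real.exp (-t) := by positivity
    rcases le_total t₀ t with h | h
    · have := hg t h
      simp only [hq]; linarith
    · have h1 := (Real.norm_eq_abs _ ▸ hC t ⟨ht.le, h⟩ : |g t| ≤ C)
      have h2 : |C| ≤ M * Real.exp (-t) := by
        rw [hM, mul_assoc, ← Real.exp_add]
        refine le_mul_of_one_le_right (abs_nonneg _) (Real.one_le_exp (by linarith))
      have h3 := le_abs_self C
      have h4 := le_abs_self (g t)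
      simp only [hq]; linarith
  have hLap : ∀ p : ℂ, 1 / 2 < p.re → HasLaplace (fun t => (q t : ℂ)) p
      (1 / p ^ 2 * (deriv xiEntire p / xiEntire p) + M / (p + 1)) := by
    intro p hp
    refine (((Screw.hasLaplace_g hp).1.const_mul (-1)).add
      ((HasLaplace.exp (a := -1) (by norm_num; linarith)).const_mul (M : ℂ))).congr
      (fun t _ => ?_) ?_
    · simp only [hq]; push_cast; rw [neg_one_mul, neg_one_mul]
    · rw [sub_neg_eq_add]; ring
  set d : ℝ → ENNReal := fun t => ENNReal.ofReal (q t) with hd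
  have hdm : Measurable d := hqc.measurable.ennreal_ofReal
  set μ : Measure ℝ := (volume.restrict (Ioi 0)).withDensity d with hμ
  have hdtop : ∀ᵐ t ∂(volume.restrict (Ioi (0 : ℝ))), d t < ⊤ := ae_of_all _ fun t =>
    ENNReal.ofReal_lt_top
  set X : ℝ → ℝ := fun t => -t with hX
  have hXm : AEMeasurable X μ := by fun_prop
  have hXneg : ∀ᵐ t ∂μ, X t ≤ 0 := by
    refine (withDensity_absolutelyContinuous _ _).ae_le ?_
    filter_upwards [ae_restrict_mem measurableSet_Ioi] with t ht
    simp only [hX]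
    have : 0 < t := ht
    linarith
  have hsmul : ∀ (p : ℂ) (t : ℝ), 0 < t → (d t).toReal • Complex.exp (p * (X t : ℂ))
      = (q t : ℂ) * Complex.exp (-p * t) := by
    intro p t ht
    simp only [hd, hX]
    rw [ENNReal.toReal_ofReal (hqnn t ht), Complex.real_smul]
    push_cast; congr 2; ring
  have hK : ∀ p : ℂ, 1 / 2 < p.re → complexMGF X μ p =
      1 / p ^ 2 * (deriv xiEntire p / xiEntire p) + M / (p + 1) := by
    intro p hp
    rw [complexMGF, integral_withDensity_eq_integral_toReal_smul hdm hdtop, ← (hLap p hp).2]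
    exact setIntegral_congr_fun measurableSet_Ioi fun t ht => hsmul p t ht
  have hS0 : Ioi (1 / 2 : ℝ) ⊆ integrableExpSet X μ := by
    intro x hx
    have h1 : Integrable (fun t => Complex.exp ((x : ℂ) * (X t : ℂ))) μ := by
      rw [integrable_withDensity_iff_integrable_smul' hdm hdtop]
      exact (hLap x (by simpa using hx)).1.congr_fun (fun t ht => (hsmul x t ht).symm)
        measurableSet_Ioi
    refine h1.norm.congr (ae_of_all _ fun t => ?_)
    simp [Complex.norm_exp]
  have hident : ∀ σ : ℝ, 0 ≤ σ → Ioi σ ⊆ integrableExpSet X μ → ∀ p : ℂ, σ < p.re →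
      complexMGF X μ p * (p ^ 2 * (p + 1) * xiEntire p)
        = deriv xiEntire p * (p + 1) + M * p ^ 2 * xiEntire p := by
    intro σ hσ hS
    set U : Set ℂ := {p | σ < p.re} with hU
    have hUo : IsOpen U := isOpen_lt continuous_const Complex.continuous_re
    have hUc : IsPreconnected U := (convex_halfSpace_re_gt σ).isPreconnected
    have hdx := differentiable_xiEntire
    have hdd : Differentiable ℂ (deriv xiEntire) := hdx.deriv
    have hKd : DifferentiableOn ℂ (complexMGF X μ) U := by
      refine differentiableOn_complexMGF.mono fun z hz => ?_
      exact interior_mono hS (by rw [interior_Ioi]; exact hz)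
    have h1 : DifferentiableOn ℂ
        (fun p => complexMGF X μ p * (p ^ 2 * (p + 1) * xiEntire p)) U :=
      hKd.mul (by fun_prop)
    have h2 : DifferentiableOn ℂ
        (fun p => deriv xiEntire p * (p + 1) + M * p ^ 2 * xiEntire p) U := by
      fun_prop
    have hz0 : ((σ + 1 : ℝ) : ℂ) ∈ U := by
      simp only [hU, mem_ofPred_eq, ofReal_re]; linarith
    refine (h1.analyticOnNhd hUo).eqOn_of_preconnected_of_eventuallyEq (h2.analyticOnNhd hUo)
      hUc hz0 ?_
    filter_upwards [(isOpen_lt continuous_const Complex.continuous_re).mem_nhds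
      (show (1 / 2 : ℝ) < ((σ + 1 : ℝ) : ℂ).re by rw [ofReal_re]; linarith)] with z hz
    have hz' : (1 / 2 : ℝ) < z.re := hz
    have hx := (Screw.hasLaplace_g hz').2
    have hz1 : z ≠ 0 := by rintro rfl; norm_num at hz'
    have hz2 : z + 1 ≠ 0 := by
      intro h; have := congrArg Complex.re h; norm_num at this; linarith
    rw [hK z hz']
    field_simp
  have hS : Ioi (0 : ℝ) ⊆ integrableExpSet X μ := by
    intro x₁ hx₁
    by_contra hx
    have hlb : x₁ ∈ lowerBounds (integrableExpSet X μ) := fun s hs => by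
      by_contra hlt
      exact hx (mem_integrableExpSet_of_le hXm hXneg hs (not_le.1 hlt).le)
    have hne : (integrableExpSet X μ).Nonempty := ⟨1, hS0 (by norm_num)⟩
    set σ := sInf (integrableExpSet X μ) with hσd
    have hσ : 0 < σ := lt_of_lt_of_le hx₁ (le_csInf hne hlb)
    have hσS : Ioi σ ⊆ integrableExpSet X μ := by
      intro y hy
      obtain ⟨s, hs, hsy⟩ := exists_lt_of_csInf_lt hne hy
      exact mem_integrableExpSet_of_le hXm hXneg hs hsy.le
    have hxσ := xiEntire_ne_zero_of_real σ
    have hσ0 : (σ : ℂ) ≠ 0 := by exact_mod_cast hσ.ne'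
    have hσ1 : (σ : ℂ) + 1 ≠ 0 := by
      have : σ + 1 ≠ 0 := by positivity
      exact_mod_cast this
    have hcont : Continuous xiEntire := differentiable_xiEntire.continuous
    have hHa : AnalyticAt ℂ
        (fun p : ℂ => (deriv xiEntire p * (p + 1) + M * p ^ 2 * xiEntire p) /
          (p ^ 2 * (p + 1) * xiEntire p)) σ := by
      have a1 : AnalyticAt ℂ xiEntire σ := differentiable_xiEntire.analyticAt _
      have a2 := a1.deriv
      refine AnalyticAt.div (by fun_prop) (by fun_prop) ?_
      exact mul_ne_zero (mul_ne_zero (pow_ne_zero _ hσ0) hσ1) hxσ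
    obtain ⟨x, hxlt, hxS⟩ := exists_mem_integrableExpSet_lt hXm hXneg hσS hHa (by
      have hev : ∀ᶠ p : ℂ in 𝓝 (σ : ℂ), p ^ 2 * (p + 1) * xiEntire p ≠ 0 := by
        refine ContinuousAt.eventually_ne (Continuous.continuousAt (by fun_prop)) ?_
        exact mul_ne_zero (mul_ne_zero (pow_ne_zero _ hσ0) hσ1) hxσ
      filter_upwards [hev] with p hp hpσ
      rw [← hident σ hσ.le hσS p hpσ, mul_div_cancel_right₀ _ hp])
    exact absurd (csInf_le ⟨x₁, hlb⟩ hxS) (not_le.2 hxlt)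
  have hpint : p.re ∈ interior (integrableExpSet X μ) :=
    interior_mono hS (by rw [interior_Ioi]; exact hp)
  have hp1 : p + 1 ≠ 0 := by
    intro h; have := congrArg Complex.re h; norm_num at this; linarith
  refine ne_zero_of_deriv_eq_mul (A := fun p => p ^ 2 * complexMGF X μ p - M * p ^ 2 / (p + 1))
    differentiable_xiEntire xiEntire_zero_ne_zero ?_ ?_
  · have := analyticAt_complexMGF hpint
    exact ((by fun_prop : AnalyticAt ℂ (fun p : ℂ => p ^ 2) p).mul this).sub
      (AnalyticAt.div (by fun_prop) (by fun_prop) hp1)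
  · filter_upwards [(isOpen_lt continuous_const Complex.continuous_re).mem_nhds hp] with z hz
    have hz1 : z + 1 ≠ 0 := by
      intro h
      have := congrArg Complex.re h
      have hz' : 0 < z.re := hz
      norm_num at this; linarith
    have := hident 0 le_rfl hS z hz
    field_simp
    linear_combination -this

end Landau

end

section

/-! ### The explicit formula for the screw function -/

open Topology FourierTransform

lemma eq_zero_of_hasLaplace_zero {φ : ℝ → ℂ} (hc : ContinuousOn φ (Ioi 0))
    (h : ∀ y : ℝ, HasLaplace φ (1 + y * I) 0) {t : ℝ} (ht : 0 < t) : φ t = 0 := by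
  set F : ℝ → ℂ := (Ioi (0 : ℝ)).indicator fun t => φ t * Complex.exp (-1 * t) with hF
  have hFi : Integrable F := by
    rw [hF, integrable_indicator_iff measurableSet_Ioi]
    have := (h 0).1
    simpa using this
  have hFF : 𝓕 F = 0 := by
    ext w
    rw [Real.fourier_real_eq_integral_exp_smul, Pi.zero_apply, ← (h (2 * π * w)).2,
      ← integral_indicator measurableSet_Ioi]
    congr 1
    ext v
    simp only [hF, indicator]
    split_ifs
    · rw [smul_eq_mul, mul_left_comm, ← Complex.exp_add]
      congr 2; push_cast; ring
    · simp
  have hFc : ContinuousAt F t := by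
    have h1 : ContinuousAt (fun t : ℝ => φ t * Complex.exp (-1 * t)) t :=
      (hc.continuousAt (Ioi_mem_nhds ht)).mul (Continuous.continuousAt (by fun_prop))
    refine h1.congr ?_
    filter_upwards [Ioi_mem_nhds ht] with u hu
    rw [hF, indicator_of_mem hu]
  have key := hFi.fourierInv_fourier_eq (by rw [hFF]; exact integrable_zero _ _ _) hFc
  rw [hFF, Real.fourierInv_eq, hF, indicator_of_mem (mem_Ioi.2 ht)] at key
  simp only [Pi.zero_apply, smul_zero, integral_zero] at key
  exact (mul_eq_zero.1 key.symm).resolve_right (Complex.exp_ne_zero _)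

namespace Screw

/-- The terms of the explicit formula. -/
def zeroTerm (ρ : XiZero) (t : ℝ) : ℂ :=
  -((xiMult ρ : ℂ) / (ρ : ℂ) ^ 2) * (Complex.exp (ρ * t) - 1)

lemma norm_exp_sub_one_le {z : ℂ} (hz : z.re = 0) : ‖Complex.exp z - 1‖ ≤ 2 := by
  refine (norm_sub_le _ _).trans ?_
  rw [Complex.norm_exp, hz, Real.exp_zero, norm_one]; norm_num

lemma norm_zeroTerm_le (hRH : RiemannHypothesis) (ρ : XiZero) (t : ℝ) :
    ‖zeroTerm ρ t‖ ≤ (xiMult ρ : ℝ) / ‖(ρ : ℂ)‖ ^ 2 * 2 := by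
  rw [zeroTerm, norm_mul, norm_neg, norm_div, norm_pow, Complex.norm_natCast]
  gcongr
  apply norm_exp_sub_one_le
  simp [re_eq_zero_of_riemannHypothesis hRH ρ.2]

lemma hasLaplace_zeroTerm (hRH : RiemannHypothesis) (ρ : XiZero) {p : ℂ} (hp : 0 < p.re) :
    HasLaplace (zeroTerm ρ) p
      (-(1 / p ^ 2) * ((xiMult ρ : ℂ) * (1 / (p - ρ) + 1 / ρ))) := by
  have hρ := re_eq_zero_of_riemannHypothesis hRH ρ.2
  have h0 := ρ.ne_zero
  have hp0 : p ≠ 0 := by rintro rfl; simp at hp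
  have hpρ : p - ρ ≠ 0 := by
    intro h; have := congrArg Complex.re h; simp [hρ] at this; linarith
  refine (((HasLaplace.exp (a := (ρ : ℂ)) (by rw [hρ]; exact hp)).sub
    (HasLaplace.one hp)).const_mul (-((xiMult ρ : ℂ) / (ρ : ℂ) ^ 2))).congr (fun t _ => rfl) ?_
  field_simp
  ring

lemma hasLaplace_tsum_zeroTerm (hRH : RiemannHypothesis) {p : ℂ} (hp : 0 < p.re)
    (hx : xiEntire p ≠ 0) :
    HasLaplace (fun t => ∑' ρ, zeroTerm ρ t) p (-(1 / p ^ 2) * (deriv xiEntire p / xiEntire p)) := by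
  have h1 := ((hasSum_logDeriv_xiEntire hx).mul_left (-(1 / p ^ 2))).tsum_eq
  refine (HasLaplace.tsum (fun ρ => hasLaplace_zeroTerm hRH ρ hp) ?_).congr (fun t _ => rfl) h1.symm
  have hone := (HasLaplace.one hp).1.norm
  refine Summable.of_nonneg_of_le (fun n => by positivity) (fun ρ => ?_)
    ((summable_xiMult.mul_right 2).mul_right (∫ t in Ioi (0 : ℝ), ‖1 * Complex.exp (-p * t)‖))
  rw [← integral_const_mul]
  refine setIntegral_mono_on (hasLaplace_zeroTerm hRH ρ hp).1.norm (hone.const_mul _)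
    measurableSet_Ioi fun t ht => ?_
  rw [norm_mul, one_mul]
  gcongr
  exact norm_zeroTerm_le hRH ρ t

lemma summable_zeroTerm (hRH : RiemannHypothesis) (t : ℝ) : Summable fun ρ => zeroTerm ρ t :=
  Summable.of_norm_bounded (summable_xiMult.mul_right 2) fun ρ => norm_zeroTerm_le hRH ρ t

/-- Under the Riemann hypothesis the screw function is a sum over the zeros. -/
theorem hasSum_zeroTerm (hRH : RiemannHypothesis) {t : ℝ} (ht : 0 ≤ t) :
    HasSum (fun ρ => zeroTerm ρ t) (g t : ℂ) := by
  rcases ht.eq_or_lt with rfl | ht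
  · rw [g_zero]
    have : (fun ρ : XiZero => zeroTerm ρ 0) = fun _ => 0 := by ext ρ; simp [zeroTerm]
    rw [this, ofReal_zero]; exact hasSum_zero
  have hcont : Continuous fun t => ∑' ρ, zeroTerm ρ t :=
    continuous_tsum (fun ρ => by unfold zeroTerm; fun_prop) (summable_xiMult.mul_right 2)
      fun ρ t => norm_zeroTerm_le hRH ρ t
  have key := eq_zero_of_hasLaplace_zero (φ := fun t => (g t : ℂ) - ∑' ρ, zeroTerm ρ t)
    (((Complex.continuous_ofReal.comp continuous_g).sub hcont).continuousOn) (fun y => by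
      have hre : (1 / 2 : ℝ) < (1 + (y : ℂ) * I).re := by norm_num
      obtain ⟨h1, h2⟩ := hasLaplace_g hre
      have h3 := hasLaplace_tsum_zeroTerm hRH (by linarith) h2
      exact (h1.sub h3).congr (fun _ _ => rfl) (sub_self _).symm) ht
  rw [sub_eq_zero.1 key]
  exact (summable_zeroTerm hRH t).hasSum

end Screw

end

section

/-! ### The function `𝔓_t` as a transform of the screw function -/

open Topology

/-- The value at `t` of `-φ - w ∫₀ᵗ e^{w(t-u)} φ(u) du` is `v`, for `φ` continuous on `[0,t]`. -/
def HasVolterra (φ : ℝ → ℂ) (w : ℂ) (t : ℝ) (v : ℂ) : Prop :=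
  ContinuousOn φ (Icc 0 t) ∧
    -φ t - w * ∫ u in (0 : ℝ)..t, Complex.exp (w * (t - u)) * φ u = v

namespace HasVolterra

variable {φ ψ : ℝ → ℂ} {w v v' : ℂ} {t : ℝ}

lemma intervalIntegrable (ht : 0 ≤ t) (h : ContinuousOn φ (Icc 0 t)) :
    IntervalIntegrable (fun u : ℝ => Complex.exp (w * (t - u)) * φ u) volume 0 t := by
  refine ContinuousOn.intervalIntegrable ?_
  rw [uIcc_of_le ht]
  exact (by fun_prop : Continuous fun u : ℝ => Complex.exp (w * (t - u))).continuousOn.mul h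

lemma add (ht : 0 ≤ t) (h1 : HasVolterra φ w t v) (h2 : HasVolterra ψ w t v') :
    HasVolterra (fun u => φ u + ψ u) w t (v + v') := by
  refine ⟨h1.1.add h2.1, ?_⟩
  simp only [mul_add]
  rw [intervalIntegral.integral_add (intervalIntegrable ht h1.1) (intervalIntegrable ht h2.1),
    ← h1.2, ← h2.2]
  ring

lemma const_mul (c : ℂ) (h1 : HasVolterra φ w t v) :
    HasVolterra (fun u => c * φ u) w t (c * v) := by
  refine ⟨continuousOn_const.mul h1.1, ?_⟩
  simp only [mul_left_comm _ c]
  rw [intervalIntegral.integral_const_mul, ← h1.2]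
  ring

lemma congr (ht : 0 ≤ t) (h1 : HasVolterra φ w t v) (h : ∀ u ∈ Icc 0 t, ψ u = φ u)
    (hv : v' = v) : HasVolterra ψ w t v' := by
  refine ⟨h1.1.congr h, ?_⟩
  rw [hv, ← h1.2, h t (right_mem_Icc.2 ht)]
  congr 2
  refine intervalIntegral.integral_congr fun u hu => ?_
  rw [uIcc_of_le ht] at hu
  simp only [h u hu]

lemma sub (ht : 0 ≤ t) (h1 : HasVolterra φ w t v) (h2 : HasVolterra ψ w t v') :
    HasVolterra (fun u => φ u - ψ u) w t (v - v') :=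
  (h1.add ht (h2.const_mul (-1))).congr ht (fun u _ => by ring) (by ring)

lemma sum (ht : 0 ≤ t) {ι : Type*} (s : Finset ι) {F : ι → ℝ → ℂ} {v : ι → ℂ}
    (h : ∀ i ∈ s, HasVolterra (F i) w t (v i)) :
    HasVolterra (fun u => ∑ i ∈ s, F i u) w t (∑ i ∈ s, v i) := by
  classical
  induction s using Finset.induction_on with
  | empty => exact ⟨by simpa using continuousOn_const, by simp⟩
  | insert a s ha ih =>
    have := (h a (Finset.mem_insert_self a s)).add ht
      (ih fun i hi => h i (Finset.mem_insert_of_mem hi))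
    simpa [Finset.sum_insert ha] using this

lemma exp {a : ℂ} (ha : a ≠ w) : HasVolterra (fun u : ℝ => Complex.exp (a * u)) w t
    ((w * Complex.exp (w * t) - a * Complex.exp (a * t)) / (a - w)) := by
  refine ⟨(by fun_prop : Continuous fun u : ℝ => Complex.exp (a * u)).continuousOn, ?_⟩
  have haw : a - w ≠ 0 := sub_ne_zero.2 ha
  have e : ∀ u : ℝ, Complex.exp (w * (t - u)) * Complex.exp (a * u)
      = Complex.exp (w * t) * Complex.exp ((a - w) * u) := fun u => by
    rw [← Complex.exp_add, ← Complex.exp_add]; congr 1; ring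
  simp_rw [e]
  rw [intervalIntegral.integral_const_mul, integral_exp_mul_complex haw]
  have e2 : Complex.exp ((a - w) * t) = Complex.exp (a * t) / Complex.exp (w * t) := by
    rw [← Complex.exp_sub]; congr 1; ring
  have := Complex.exp_ne_zero (w * t)
  rw [e2]
  simp only [ofReal_zero, mul_zero, Complex.exp_zero]
  field_simp
  ring

lemma one (hw : w ≠ 0) : HasVolterra (fun _ => 1) w t (-Complex.exp (w * t)) := by
  have h := exp (a := 0) (t := t) hw.symm
  have e : (w * Complex.exp (w * t) - 0 * Complex.exp (0 * t)) / (0 - w)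
      = -Complex.exp (w * t) := by
    rw [zero_mul, sub_zero, zero_sub]; field_simp
  rw [e] at h
  simpa using h

lemma ramp (hw : w ≠ 0) {L : ℝ} (hL : 0 ≤ L) (hLt : L ≤ t) :
    HasVolterra (fun u : ℝ => ((max (u - L) 0 : ℝ) : ℂ)) w t
      (-((Complex.exp (w * (t - L)) - 1) / w)) := by
  refine ⟨(by fun_prop : Continuous fun u : ℝ => ((max (u - L) 0 : ℝ) : ℂ)).continuousOn, ?_⟩
  have hc : Continuous fun u : ℝ => Complex.exp (w * (t - u)) * ((max (u - L) 0 : ℝ) : ℂ) := by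
    fun_prop
  rw [← intervalIntegral.integral_add_adjacent_intervals (hc.intervalIntegrable 0 L)
    (hc.intervalIntegrable L t)]
  have h1 : ∫ u in (0 : ℝ)..L, Complex.exp (w * (t - u)) * ((max (u - L) 0 : ℝ) : ℂ) = 0 := by
    rw [intervalIntegral.integral_congr (g := fun _ => 0)]
    · simp
    · intro u hu
      rw [uIcc_of_le hL] at hu
      simp [max_eq_right (sub_nonpos.2 hu.2)]
  have h2 : ∫ u in L..t, Complex.exp (w * (t - u)) * ((max (u - L) 0 : ℝ) : ℂ)
      = ∫ u in L..t, Complex.exp (w * (t - u)) * ((u : ℂ) - L) := by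
    refine intervalIntegral.integral_congr fun u hu => ?_
    rw [uIcc_of_le hLt] at hu
    simp only [max_eq_left (sub_nonneg.2 hu.1)]
    push_cast; rfl
  have hd : ∀ u ∈ uIcc L t, HasDerivAt
      (fun u : ℝ => -(((u : ℂ) - L) / w + 1 / w ^ 2) * Complex.exp (w * (t - u)))
      (Complex.exp (w * (t - u)) * ((u : ℂ) - L)) u := by
    intro u _
    have h1 : HasDerivAt (fun u : ℂ => -((u - L) / w + 1 / w ^ 2) * Complex.exp (w * (t - u)))
        (-(1 / w) * Complex.exp (w * (t - u)) + -(((u : ℂ) - L) / w + 1 / w ^ 2) *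
          (Complex.exp (w * (t - u)) * (w * (0 - 1)))) (u : ℂ) :=
      ((((((hasDerivAt_id (u : ℂ)).sub_const (L : ℂ)).div_const w).add_const (1 / w ^ 2))).neg).mul
        ((((hasDerivAt_const (u : ℂ) (t : ℂ)).sub (hasDerivAt_id (u : ℂ))).const_mul w).cexp)
    refine h1.comp_ofReal.congr_deriv ?_
    field_simp
    ring
  have hci : IntervalIntegrable (fun u : ℝ => Complex.exp (w * (t - u)) * ((u : ℂ) - L))
      volume L t := Continuous.intervalIntegrable (by fun_prop) _ _
  rw [h1, h2, intervalIntegral.integral_eq_sub_of_hasDerivAt hd hci]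
  beta_reduce
  rw [max_eq_left (sub_nonneg.2 hLt)]
  simp only [sub_self, mul_zero, Complex.exp_zero, zero_div, zero_add]
  push_cast
  field_simp
  ring

lemma hasSum (ht : 0 ≤ t) {ι : Type*} [Countable ι] {F : ι → ℝ → ℂ} {v : ι → ℂ} {B : ι → ℝ}
    (hF : ∀ i, HasVolterra (F i) w t (v i)) (hB : Summable B)
    (hFB : ∀ i, ∀ u ∈ Icc 0 t, ‖F i u‖ ≤ B i)
    (hV : HasVolterra (fun u => ∑' i, F i u) w t v') : HasSum v v' := by
  have hI : HasSum (fun i => ∫ u in (0 : ℝ)..t, Complex.exp (w * (t - u)) * F i u)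
      (∫ u in (0 : ℝ)..t, Complex.exp (w * (t - u)) * ∑' i, F i u) := by
    have hcE : Continuous fun u : ℝ => ‖Complex.exp (w * (t - u))‖ := by fun_prop
    refine intervalIntegral.hasSum_integral_of_dominated_convergence
      (fun i u => ‖Complex.exp (w * (t - u))‖ * B i) (fun i => ?_) (fun i => ?_) ?_ ?_ ?_
    · exact (intervalIntegrable ht (hF i).1).def'.aestronglyMeasurable
    · refine ae_of_all _ fun u hu => ?_
      rw [uIoc_of_le ht] at hu
      rw [norm_mul]
      gcongr
      exact hFB i u ⟨hu.1.le, hu.2⟩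
    · exact ae_of_all _ fun u _ => hB.mul_left _
    · simp_rw [tsum_mul_left]
      exact (hcE.mul continuous_const).intervalIntegrable _ _
    · refine ae_of_all _ fun u hu => ?_
      rw [uIoc_of_le ht] at hu
      exact (Summable.of_norm_bounded hB fun i => hFB i u ⟨hu.1.le, hu.2⟩).hasSum.mul_left _
  have h0 : HasSum (fun i => F i t) (∑' i, F i t) :=
    (Summable.of_norm_bounded hB fun i => hFB i t (right_mem_Icc.2 ht)).hasSum
  have := h0.neg.sub (hI.mul_left w)
  rw [hV.2] at this
  exact this.congr_fun fun i => ((hF i).2).symm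

lemma of_continuousOn (h : ContinuousOn φ (Icc 0 t)) : ∃ v, HasVolterra φ w t v := ⟨_, h, rfl⟩

end HasVolterra

end

namespace Screw

open Topology DigammaSeries

variable {w : ℂ} {t : ℝ}

lemma hasSum_PhiC_one {q : ℝ} (hq0 : 0 ≤ q) (hq : q < 1) {a : ℂ} (ha : 1 / 4 ≤ a.re) :
    HasSum (fun n : ℕ => (q : ℂ) ^ n / ((n : ℂ) + a)) (PhiC q 1 a) := by
  have hs : Summable fun n : ℕ => (q : ℂ) ^ n / ((n : ℂ) + a) := by
    refine Summable.of_norm_bounded ((summable_geometric_of_lt_one hq0 hq).mul_right 4) fun n => ?_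
    have h1 : 1 / 4 ≤ ‖(n : ℂ) + a‖ := by
      refine le_trans ?_ (Complex.re_le_norm _)
      have : (0 : ℝ) ≤ n := by positivity
      simp only [add_re, natCast_re]; linarith
    rw [norm_div, norm_pow, Complex.norm_of_nonneg hq0, div_le_iff₀ (by linarith)]
    have := pow_nonneg hq0 n
    nlinarith
  simpa [PhiC] using hs.hasSum

lemma hasVolterra_gammaTerm (hw : w ≠ 0) (hre : 0 ≤ w.re) (n : ℕ) (ht : 0 ≤ t) :
    HasVolterra (fun u => (gammaTerm n u : ℂ)) w t
      (2 / w * ((Real.exp (-t / 2) : ℂ) * ((Real.exp (-2 * t) : ℂ) ^ n / ((n : ℂ) + 1 / 4)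
          - (Real.exp (-2 * t) : ℂ) ^ n / ((n : ℂ) + (1 / 2 + w) / 2))
        - Complex.exp (w * t) * (1 / ((n : ℂ) + (1 / 4 : ℝ)) - 1 / ((n : ℂ) + (1 / 4 + w / 2))))) := by
  have hn : (0 : ℝ) ≤ n := by positivity
  have ha : 4 * (n : ℂ) + 1 ≠ 0 := by
    intro h; have := congrArg Complex.re h; norm_num at this; linarith
  have hb : 2 * w + (4 * (n : ℂ) + 1) ≠ 0 := by
    intro h; have := congrArg Complex.re h; norm_num at this; linarith
  have haw : -(2 * (n : ℂ) + 1 / 2) ≠ w := by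
    rintro rfl; norm_num at hre; linarith
  refine (((HasVolterra.one hw).sub ht (HasVolterra.exp haw)).const_mul
    (1 / ((n : ℂ) + 1 / 4) ^ 2)).congr ht (fun u _ => ?_) ?_
  · rw [gammaTerm]; push_cast; ring
  · have e1 : (Real.exp (-t / 2) : ℂ) * (Real.exp (-2 * t) : ℂ) ^ n
        = Complex.exp (-(2 * (n : ℂ) + 1 / 2) * t) := by
      push_cast
      rw [← Complex.exp_nat_mul, ← Complex.exp_add]; congr 1; ring
    have e2 : (n : ℂ) + 1 / 4 = (4 * (n : ℂ) + 1) / 4 := by ring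
    have e3 : (n : ℂ) + (1 / 2 + w) / 2 = (2 * w + (4 * (n : ℂ) + 1)) / 4 := by ring
    have e4 : (n : ℂ) + (1 / 4 + w / 2) = (2 * w + (4 * (n : ℂ) + 1)) / 4 := by ring
    have e5 : -(2 * (n : ℂ) + 1 / 2) - w = -(2 * w + (4 * (n : ℂ) + 1)) / 2 := by ring
    rw [← e1]
    push_cast
    rw [e5, e2, e3, e4]
    set A := 4 * (n : ℂ) + 1 with hA
    have e6 : 2 * (n : ℂ) + 1 / 2 = A / 2 := by rw [hA]; ring
    rw [e6]
    generalize Complex.exp (w * t) = X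
    generalize Complex.exp (-(t:ℂ) / 2) = Y
    generalize Complex.exp (-2 * (t:ℂ)) ^ n = W
    clear_value A
    field_simp
    ring

lemma hasVolterra_tsum_gammaTerm (hw : w ≠ 0) (hre : 0 ≤ w.re) (ht : 0 < t) :
    HasVolterra (fun u => ((∑' n, gammaTerm n u : ℝ) : ℂ)) w t
      (2 / w * ((Real.exp (-t / 2) : ℂ) *
        (PhiC (Real.exp (-2 * t)) 1 (1 / 4) - PhiC (Real.exp (-2 * t)) 1 ((1 / 2 + w) / 2))
        - Complex.exp (w * t) * (_root_.digamma (1 / 4 + w / 2) - _root_.digamma (1 / 4)))) := by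
  have hc : ContinuousOn (fun u => ((∑' n, gammaTerm n u : ℝ) : ℂ)) (Icc 0 t) := by
    refine continuous_ofReal.comp_continuousOn ((continuousOn_tsum (s := Ici 0) (fun n => ?_)
      summable_quarter fun n t ht => norm_gammaTerm_le n ht).mono Icc_subset_Ici_self)
    unfold gammaTerm; fun_prop
  have hV := HasVolterra.of_continuousOn (w := w) hc
  obtain ⟨v', hv'⟩ := hV
  have hv'' : HasVolterra (fun u => ∑' n, (gammaTerm n u : ℂ)) w t v' := by
    simpa only [ofReal_tsum] using hv'
  have h1 := HasVolterra.hasSum ht.le (fun n => hasVolterra_gammaTerm hw hre n ht.le)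
    summable_quarter (fun n u hu => by
      rw [Complex.norm_real]; exact norm_gammaTerm_le n hu.1) hv''
  have hq : Real.exp (-2 * t) < 1 := by rw [Real.exp_lt_one_iff]; linarith
  have hP1 := hasSum_PhiC_one (Real.exp_pos (-2 * t)).le hq (a := 1 / 4) (by norm_num)
  have hP2 := hasSum_PhiC_one (Real.exp_pos (-2 * t)).le hq (a := (1 / 2 + w) / 2)
    (by norm_num; linarith)
  have hd := hasSum_digamma_sub (a := 1 / 4) (by norm_num) (s := 1 / 4 + w / 2)
    (by norm_num; linarith)
  have h2 := (((hP1.sub hP2).mul_left (Real.exp (-t / 2) : ℂ)).sub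
    (hd.mul_left (Complex.exp (w * t)))).mul_left (2 / w)
  rw [h1.unique h2] at hv'
  convert hv' using 5
  norm_num

lemma hasVolterra_elemTerm (hw : w ≠ 0) (hre : w.re = 0) (ht : 0 < t) :
    HasVolterra (fun u => (elemTerm u : ℂ)) w t
      (-4 * ((w * Complex.exp (w * t) - 1 / 2 * (Real.exp (t / 2) : ℂ)) / (1 / 2 - w)
        + (w * Complex.exp (w * t) + 1 / 2 * (Real.exp (-t / 2) : ℂ)) / (-(1 / 2) - w)
        + 2 * Complex.exp (w * t))
        + 1 / 2 * (_root_.digamma (1 / 4) - Real.log π) * ((Complex.exp (w * t) - 1) / w)) := by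
  have h1 : (1 / 2 : ℂ) ≠ w := by rintro rfl; norm_num at hre
  have h2 : (-(1 / 2) : ℂ) ≠ w := by rintro rfl; norm_num at hre
  have hd : _root_.digamma (1 / 4) = (digammaR (1 / 4) : ℂ) := by
    rw [← digamma_ofReal (by norm_num)]; norm_num
  refine (((((HasVolterra.exp h1).add ht.le (HasVolterra.exp h2)).sub ht.le
    ((HasVolterra.one hw).const_mul 2)).const_mul (-4)).sub ht.le
    ((HasVolterra.ramp hw le_rfl ht.le).const_mul (1 / 2 * (digammaR (1 / 4) - Real.log π)))).congr
    ht.le (fun u hu => ?_) ?_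
  · rw [elemTerm, sub_zero, max_eq_left hu.1]
    push_cast
    rw [show (1 / 2 : ℂ) * u = u / 2 by ring, show -(1 / 2 : ℂ) * u = -u / 2 by ring]
    ring
  · rw [hd]
    push_cast
    rw [show (1 / 2 : ℂ) * t = t / 2 by ring, show -(1 / 2 : ℂ) * t = -t / 2 by ring, sub_zero]
    ring

lemma hasVolterra_tsum_primeTerm (hw : w ≠ 0) (ht : 0 ≤ t) :
    HasVolterra (fun u => ((∑' n, primeTerm n u : ℝ) : ℂ)) w t
      (-∑ n ∈ Finset.Icc 1 ⌊Real.exp t⌋₊, ((vM n / Real.sqrt n : ℝ) : ℂ) *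
          ((Complex.exp (w * ((t : ℝ) - Real.log n)) - 1) / w)) := by
  have h : ∀ n ∈ Finset.Icc 1 ⌊Real.exp t⌋₊, HasVolterra (fun u => (primeTerm n u : ℂ)) w t
      (((vM n / Real.sqrt n : ℝ) : ℂ) * -((Complex.exp (w * ((t : ℝ) - Real.log n)) - 1) / w)) := by
    intro n hn
    rw [Finset.mem_Icc] at hn
    have h1 : (1 : ℝ) ≤ n := by exact_mod_cast hn.1
    have h2 : Real.log n ≤ t := by
      rw [Real.log_le_iff_le_exp (by linarith)]
      exact (Nat.le_floor_iff (Real.exp_pos t).le).1 hn.2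
    refine ((HasVolterra.ramp hw (Real.log_nonneg h1) h2).const_mul
      ((vM n / Real.sqrt n : ℝ) : ℂ)).congr ht (fun u _ => ?_) rfl
    rw [primeTerm]; push_cast; rfl
  refine (HasVolterra.sum ht _ h).congr ht (fun u hu => ?_) ?_
  · rw [tsum_primeTerm (Nat.floor_le_floor (Real.exp_le_exp.2 hu.2)), ofReal_sum]
  · simp

/-- The transform of the screw function is `𝔓_t` up to the contribution of `ξ'/ξ`. -/
theorem hasVolterra_g {x : ℝ} (hx : x ≠ 0) (hX : xiEntire (-(I * x)) ≠ 0) (ht : 0 < t) :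
    HasVolterra (fun u => (g u : ℂ)) (I * x) t
      (Pfrak t x - deriv xiEntire (-(I * x)) / xiEntire (-(I * x)) *
        ((Complex.exp (I * x * t) - 1) / (I * x))) := by
  have hw : I * (x : ℂ) ≠ 0 := mul_ne_zero I_ne_zero (by exact_mod_cast hx)
  have hre : (I * (x : ℂ)).re = 0 := by simp
  have hl := logDeriv_xiEntire_eq_Zfun (s := 1 / 2 - I * x) (by norm_num)
    (by intro h; have := congrArg Complex.re h; norm_num at this)
    (by rwa [show (1 : ℂ) / 2 - I * x - 1 / 2 = -(I * x) by ring])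
  rw [show (1 : ℂ) / 2 - I * x - 1 / 2 = -(I * x) by ring] at hl
  refine (((hasVolterra_elemTerm hw hre ht).sub ht.le
    ((hasVolterra_tsum_gammaTerm hw hre.ge ht).const_mul (1 / 4))).add ht.le
    (hasVolterra_tsum_primeTerm hw ht.le)).congr ht.le (fun u hu => ?_) ?_
  · rw [g_eq hu.1]; push_cast; ring
  · rw [hl, Pfrak]
    rw [show I * (t : ℂ) * x = I * x * t by ring]
    simp only [mul_assoc (2 : ℂ) I (x : ℂ)]
    have h1 : 1 - 2 * (I * (x : ℂ)) ≠ 0 := by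
      intro h; have := congrArg Complex.re h; norm_num at this
    have h2 : 1 + 2 * (I * (x : ℂ)) ≠ 0 := by
      intro h; have := congrArg Complex.re h; norm_num at this
    generalize (∑ n ∈ Finset.Icc 1 ⌊Real.exp t⌋₊, ((vM n / Real.sqrt n : ℝ) : ℂ) *
          ((Complex.exp (I * x * ((t : ℝ) - Real.log n)) - 1) / (I * x))) = S
    generalize deriv Zfun (1 / 2 - I * ↑x) / Zfun (1 / 2 - I * ↑x) = Q
    generalize PhiC (Real.exp (-2 * t)) 1 (1 / 4) = P1
    generalize PhiC (Real.exp (-2 * t)) 1 ((1 / 2 + I * x) / 2) = P2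
    generalize _root_.digamma (1 / 4 + I * x / 2) = D1
    generalize _root_.digamma (1 / 4) = D2
    generalize (Real.exp (t / 2) : ℂ) = E1
    generalize (Real.exp (-t / 2) : ℂ) = E2
    generalize (Real.log π : ℂ) = lp
    generalize Complex.exp (I * x * t) = X
    generalize I * (x : ℂ) = w at *
    rw [show (1 : ℂ) / 2 - w - 1 = -((1 + 2 * w) / 2) by ring,
      show (1 : ℂ) / 2 - w = (1 - 2 * w) / 2 by ring,
      show -((1 : ℂ) / 2) - w = -((1 + 2 * w) / 2) by ring]
    field_simp
    ring

/-- Under RH, `𝔓_t` is a sum over the zeros of `ξ`. -/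
theorem hasSum_Pfrak (hRH : RiemannHypothesis) {x : ℝ} (hx : x ≠ 0) (hX : xiEntire (I * x) ≠ 0)
    (ht : 0 < t) :
    HasSum (fun ρ : XiZero => (xiMult ρ : ℂ) * (Complex.exp (ρ * t) - 1) /
      ((ρ : ℂ) * (ρ - I * x))) (Pfrak t x) := by
  have hw : I * (x : ℂ) ≠ 0 := mul_ne_zero I_ne_zero (by exact_mod_cast hx)
  have hg := hasVolterra_g hx (by rwa [xiEntire_neg]) ht
  have hne : ∀ ρ : XiZero, (ρ : ℂ) ≠ I * x := fun ρ h => hX (h ▸ ρ.2)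
  have hz : ∀ ρ : XiZero, HasVolterra (fun u => zeroTerm ρ u) (I * x) t
      (-((xiMult ρ : ℂ) / (ρ : ℂ) ^ 2) * ((I * x * Complex.exp (I * x * t)
        - ρ * Complex.exp (ρ * t)) / (ρ - I * x) - -Complex.exp (I * x * t))) := fun ρ =>
    ((HasVolterra.exp (hne ρ)).sub ht.le (HasVolterra.one hw)).const_mul _
  have hg' : HasVolterra (fun u => ∑' ρ, zeroTerm ρ u) (I * x) t _ :=
    hg.congr ht.le (fun u hu => (hasSum_zeroTerm hRH hu.1).tsum_eq) rfl
  have h1 := HasVolterra.hasSum ht.le hz (summable_xiMult.mul_right 2)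
    (fun ρ u _ => norm_zeroTerm_le hRH ρ u) hg'
  have h2 := (hasSum_logDeriv_xiEntire hX).mul_left ((Complex.exp (I * x * t) - 1) / (I * x))
  have h3 := h1.sub h2
  rw [xiEntire_neg, deriv_xiEntire_neg] at h3
  have e : Pfrak t x = Pfrak t x - -deriv xiEntire (I * x) / xiEntire (I * x) *
      ((Complex.exp (I * x * t) - 1) / (I * x)) - (Complex.exp (I * x * t) - 1) / (I * x) *
        (deriv xiEntire (I * x) / xiEntire (I * x)) := by ring
  rw [e]
  refine h3.congr_fun fun ρ => ?_
  have h4 := sub_ne_zero.2 (hne ρ)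
  have h6 := ρ.ne_zero
  rw [show 1 / (I * (x : ℂ) - ρ) = -(1 / (ρ - I * x)) by rw [← neg_sub, one_div_neg_eq_neg_one_div]]
  generalize I * (x : ℂ) = w at *
  field_simp
  ring

end Screw

/-! ### Integrals over the real line of functions holomorphic in the upper half plane -/

namespace HalfPlane

open Topology

lemma integrable_of_norm_le {F : ℝ → ℂ} (hF : Continuous F) {C R : ℝ} (hC : 0 ≤ C)
    (hb : ∀ x : ℝ, R ≤ |x| → ‖F x‖ ≤ C / |x| ^ 2) : Integrable F := by
  have key : ∀ x : ℝ, R ≤ |x| → 1 ≤ |x| → ‖F x‖ ≤ (2 * C) * ‖(1 + x ^ 2)⁻¹‖ := by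
    intro x h1 h2
    refine (hb x h1).trans ?_
    rw [Real.norm_of_nonneg (by positivity), sq_abs, ← div_eq_mul_inv]
    have h3 : 1 ≤ x ^ 2 := by rw [← sq_abs]; nlinarith
    rw [div_le_div_iff₀ (by linarith) (by positivity)]
    nlinarith
  refine hF.locallyIntegrable.integrable_of_isBigO_atBot_atTop (g := fun x : ℝ => (1 + x ^ 2)⁻¹)
    (g' := fun x : ℝ => (1 + x ^ 2)⁻¹) ?_ (integrable_inv_one_add_sq.integrableAtFilter _) ?_
    (integrable_inv_one_add_sq.integrableAtFilter _)
  · refine Asymptotics.IsBigO.of_bound (2 * C) ?_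
    filter_upwards [tendsto_abs_atBot_atTop.eventually_ge_atTop R,
      tendsto_abs_atBot_atTop.eventually_ge_atTop 1] with x using key x
  · refine Asymptotics.IsBigO.of_bound (2 * C) ?_
    filter_upwards [tendsto_abs_atTop_atTop.eventually_ge_atTop R,
      tendsto_abs_atTop_atTop.eventually_ge_atTop 1] with x using key x

lemma integral_eq_zero {F : ℂ → ℂ} (hF : ∀ z : ℂ, 0 ≤ z.im → DifferentiableAt ℂ F z) {C R : ℝ}
    (hC : 0 ≤ C) (hb : ∀ z : ℂ, 0 ≤ z.im → R ≤ ‖z‖ → ‖F z‖ ≤ C / ‖z‖ ^ 2) :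
    Integrable (fun x : ℝ => F x) ∧ ∫ x : ℝ, F x = 0 := by
  have hintegrable : Integrable (fun x : ℝ => F x) := by
    refine integrable_of_norm_le (R := R) ?_ hC fun x hx => ?_
    · rw [continuous_iff_continuousAt]
      exact fun x => (hF x (by simp)).continuousAt.comp continuous_ofReal.continuousAt
    · have := hb x (by simp) (by simpa using hx)
      simpa using this
  refine ⟨hintegrable, tendsto_nhds_unique
    (intervalIntegral_tendsto_integral hintegrable tendsto_neg_atTop_atBot tendsto_id) ?_⟩
  have hlim : Tendsto (fun T : ℝ => 4 * C / T) atTop (𝓝 0) := tendsto_const_nhds.div_atTop tendsto_id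
  refine squeeze_zero_norm' ?_ hlim
  filter_upwards [eventually_ge_atTop R, eventually_gt_atTop 0] with T hR hT
  have hrect := Complex.integral_boundary_rect_eq_zero_of_differentiableOn F (-T : ℝ) (T + T * I) ?_
  swap
  · intro z hz
    refine (hF z ?_).differentiableWithinAt
    have := hz.2
    simp only [mem_preimage, ofReal_im, add_im, mul_im, ofReal_re, I_im, mul_one, I_re, mul_zero,
      add_zero, zero_add, uIcc_of_le hT.le] at this
    exact this.1
  simp only [ofReal_re, ofReal_im, add_re, add_im, mul_re, mul_im, I_re, I_im, mul_zero, mul_one,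
    sub_self, add_zero, zero_add, ofReal_zero, zero_mul, smul_eq_mul] at hrect
  have hbd : ∀ z : ℂ, 0 ≤ z.im → T ≤ ‖z‖ → ‖F z‖ ≤ C / T ^ 2 := fun z h1 h2 =>
    (hb z h1 (hR.trans h2)).trans (by gcongr)
  have b1 : ‖∫ x : ℝ in (-T)..T, F (x + T * I)‖ ≤ C / T ^ 2 * |T - -T| := by
    refine intervalIntegral.norm_integral_le_of_norm_le_const fun x _ => hbd _ (by simp [hT.le]) ?_
    refine le_trans ?_ (Complex.abs_im_le_norm _)
    simp [abs_of_pos hT]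
  have b2 : ∀ S : ℝ, |S| = T → ‖∫ y : ℝ in (0 : ℝ)..T, F (S + y * I)‖ ≤ C / T ^ 2 * |T - 0| := by
    intro S hS
    refine intervalIntegral.norm_integral_le_of_norm_le_const fun y hy => hbd _ ?_ ?_
    · rw [uIoc_of_le hT.le] at hy; simpa using hy.1.le
    · refine le_trans ?_ (Complex.abs_re_le_norm _)
      simp [hS]
  have b3 := b2 T (abs_of_pos hT)
  have b4 := b2 (-T) (by rw [abs_neg, abs_of_pos hT])
  rw [show T - -T = 2 * T by ring, abs_of_pos (by linarith)] at b1
  rw [sub_zero, abs_of_pos hT] at b3 b4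
  have e : ∫ x : ℝ in (-T)..T, F x = (∫ x : ℝ in (-T)..T, F (x + T * I))
      - I * (∫ y : ℝ in (0 : ℝ)..T, F (T + y * I))
      + I * (∫ y : ℝ in (0 : ℝ)..T, F ((-T : ℝ) + y * I)) := by
    linear_combination hrect
  simp only [id]
  rw [e]
  refine (norm_add_le _ _).trans ((add_le_add_left (norm_sub_le _ _) _).trans ?_)
  rw [norm_mul, norm_mul, norm_I, one_mul, one_mul]
  have e2 : 4 * C / T = C / T ^ 2 * (2 * T) + C / T ^ 2 * T + C / T ^ 2 * T := by
    field_simp; ring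
  rw [e2]
  gcongr

/-- If `h` is bounded and holomorphic in the closed upper half plane and vanishes at the points
`a` and `b` of the real line (counted with multiplicity), then the integral over the line of
`h / ((x - a) (x - b))` vanishes. -/
lemma integral_div_eq_zero {h : ℂ → ℂ} (hh : ∀ z : ℂ, 0 ≤ z.im → AnalyticAt ℂ h z) {K : ℝ}
    (hK : ∀ z : ℂ, 0 ≤ z.im → ‖h z‖ ≤ K) {a b : ℝ} (ha : h a = 0) (hab : dslope h a b = 0) :
    Integrable (fun x : ℝ => h x / (((x : ℂ) - a) * (x - b))) ∧
      ∫ x : ℝ, h x / (((x : ℂ) - a) * (x - b)) = 0 := by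
  have hK0 : 0 ≤ K := (norm_nonneg _).trans (hK 0 (by simp))
  set U : Set ℂ := {z | AnalyticAt ℂ h z} with hU
  have hUo : IsOpen U := isOpen_analyticAt ℂ h
  have hUm : ∀ z : ℂ, 0 ≤ z.im → U ∈ 𝓝 z := fun z hz => hUo.mem_nhds (hh z hz)
  have hd : DifferentiableOn ℂ (dslope (dslope h a) b) U := by
    rw [Complex.differentiableOn_dslope (hUm b (by simp)),
      Complex.differentiableOn_dslope (hUm a (by simp))]
    exact fun z hz => hz.differentiableAt.differentiableWithinAt
  have hval : ∀ z : ℂ, z ≠ a → z ≠ b →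
      dslope (dslope h a) b z = h z / ((z - a) * (z - b)) := by
    intro z hza hzb
    rw [dslope_of_ne _ hzb, slope_def_field, hab, dslope_of_ne _ hza, slope_def_field, ha]
    rw [sub_zero, sub_zero, div_div]
  have hz := integral_eq_zero (F := dslope (dslope h a) b) (C := 4 * K)
    (R := 2 * |a| + 2 * |b| + 1) (fun z hz => (hd z (hh z hz)).differentiableAt (hUm z hz))
    (by positivity) ?_
  · have hae : (fun x : ℝ => dslope (dslope h a) b x) =ᵐ[volume]
        fun x : ℝ => h x / (((x : ℂ) - a) * (x - b)) := by
      have h1 : ∀ᵐ x : ℝ, x ≠ a := by simp [ae_iff]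
      have h2 : ∀ᵐ x : ℝ, x ≠ b := by simp [ae_iff]
      filter_upwards [h1, h2] with x hx1 hx2
      exact hval x (by exact_mod_cast hx1) (by exact_mod_cast hx2)
    exact ⟨hz.1.congr hae, by rw [← integral_congr_ae hae]; exact hz.2⟩
  · intro z hz hR
    have hz0 : 0 < ‖z‖ := lt_of_lt_of_le (by positivity) hR
    have far : ∀ c : ℝ, |c| ≤ |a| + |b| → ‖z‖ / 2 ≤ ‖z - c‖ := by
      intro c hc
      have := norm_sub_norm_le z (c : ℂ)
      rw [Complex.norm_real, Real.norm_eq_abs] at this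
      linarith
    have fa := far a (by linarith [abs_nonneg b])
    have fb := far b (by linarith [abs_nonneg a])
    have za : z ≠ a := by rintro rfl; rw [sub_self, norm_zero] at fa; linarith
    have zb : z ≠ b := by rintro rfl; rw [sub_self, norm_zero] at fb; linarith
    rw [hval z za zb, norm_div, norm_mul]
    calc ‖h z‖ / (‖z - a‖ * ‖z - b‖) ≤ K / (‖z‖ / 2 * (‖z‖ / 2)) := by
          gcongr; exact hK z hz
      _ = 4 * K / ‖z‖ ^ 2 := by field_simp; ring

lemma integral_im_div_eq_zero {f : ℂ → ℂ} (hf : ∀ z : ℂ, 0 ≤ z.im → AnalyticAt ℂ f z)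
    (hb : ∀ z : ℂ, 0 ≤ z.im → ‖f z‖ ≤ 1) {a b : ℝ} (hab : a ≠ b) (ha : f a = 0) (hfb : f b = 0) :
    Integrable (fun x : ℝ => (f x).im / ((x - a) * (x - b))) ∧
      ∫ x : ℝ, (f x).im / ((x - a) * (x - b)) = 0 := by
  have h := integral_div_eq_zero hf hb ha (b := b) (by
    rw [dslope_of_ne _ (by exact_mod_cast hab.symm), slope_def_field, ha, hfb]; simp)
  have e : ∀ x : ℝ, (f x / (((x : ℂ) - a) * (x - b))).im = (f x).im / ((x - a) * (x - b)) := by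
    intro x
    have : (((x : ℂ) - a) * (x - b)) = (((x - a) * (x - b) : ℝ) : ℂ) := by push_cast; ring
    rw [this, Complex.div_ofReal_im]
  have h1 := h.1.im
  have h2 := integral_im h.1
  rw [h.2] at h2
  simp only [RCLike.im_to_complex, e, zero_im] at h1 h2
  exact ⟨h1, h2⟩

lemma integral_inv_sq_add_sq {m : ℝ} (hm : 0 < m) (a : ℝ) :
    Integrable (fun x : ℝ => 1 / (m ^ 2 + (x - a) ^ 2)) ∧
      ∫ x : ℝ, 1 / (m ^ 2 + (x - a) ^ 2) = π / m := by
  have e : ∀ x : ℝ, 1 / (m ^ 2 + (x - a) ^ 2) = (1 / m ^ 2) * (1 + ((x - a) / m) ^ 2)⁻¹ := by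
    intro x
    have : 0 < m ^ 2 + (x - a) ^ 2 := by positivity
    field_simp
  have h1 : Integrable fun x : ℝ => (1 + (x / m) ^ 2)⁻¹ :=
    integrable_inv_one_add_sq.comp_div hm.ne'
  simp_rw [e]
  refine ⟨(h1.comp_sub_right a).const_mul _, ?_⟩
  rw [integral_const_mul, integral_sub_right_eq_self (fun x : ℝ => (1 + (x / m) ^ 2)⁻¹),
    Measure.integral_comp_div (fun x : ℝ => (1 + x ^ 2)⁻¹), integral_univ_inv_one_add_sq,
    abs_of_pos hm, smul_eq_mul]
  field_simp

lemma integral_im_div_sq {f : ℂ → ℂ} (hf : ∀ z : ℂ, 0 ≤ z.im → AnalyticAt ℂ f z)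
    (hb : ∀ z : ℂ, 0 ≤ z.im → ‖f z‖ ≤ 1) {a m : ℝ} (hm : 0 < m) (ha : f a = 0)
    (hd : deriv f a = 1 / m) :
    Integrable (fun x : ℝ => (f x).im / ((x - a) * (x - a))) ∧
      ∫ x : ℝ, (f x).im / ((x - a) * (x - a)) = π / m := by
  set k : ℂ → ℂ := fun z => (z - a) / (m - I * (z - a)) with hk
  have hden : ∀ z : ℂ, 0 ≤ z.im → m ≤ ((m : ℂ) - I * (z - a)).re := by
    intro z hz; simp [hz]
  have hne : ∀ z : ℂ, 0 ≤ z.im → (m : ℂ) - I * (z - a) ≠ 0 := by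
    intro z hz h0
    have := hden z hz
    rw [h0] at this; simp at this; linarith
  have hkan : ∀ z : ℂ, 0 ≤ z.im → AnalyticAt ℂ k z := by
    intro z hz
    exact AnalyticAt.div (by fun_prop) (by fun_prop) (hne z hz)
  have hkb : ∀ z : ℂ, 0 ≤ z.im → ‖k z‖ ≤ 1 := by
    intro z hz
    rw [hk]
    simp only
    rw [norm_div, div_le_one (norm_pos_iff.2 (hne z hz)), ← sq_le_sq₀ (norm_nonneg _) (norm_nonneg _),
      ← Complex.normSq_eq_norm_sq, ← Complex.normSq_eq_norm_sq, Complex.normSq_apply,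
      Complex.normSq_apply]
    simp
    nlinarith
  have hka : k a = 0 := by simp [hk]
  have hkd : deriv k a = 1 / m := by
    have h1 : HasDerivAt (fun z : ℂ => z - (a : ℂ)) 1 a := (hasDerivAt_id _).sub_const _
    have h2 := h1.div ((h1.const_mul I).const_sub (m : ℂ)) (hne a (by simp))
    rw [hk]
    refine h2.deriv.trans ?_
    have : (m : ℂ) ≠ 0 := by exact_mod_cast hm.ne'
    simp
    field_simp
  have h := integral_div_eq_zero (h := fun z => f z - k z) (K := 2) (a := a) (b := a)
    (fun z hz => (hf z hz).sub (hkan z hz))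
    (fun z hz => (norm_sub_le _ _).trans (by linarith [hb z hz, hkb z hz]))
    (by simp [ha, hka]) (by
      rw [dslope_same]
      have := deriv_sub (hf a (by simp)).differentiableAt (hkan a (by simp)).differentiableAt
      refine Eq.trans ?_ (this.trans (by rw [hd, hkd, sub_self]))
      rfl)
  have e : ∀ x : ℝ, x ≠ a → ((f x - k x) / (((x : ℂ) - a) * (x - a))).im
      = (f x).im / ((x - a) * (x - a)) - 1 / (m ^ 2 + (x - a) ^ 2) := by
    intro x hx
    have h0 : x - a ≠ 0 := sub_ne_zero.2 hx
    have : (((x : ℂ) - a) * (x - a)) = (((x - a) * (x - a) : ℝ) : ℂ) := by push_cast; ring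
    rw [this, Complex.div_ofReal_im, sub_im, sub_div]
    congr 1
    have hkx : (k x).im = (x - a) ^ 2 / (m ^ 2 + (x - a) ^ 2) := by
      rw [hk]
      simp only
      rw [Complex.div_im]
      have hn : Complex.normSq ((m : ℂ) - I * (x - a)) = m ^ 2 + (x - a) ^ 2 := by
        rw [Complex.normSq_apply]; simp; ring
      rw [hn]; simp; ring
    rw [hkx]
    have : 0 < m ^ 2 + (x - a) ^ 2 := by positivity
    field_simp
  have hae : (fun x : ℝ => ((f x - k x) / (((x : ℂ) - a) * (x - a))).im) =ᵐ[volume] fun x : ℝ =>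
      (f x).im / ((x - a) * (x - a)) - 1 / (m ^ 2 + (x - a) ^ 2) := by
    have h1 : ∀ᵐ x : ℝ, x ≠ a := by simp [ae_iff]
    filter_upwards [h1] with x hx using e x hx
  have hi := integral_inv_sq_add_sq hm a
  have h1 : Integrable (fun x : ℝ =>
      (f x).im / ((x - a) * (x - a)) - 1 / (m ^ 2 + (x - a) ^ 2)) := h.1.im.congr hae
  have h2 : ∫ x : ℝ, ((f x).im / ((x - a) * (x - a)) - 1 / (m ^ 2 + (x - a) ^ 2)) = 0 := by
    rw [← integral_congr_ae hae]
    have := integral_im h.1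
    rw [h.2] at this
    simpa using this
  have h3 : Integrable (fun x : ℝ => (f x).im / ((x - a) * (x - a))) :=
    (h1.add hi.1).congr (ae_of_all _ fun x => by simp)
  refine ⟨h3, ?_⟩
  rw [integral_sub h3 hi.1, hi.2] at h2
  linarith

end HalfPlane

/-! ### Parseval's identity for series converging almost everywhere -/

open Topology in
theorem integral_norm_sq_of_orthonormal {ι α : Type*} [Countable ι] {mα : MeasurableSpace α}
    {μ : Measure α} {e : ι → α → ℂ} (he : ∀ i, MemLp (e i) 2 μ)
    (horth : ∀ i j, i ≠ j → ∫ x, e j x * (starRingEnd ℂ) (e i x) ∂μ = 0)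
    (hnorm : ∀ i, ∫ x, e i x * (starRingEnd ℂ) (e i x) ∂μ = 1)
    {b : ι → ℂ} (hb : Summable fun i => ‖b i‖ ^ 2) {S : α → ℂ}
    (hS : ∀ᵐ x ∂μ, HasSum (fun i => b i * e i x) (S x)) :
    ∫ x, ‖S x‖ ^ 2 ∂μ = ∑' i, ‖b i‖ ^ 2 := by
  classical
  set v : ι → Lp ℂ 2 μ := fun i => (he i).toLp (e i) with hv
  have hin : ∀ i j, inner ℂ (v i) (v j) = ∫ x, e j x * (starRingEnd ℂ) (e i x) ∂μ := by
    intro i j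
    rw [L2.inner_def]
    refine integral_congr_ae ?_
    filter_upwards [(he i).coeFn_toLp, (he j).coeFn_toLp] with x h1 h2
    rw [hv]
    simp only
    rw [h1, h2, RCLike.inner_apply]
  have hon : Orthonormal ℂ v := by
    rw [orthonormal_iff_ite]
    intro i j
    rw [hin]
    split_ifs with h
    · subst h; exact hnorm i
    · exact horth i j h
  obtain ⟨L, hL⟩ := (hon.orthogonalFamily.summable_iff_norm_sq_summable b).2 hb
  have hL' : Tendsto (fun s : Finset ι => ∑ i ∈ s, b i • v i) atTop (𝓝 L) := by
    simpa [HasSum] using hL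
  have hnormL : ‖L‖ ^ 2 = ∑' i, ‖b i‖ ^ 2 := by
    have h1 : Tendsto (fun s : Finset ι => ‖∑ i ∈ s, b i • v i‖ ^ 2) atTop (𝓝 (‖L‖ ^ 2)) :=
      hL'.norm.pow 2
    have h2 : ∀ s : Finset ι, ‖∑ i ∈ s, b i • v i‖ ^ 2 = ∑ i ∈ s, ‖b i‖ ^ 2 := fun s => by
      have := hon.orthogonalFamily.norm_sum b s
      simpa using this
    simp_rw [h2] at h1
    exact tendsto_nhds_unique h1 hb.hasSum
  obtain ⟨s, hs⟩ := Filter.exists_seq_tendsto (atTop : Filter (Finset ι))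
  obtain ⟨ns, hns, hae⟩ :=
    (tendstoInMeasure_of_tendsto_Lp (hL'.comp hs)).exists_seq_tendsto_ae
  have hsum : ∀ n : ℕ, ∀ᵐ x ∂μ, (∑ i ∈ s n, b i • v i : Lp ℂ 2 μ) x = ∑ i ∈ s n, b i * e i x := by
    intro n
    have h1 : ∀ᵐ x ∂μ, ∀ i, (b i • v i : Lp ℂ 2 μ) x = b i * e i x := by
      rw [ae_all_iff]
      intro i
      filter_upwards [Lp.coeFn_smul (b i) (v i), (he i).coeFn_toLp] with x h1 h2
      rw [h1, Pi.smul_apply, smul_eq_mul, hv]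
      simp only
      rw [h2]
    filter_upwards [Lp.coeFn_finsetSum (s n) (fun i => b i • v i), h1] with x hx1 hx2
    rw [hx1, Finset.sum_apply]
    exact Finset.sum_congr rfl fun i _ => hx2 i
  have hLS : (L : α → ℂ) =ᵐ[μ] S := by
    filter_upwards [hae, hS, ae_all_iff.2 hsum] with x h1 h2 h3
    refine tendsto_nhds_unique h1 ?_
    have h4 : Tendsto (fun s : Finset ι => ∑ i ∈ s, b i * e i x) atTop (𝓝 (S x)) := by
      simpa [HasSum] using h2
    exact ((h4.comp hs).comp hns.tendsto_atTop).congr fun k => (h3 (ns k)).symm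
  rw [← hnormL]
  have h5 : (‖L‖ ^ 2 : ℝ) = RCLike.re (inner ℂ L L) := by
    rw [inner_self_eq_norm_sq]
  rw [h5, L2.inner_def, ← integral_re (L2.integrable_inner L L)]
  refine integral_congr_ae ?_
  filter_upwards [hLS] with x hx
  rw [inner_self_eq_norm_sq, hx]

/-! ### The weight attached to the xi function -/

open Topology in
lemma analyticAt_div_deriv_sub {A h : ℂ → ℂ} {a : ℂ} {m : ℕ} (hm : 0 < m) (hh : AnalyticAt ℂ h a)
    (h0 : h a ≠ 0) (hA : ∀ᶠ z in 𝓝 a, A z = (z - a) ^ m * h z) (c : ℂ) :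
    AnalyticAt ℂ (fun z => A z / (deriv A z - c * A z)) a ∧
      deriv (fun z => A z / (deriv A z - c * A z)) a = 1 / m := by
  obtain ⟨n, rfl⟩ : ∃ n, m = n + 1 := ⟨m - 1, by omega⟩
  set u : ℂ → ℂ := fun z =>
    h z / (((n + 1 : ℕ) : ℂ) * h z + (z - a) * deriv h z - c * (z - a) * h z) with hu
  have hn : ((n + 1 : ℕ) : ℂ) ≠ 0 := by exact_mod_cast Nat.succ_ne_zero n
  have hden : ((n + 1 : ℕ) : ℂ) * h a + (a - a) * deriv h a - c * (a - a) * h a ≠ 0 := by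
    rw [sub_self]; simpa using ⟨by exact_mod_cast hn, h0⟩
  have hhd : AnalyticAt ℂ (deriv h) a := hh.deriv
  have hua : AnalyticAt ℂ u a := AnalyticAt.div hh (by fun_prop) hden
  have hua1 : u a = 1 / ((n + 1 : ℕ) : ℂ) := by
    rw [hu]; simp only [sub_self, zero_mul, mul_zero, add_zero, sub_zero]
    field_simp
  have hev : (fun z => A z / (deriv A z - c * A z)) =ᶠ[𝓝 a] fun z => (z - a) * u z := by
    filter_upwards [hA, eventually_eventually_nhds.2 hA, hh.eventually_analyticAt]
      with z hz1 hz2 hz3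
    have hd : deriv A z = (z - a) ^ n * (((n + 1 : ℕ) : ℂ) * h z + (z - a) * deriv h z) := by
      rw [Filter.EventuallyEq.deriv_eq hz2]
      have h1 : HasDerivAt (fun z : ℂ => z - a) 1 z := (hasDerivAt_id z).sub_const a
      have h2 := (h1.pow (n + 1)).mul hz3.differentiableAt.hasDerivAt
      refine h2.deriv.trans ?_
      simp only [Pi.pow_apply]
      rw [Nat.add_sub_cancel]
      ring
    rw [hd, hz1, hu]
    simp only
    rcases eq_or_ne z a with rfl | hza
    · simp
    · have h1 : (z - a) ^ n ≠ 0 := pow_ne_zero _ (sub_ne_zero.2 hza)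
      rw [← mul_div_assoc]
      refine Eq.trans ?_ (mul_div_mul_left _ _ h1)
      congr 1 <;> ring
  have han : AnalyticAt ℂ (fun z => (z - a) * u z) a := by fun_prop
  refine ⟨han.congr hev.symm, ?_⟩
  rw [hev.deriv_eq, ← hua1]
  have h1 : HasDerivAt (fun z : ℂ => z - a) 1 a := (hasDerivAt_id a).sub_const a
  have := (h1.mul hua.differentiableAt.hasDerivAt).deriv
  rw [sub_self, zero_mul, one_mul, add_zero] at this
  exact this

namespace XiLine

open Topology

/-- The function `z ↦ ξ(1/2 + iz)`. -/
def xiLine (z : ℂ) : ℂ := xiEntire (I * z)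

/-- The ordinate of a zero of the xi function. -/
def ordinate (ρ : XiZero) : ℝ := (ρ : ℂ).im

/-- The function `A / (A' - iA)`, where `A(z) = ξ(1/2 + iz)`. -/
def resolvent (z : ℂ) : ℂ := xiLine z / (deriv xiLine z - I * xiLine z)

lemma hasDerivAt_xiLine (z : ℂ) : HasDerivAt xiLine (deriv xiEntire (I * z) * I) z := by
  have h1 : HasDerivAt (fun z : ℂ => I * z) I z := by simpa using (hasDerivAt_id z).const_mul I
  exact (differentiable_xiEntire (I * z)).hasDerivAt.comp z h1

lemma differentiable_xiLine : Differentiable ℂ xiLine := fun z =>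
  (hasDerivAt_xiLine z).differentiableAt

lemma xiLine_ofReal_conj (x : ℝ) : (starRingEnd ℂ) (xiLine x) = xiLine x := by
  rw [xiLine, ← xiEntire_conj, ← xiEntire_neg]
  simp

lemma eq_I_mul_ordinate (hRH : RiemannHypothesis) (ρ : XiZero) : (ρ : ℂ) = I * ordinate ρ := by
  refine Complex.ext ?_ ?_
  · simpa using re_eq_zero_of_riemannHypothesis hRH ρ.2
  · simp [ordinate]

lemma ordinate_ne_zero (hRH : RiemannHypothesis) (ρ : XiZero) : ordinate ρ ≠ 0 := by
  intro h
  have := eq_I_mul_ordinate hRH ρ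
  rw [h] at this
  exact ρ.ne_zero (by simpa using this)

lemma ordinate_injective (hRH : RiemannHypothesis) : Function.Injective ordinate := by
  intro ρ σ h
  apply Subtype.ext
  rw [eq_I_mul_ordinate hRH ρ, eq_I_mul_ordinate hRH σ, h]

lemma hasSum_logDeriv (hRH : RiemannHypothesis) {z : ℂ} (hz : xiLine z ≠ 0) :
    HasSum (fun ρ : XiZero => (xiMult ρ : ℂ) * (1 / (z - ordinate ρ) + 1 / (ordinate ρ : ℂ)))
      (deriv xiLine z / xiLine z) := by
  have h := (hasSum_logDeriv_xiEntire hz).mul_left I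
  rw [(hasDerivAt_xiLine z).deriv, show deriv xiEntire (I * z) * I / xiLine z
    = I * (deriv xiEntire (I * z) / xiEntire (I * z)) by rw [xiLine]; ring]
  refine h.congr_fun fun ρ => ?_
  rw [eq_I_mul_ordinate hRH ρ, ← mul_sub]
  simp only [one_div, mul_inv, inv_I]
  linear_combination ((xiMult ρ : ℂ) * ((z - ordinate ρ)⁻¹ + (ordinate ρ : ℂ)⁻¹)) * I_sq

lemma im_term (ρ : XiZero) (z : ℂ) :
    ((xiMult ρ : ℂ) * (1 / (z - ordinate ρ) + 1 / (ordinate ρ : ℂ))).im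
      = -(xiMult ρ * (z.im / Complex.normSq (z - ordinate ρ))) := by
  have h1 : (1 / (ordinate ρ : ℂ)).im = 0 := by
    rw [show 1 / (ordinate ρ : ℂ) = ((1 / ordinate ρ : ℝ) : ℂ) by push_cast; rfl, ofReal_im]
  rw [← ofReal_natCast, im_ofReal_mul, add_im, h1, one_div, inv_im]
  simp
  ring

lemma im_logDeriv_nonpos (hRH : RiemannHypothesis) {z : ℂ} (him : 0 ≤ z.im) (hz : xiLine z ≠ 0) :
    (deriv xiLine z / xiLine z).im ≤ 0 := by
  have h := Complex.hasSum_im (hasSum_logDeriv hRH hz)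
  refine h.nonpos fun ρ => ?_
  rw [im_term, neg_nonpos]
  exact mul_nonneg (Nat.cast_nonneg _) (div_nonneg him (Complex.normSq_nonneg _))

lemma im_logDeriv_ofReal (hRH : RiemannHypothesis) {x : ℝ} (hx : xiLine x ≠ 0) :
    (deriv xiLine x / xiLine x).im = 0 := by
  have h := Complex.hasSum_im (hasSum_logDeriv hRH hx)
  refine h.unique ?_
  simp_rw [im_term]
  simp

lemma resolvent_eq {z : ℂ} (hz : xiLine z ≠ 0) :
    resolvent z = (deriv xiLine z / xiLine z - I)⁻¹ := by
  rw [resolvent, div_sub' hz, inv_div, mul_comm I]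

lemma one_le_norm (hRH : RiemannHypothesis) {z : ℂ} (him : 0 ≤ z.im) (hz : xiLine z ≠ 0) :
    1 ≤ ‖deriv xiLine z / xiLine z - I‖ := by
  refine le_trans ?_ (Complex.abs_im_le_norm _)
  have := im_logDeriv_nonpos hRH him hz
  rw [sub_im, I_im, abs_of_nonpos (by linarith)]
  linarith

lemma norm_resolvent_le (hRH : RiemannHypothesis) {z : ℂ} (him : 0 ≤ z.im) :
    ‖resolvent z‖ ≤ 1 := by
  by_cases hz : xiLine z = 0
  · simp [resolvent, hz]
  · rw [resolvent_eq hz, norm_inv]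
    exact inv_le_one_of_one_le₀ (one_le_norm hRH him hz)

lemma analyticAt_resolvent_ordinate (hRH : RiemannHypothesis) (ρ : XiZero) :
    AnalyticAt ℂ resolvent (ordinate ρ) ∧ deriv resolvent (ordinate ρ) = 1 / (xiMult ρ : ℝ) := by
  have han := differentiable_xiEntire.analyticAt (ρ : ℂ)
  obtain ⟨g, hg, hg0, hge⟩ := (han.analyticOrderNatAt_eq_iff
    (EntireFunction.analyticOrderAt_ne_top_of_differentiable differentiable_xiEntire
      xiEntire_zero_ne_zero ρ)).1 (rfl : analyticOrderNatAt xiEntire ρ = xiMult ρ)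
  have hρ := eq_I_mul_ordinate hRH ρ
  have hcont : Tendsto (fun z : ℂ => I * z) (𝓝 (ordinate ρ : ℂ)) (𝓝 (ρ : ℂ)) := by
    rw [hρ]; exact (continuous_const.mul continuous_id).tendsto _
  have h := analyticAt_div_deriv_sub (A := xiLine) (h := fun z => I ^ xiMult ρ * g (I * z))
    (a := ordinate ρ) (m := xiMult ρ) (xiMult_pos ρ) ?_ ?_ ?_ I
  · refine ⟨h.1, h.2.trans (by push_cast; rfl)⟩
  · refine analyticAt_const.mul (AnalyticAt.comp (g := g) ?_ (by fun_prop))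
    rwa [← hρ]
  · rw [← hρ]
    exact mul_ne_zero (pow_ne_zero _ I_ne_zero) hg0
  · filter_upwards [hcont.eventually hge] with z hz
    have e : I * z - (ρ : ℂ) = I * (z - ordinate ρ) := by rw [mul_sub, ← hρ]
    rw [xiLine, hz, e, mul_pow, smul_eq_mul, xiMult]
    ring

lemma exists_ordinate_eq {z : ℂ} (hRH : RiemannHypothesis) (hz : xiLine z = 0) :
    ∃ ρ : XiZero, (ordinate ρ : ℂ) = z := by
  refine ⟨⟨I * z, hz⟩, ?_⟩
  have := eq_I_mul_ordinate hRH ⟨I * z, hz⟩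
  exact (mul_left_cancel₀ I_ne_zero this).symm

lemma analyticAt_resolvent (hRH : RiemannHypothesis) {z : ℂ} (him : 0 ≤ z.im) :
    AnalyticAt ℂ resolvent z := by
  by_cases hz : xiLine z = 0
  · obtain ⟨ρ, rfl⟩ := exists_ordinate_eq hRH hz
    exact (analyticAt_resolvent_ordinate hRH ρ).1
  · have hA := differentiable_xiLine.analyticAt z
    refine hA.div (hA.deriv.sub (analyticAt_const.mul hA)) ?_
    have h1 := one_le_norm hRH him hz
    intro h0
    have : deriv xiLine z / xiLine z - I = 0 := by
      rw [div_sub' hz, div_eq_zero_iff]; left; rw [mul_comm]; exact h0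
    rw [this, norm_zero] at h1
    linarith

lemma xiLine_ordinate (hRH : RiemannHypothesis) (ρ : XiZero) : xiLine (ordinate ρ) = 0 := by
  rw [xiLine, ← eq_I_mul_ordinate hRH ρ]; exact ρ.2

lemma resolvent_ordinate (hRH : RiemannHypothesis) (ρ : XiZero) : resolvent (ordinate ρ) = 0 := by
  rw [resolvent, xiLine_ordinate hRH, zero_div]

lemma im_resolvent (hRH : RiemannHypothesis) {x : ℝ} (hx : xiLine x ≠ 0) :
    (resolvent x).im = 1 / (1 + (deriv xiLine x / xiLine x).re ^ 2) := by
  have h := im_logDeriv_ofReal hRH hx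
  rw [resolvent_eq hx, inv_im, Complex.normSq_apply]
  simp only [sub_im, sub_re, I_im, I_re, h]
  norm_num
  ring

lemma im_resolvent_nonneg (hRH : RiemannHypothesis) (x : ℝ) : 0 ≤ (resolvent x).im := by
  by_cases hx : xiLine x = 0
  · simp [resolvent, hx]
  · rw [im_resolvent hRH hx]; positivity

lemma ae_xiLine_ne_zero (hRH : RiemannHypothesis) : ∀ᵐ x : ℝ, xiLine x ≠ 0 := by
  have hc : {x : ℝ | ¬ xiLine x ≠ 0}.Countable := by
    refine (countable_range ordinate).mono fun x hx => ?_
    obtain ⟨ρ, h⟩ := exists_ordinate_eq hRH (not_not.1 hx)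
    exact ⟨ρ, by exact_mod_cast h⟩
  exact hc.measure_zero volume

lemma Efun_ofReal {x : ℝ} (hx : xiLine x ≠ 0) :
    Efun x = xiLine x * (1 + I * (deriv xiLine x / xiLine x)) := by
  have hre : 0 < ((1 : ℂ) / 2 - I * x).re := by norm_num
  have hne : (1 : ℂ) / 2 - I * x ≠ 1 := by
    intro h; have := congrArg Complex.re h; norm_num at this
  have hev : xi =ᶠ[𝓝 ((1 : ℂ) / 2 - I * x)] fun s => xiEntire (s - 1 / 2) := by
    filter_upwards [(isOpen_lt continuous_const Complex.continuous_re).mem_nhds hre,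
      isOpen_ne.mem_nhds hne] with s h1 h2
    exact (xiEntire_eq_xi h1 h2).symm
  rw [Efun, hev.deriv_eq, hev.eq_of_nhds, deriv_comp_sub_const,
    show (1 : ℂ) / 2 - I * x - 1 / 2 = -(I * x) by ring, xiEntire_neg, deriv_xiEntire_neg,
    (hasDerivAt_xiLine x).deriv]
  change xiLine x + _ = _
  field_simp
  linear_combination -(deriv xiEntire (I * x)) * I_sq

lemma normSq_one_add_Theta (hRH : RiemannHypothesis) {x : ℝ} (hx : xiLine x ≠ 0) :
    ‖1 + Theta x‖ ^ 2 = 4 * (resolvent x).im := by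
  set q : ℝ := (deriv xiLine x / xiLine x).re with hq
  have hqe : deriv xiLine x / xiLine x = q := by
    refine Complex.ext (by simp [hq]) ?_
    rw [im_logDeriv_ofReal hRH hx, ofReal_im]
  have hn : Complex.normSq (1 + I * q) = 1 + q ^ 2 := by
    rw [Complex.normSq_apply]; simp; ring
  have hne : (1 : ℂ) + I * q ≠ 0 := by
    rw [← Complex.normSq_pos, hn]; positivity
  have h1 : 1 + Theta x = 2 / (1 + I * q) := by
    rw [Theta, conj_ofReal, Efun_ofReal hx, hqe, map_mul, xiLine_ofReal_conj]
    simp only [map_add, map_one, map_mul, conj_I, conj_ofReal]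
    field_simp
    ring
  rw [h1, im_resolvent hRH hx, ← hq, norm_div, div_pow, ← Complex.normSq_eq_norm_sq (1 + I * q), hn]
  norm_num
  ring

end XiLine

namespace XiLine

open Topology Screw

/-- The orthonormal system attached to the zeros of the xi function. -/
def basisFun (ρ : XiZero) (x : ℝ) : ℝ :=
  √(xiMult ρ / π) * √(resolvent x).im / (x - ordinate ρ)

/-- The coefficients of `𝔖_t` in the system `basisFun`. -/
def coeff (t : ℝ) (ρ : XiZero) : ℂ := √(xiMult ρ) * ((Complex.exp (ρ * t) - 1) / ordinate ρ)

lemma measurable_basisFun (hRH : RiemannHypothesis) (ρ : XiZero) : Measurable (basisFun ρ) := by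
  have hc : Continuous fun x : ℝ => resolvent x := by
    rw [continuous_iff_continuousAt]
    exact fun x => (analyticAt_resolvent hRH (z := x) (by simp)).continuousAt.comp
      continuous_ofReal.continuousAt
  have h1 : Measurable fun x : ℝ => (resolvent x).im := (Complex.continuous_im.comp hc).measurable
  unfold basisFun
  fun_prop

lemma basisFun_mul (hRH : RiemannHypothesis) (ρ σ : XiZero) (x : ℝ) :
    basisFun ρ x * basisFun σ x = √(xiMult ρ / π) * √(xiMult σ / π) *
      ((resolvent x).im / ((x - ordinate ρ) * (x - ordinate σ))) := by
  have := Real.mul_self_sqrt (im_resolvent_nonneg hRH x)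
  unfold basisFun
  rw [div_mul_div_comm, ← mul_div_assoc]
  congr 1
  linear_combination (√(xiMult ρ / π) * √(xiMult σ / π)) * this

lemma integral_basisFun_mul (hRH : RiemannHypothesis) {ρ σ : XiZero} (h : ρ ≠ σ) :
    ∫ x, basisFun ρ x * basisFun σ x = 0 := by
  simp_rw [basisFun_mul hRH]
  rw [integral_const_mul, (HalfPlane.integral_im_div_eq_zero
    (fun z hz => analyticAt_resolvent hRH hz) (fun z hz => norm_resolvent_le hRH hz)
    ((ordinate_injective hRH).ne h) (resolvent_ordinate hRH ρ) (resolvent_ordinate hRH σ)).2,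
    mul_zero]

lemma integral_basisFun_sq (hRH : RiemannHypothesis) (ρ : XiZero) :
    Integrable (fun x => basisFun ρ x * basisFun ρ x) ∧
      ∫ x, basisFun ρ x * basisFun ρ x = 1 := by
  have hm : (0 : ℝ) < xiMult ρ := by exact_mod_cast xiMult_pos ρ
  have h := HalfPlane.integral_im_div_sq
    (fun z hz => analyticAt_resolvent hRH hz) (fun z hz => norm_resolvent_le hRH hz) hm
    (resolvent_ordinate hRH ρ) (analyticAt_resolvent_ordinate hRH ρ).2
  simp_rw [basisFun_mul hRH]
  refine ⟨h.1.const_mul _, ?_⟩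
  rw [integral_const_mul, h.2, Real.mul_self_sqrt (by positivity)]
  field_simp

lemma hasSum_norm_coeff_sq (hRH : RiemannHypothesis) {t : ℝ} (ht : 0 ≤ t) :
    HasSum (fun ρ => ‖coeff t ρ‖ ^ 2) (-2 * g t) := by
  have h := (Complex.hasSum_re (hasSum_zeroTerm hRH ht)).mul_left (-2)
  rw [ofReal_re] at h
  refine h.congr_fun fun ρ => ?_
  have hγ := ordinate_ne_zero hRH ρ
  have hρ := eq_I_mul_ordinate hRH ρ
  have hm : (0 : ℝ) ≤ xiMult ρ := by positivity
  have hnorm : ‖Complex.exp (ρ * t)‖ = 1 := by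
    rw [hρ, show I * (ordinate ρ : ℂ) * t = ((ordinate ρ * t : ℝ) : ℂ) * I by push_cast; ring,
      Complex.norm_exp_ofReal_mul_I]
  have h1 : ‖Complex.exp (ρ * t) - 1‖ ^ 2 = 2 - 2 * (Complex.exp (ρ * t)).re := by
    have h2 : Complex.normSq (Complex.exp (ρ * t)) = 1 := by
      rw [Complex.normSq_eq_norm_sq, hnorm, one_pow]
    rw [Complex.normSq_apply] at h2
    rw [← Complex.normSq_eq_norm_sq, Complex.normSq_apply]
    simp only [sub_re, sub_im, one_re, one_im]
    linear_combination h2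
  have h3 : zeroTerm ρ t
      = ((xiMult ρ / ordinate ρ ^ 2 : ℝ) : ℂ) * (Complex.exp (ρ * t) - 1) := by
    rw [zeroTerm]
    congr 1
    rw [hρ, mul_pow, I_sq]
    push_cast
    rw [neg_one_mul, div_neg, neg_neg]
  rw [h3, re_ofReal_mul, coeff, norm_mul, norm_div, mul_pow, div_pow, h1, Complex.norm_real,
    Complex.norm_real, Real.norm_eq_abs, Real.norm_eq_abs, sq_abs, sq_abs, Real.sq_sqrt hm,
    sub_re, one_re]
  ring

lemma norm_Sfrak_sq (hRH : RiemannHypothesis) {t x : ℝ} (ht : 0 ≤ t) (hx : xiLine x ≠ 0) :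
    ‖Sfrak t x‖ ^ 2 = ‖(√(resolvent x).im / √π : ℂ) * Pfrak t x‖ ^ 2 := by
  rw [Sfrak, abs_of_nonneg ht, norm_mul, norm_mul, mul_pow, mul_pow, norm_div, norm_mul, norm_I,
    one_mul, div_pow, normSq_one_add_Theta hRH hx, norm_div, div_pow, norm_mul, mul_pow,
    Complex.norm_real, Complex.norm_real, Real.norm_eq_abs, Real.norm_eq_abs, sq_abs, sq_abs,
    Real.sq_sqrt pi_nonneg, Real.sq_sqrt (im_resolvent_nonneg hRH x)]
  have := pi_ne_zero
  norm_num
  left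
  field_simp

theorem integral_norm_Sfrak_sq (hRH : RiemannHypothesis) {t : ℝ} (ht : 0 < t) :
    ∫ x : ℝ, ‖Sfrak t x‖ ^ 2 = -2 * g t := by
  have hae : (fun x : ℝ => ‖Sfrak t x‖ ^ 2) =ᵐ[volume]
      fun x : ℝ => ‖(√(resolvent x).im / √π : ℂ) * Pfrak t x‖ ^ 2 := by
    filter_upwards [ae_xiLine_ne_zero hRH] with x hx using norm_Sfrak_sq hRH ht.le hx
  rw [integral_congr_ae hae, ← (hasSum_norm_coeff_sq hRH ht.le).tsum_eq]
  have hconj : ∀ ρ σ : XiZero, ∀ x : ℝ, (basisFun σ x : ℂ) * (starRingEnd ℂ) (basisFun ρ x : ℂ)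
      = ((basisFun σ x * basisFun ρ x : ℝ) : ℂ) := fun ρ σ x => by
    rw [conj_ofReal, ofReal_mul]
  refine integral_norm_sq_of_orthonormal (e := fun ρ x => (basisFun ρ x : ℂ)) (fun ρ => ?_)
    (fun ρ σ h => ?_) (fun ρ => ?_) (hasSum_norm_coeff_sq hRH ht.le).summable ?_
  · have hmeas := measurable_basisFun hRH ρ
    refine MemLp.ofReal ((memLp_two_iff_integrable_sq hmeas.aestronglyMeasurable).2 ?_)
    simpa only [sq] using (integral_basisFun_sq hRH ρ).1
  · simp_rw [hconj]
    rw [integral_complex_ofReal, integral_basisFun_mul hRH h.symm, ofReal_zero]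
  · simp_rw [hconj]
    rw [integral_complex_ofReal, (integral_basisFun_sq hRH ρ).2, ofReal_one]
  · have h0 : ∀ᵐ x : ℝ, x ≠ 0 := by simp [ae_iff]
    filter_upwards [ae_xiLine_ne_zero hRH, h0] with x hx hx0
    have h := (hasSum_Pfrak hRH hx0 hx ht).mul_left (√(resolvent x).im / √π : ℂ)
    refine h.congr_fun fun ρ => ?_
    have hρ := eq_I_mul_ordinate hRH ρ
    have hγ : (ordinate ρ : ℂ) ≠ 0 := by exact_mod_cast ordinate_ne_zero hRH ρ
    have hxγ : (x : ℂ) - ordinate ρ ≠ 0 := by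
      intro h0
      rw [sub_eq_zero.1 h0] at hx
      exact hx (xiLine_ordinate hRH ρ)
    have hm : (√(xiMult ρ : ℝ) : ℂ) * √(xiMult ρ : ℝ) = xiMult ρ := by
      rw [← ofReal_mul, Real.mul_self_sqrt (by positivity), ofReal_natCast]
    have hden : (ρ : ℂ) * (ρ - I * x) = ordinate ρ * (x - ordinate ρ) := by
      rw [hρ]
      linear_combination ((ordinate ρ : ℂ) * (ordinate ρ - x)) * I_sq
    have hpi : (√π : ℂ) ≠ 0 := by exact_mod_cast (Real.sqrt_pos.2 pi_pos).ne'
    rw [hden, coeff, basisFun, Real.sqrt_div (by positivity), ← hm]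
    push_cast
    field_simp

end XiLine

/-- RH holds iff `‖𝔖_t‖²_{L²(ℝ)} = -2 g(t)` for all `t ≥ t₀`, for some `t₀ ≥ 0`. -/
theorem statement3 :
    RiemannHypothesis ↔
      ∃ t₀ : ℝ, 0 ≤ t₀ ∧ ∀ t : ℝ, t₀ ≤ t →
        (∫ x : ℝ, ‖Sfrak t (x : ℂ)‖ ^ 2) = -2 * g t := by
  constructor
  · intro hRH
    exact ⟨1, zero_le_one, fun t ht =>
      XiLine.integral_norm_Sfrak_sq hRH (zero_lt_one.trans_le ht)⟩
  · rintro ⟨t₀, -, h⟩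
    refine riemannHypothesis_of_xiEntire_ne_zero fun p hp =>
      Landau.xiEntire_ne_zero_of_g_nonpos (t₀ := t₀) (fun t ht => ?_) hp
    have h1 : 0 ≤ ∫ x : ℝ, ‖Sfrak t (x : ℂ)‖ ^ 2 := integral_nonneg fun x => by positivity
    rw [h t ht] at h1
    linarith
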